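/- For every real δ > 0 there exists ε = ε(δ) > 0 such that for every prime p and every symmetric generating set S of G = SL(2,p): if the girth of the Cayley graph Cay(G,S) is at least δ·log p, then Cay(G,S) is an ε-expander, i.e. for every subset A of G with |A| < |G|/2 one has |(S·A) \ A| ≥ ε·|A|. -/

import Mathlib

open scoped MatrixGroups Pointwise

/-- The Cayley graph of a group `G` with respect to a (symmetric) set `S` of
generators: `x` and `y` are adjacent iff `x = s * y` for some `s ∈ S`. -/
def cayleyGraph (G : Type*) [Group G] (S : Set G) : SimpleGraph G :=
  SimpleGraph.fromRel fun x y => ∃ s ∈ S, x = s * y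

namespace BourgainGamburd

open Finset

section Walk

variable {Γ Δ : Type*} [Group Γ] [Group Δ]

/-- The generator or inverse generator named by a letter of the free group on `Bool`. -/
def letter (a : Bool → Γ) (i : Bool × Bool) : Γ := cond i.2 (a i.1) (a i.1)⁻¹

lemma letter_not (a : Bool → Γ) (i : Bool × Bool) : letter a (i.1, !i.2) = (letter a i)⁻¹ := by
  rcases i with ⟨i, _ | _⟩ <;> simp [letter]

/-- The mean of `F` over the `n`-th step of the simple random walk with steps
`a false`, `a true` and their inverses. -/
noncomputable def walkMean (a : Bool → Γ) : ℕ → (Γ → ℝ) → ℝ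
  | 0, F => F 1
  | n + 1, F => (∑ i, walkMean a n fun x => F (letter a i * x)) / 4

variable (a : Bool → Γ)

lemma walkMean_succ (n : ℕ) (F : Γ → ℝ) :
    walkMean a (n + 1) F = (∑ i, walkMean a n fun x => F (letter a i * x)) / 4 := rfl

lemma walkMean_mono (n : ℕ) {F F' : Γ → ℝ} (h : ∀ x, F x ≤ F' x) :
    walkMean a n F ≤ walkMean a n F' := by
  induction n generalizing F F' with
  | zero => exact h 1
  | succ n ih =>
    rw [walkMean_succ, walkMean_succ]
    gcongr with i
    exact ih fun x => h _

lemma walkMean_const (n : ℕ) (c : ℝ) : walkMean a n (fun _ => c) = c := by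
  induction n with
  | zero => rfl
  | succ n ih => rw [walkMean_succ, ih]; simp

lemma walkMean_nonneg (n : ℕ) {F : Γ → ℝ} (h : ∀ x, 0 ≤ F x) : 0 ≤ walkMean a n F := by
  simpa [walkMean_const] using walkMean_mono a n h

lemma walkMean_sum {ι : Type*} (n : ℕ) (s : Finset ι) (F : ι → Γ → ℝ) :
    walkMean a n (fun x => ∑ i ∈ s, F i x) = ∑ i ∈ s, walkMean a n (F i) := by
  induction n generalizing F with
  | zero => rfl
  | succ n ih =>
    simp only [walkMean_succ, ih]
    rw [Finset.sum_comm, Finset.sum_div]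

lemma walkMean_mul_const (n : ℕ) (F : Γ → ℝ) (c : ℝ) :
    walkMean a n (fun x => F x * c) = walkMean a n F * c := by
  induction n generalizing F with
  | zero => rfl
  | succ n ih =>
    simp only [walkMean_succ]
    simp only [fun i => ih fun x => F (letter a i * x)]
    rw [← Finset.sum_mul]
    ring

lemma letter_comp (φ : Γ →* Δ) (i : Bool × Bool) : letter (φ ∘ a) i = φ (letter a i) := by
  rcases i with ⟨i, _ | _⟩ <;> simp [letter]

lemma walkMean_map (φ : Γ →* Δ) (n : ℕ) (F : Δ → ℝ) :
    walkMean (φ ∘ a) n F = walkMean a n (F ∘ φ) := by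
  induction n generalizing F with
  | zero => simp [walkMean]
  | succ n ih =>
    simp only [walkMean_succ, ih, letter_comp]
    congr 1
    exact Finset.sum_congr rfl fun i _ => by congr 1; ext x; simp

lemma walkMean_add (m n : ℕ) (F : Γ → ℝ) :
    walkMean a (m + n) F = walkMean a m fun x => walkMean a n fun y => F (x * y) := by
  induction m generalizing F with
  | zero => simp [walkMean]
  | succ m ih =>
    rw [Nat.add_right_comm, walkMean_succ, walkMean_succ]
    simp only [ih, mul_assoc]

lemma walkMean_inv (n : ℕ) (F : Γ → ℝ) : walkMean a n (fun x => F x⁻¹) = walkMean a n F := by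
  induction n generalizing F with
  | zero => simp [walkMean]
  | succ n ih =>
    have h1 : walkMean a (n + 1) F = (∑ i, walkMean a n fun x => F (x * letter a i)) / 4 := by
      rw [walkMean_add a n 1 F]
      simp only [walkMean, mul_one, div_eq_mul_inv]
      rw [walkMean_mul_const, walkMean_sum]
    have h2 : ∀ i, walkMean a n (fun x => F (letter a i * x)⁻¹) =
        walkMean a n fun x => F (x * letter a (i.1, !i.2)) := by
      intro i
      rw [← ih fun x => F (x * letter a (i.1, !i.2))]
      simp [letter_not]
    rw [h1, walkMean_succ]
    simp only [h2]
    congr 1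
    exact Fintype.sum_equiv ⟨fun i => (i.1, !i.2), fun i => (i.1, !i.2), fun i => by simp,
      fun i => by simp⟩ _ _ fun i => rfl

open Classical in
/-- The density of the `n`-th step of the random walk. -/
noncomputable def walk (n : ℕ) (x : Γ) : ℝ := walkMean a n fun y => if y = x then 1 else 0

lemma walk_zero [DecidableEq Γ] (x : Γ) : walk a 0 x = if x = 1 then 1 else 0 := by
  simp [walk, walkMean, eq_comm]

lemma walk_succ (n : ℕ) (x : Γ) : walk a (n + 1) x = (∑ i, walk a n ((letter a i)⁻¹ * x)) / 4 := by
  simp only [walk, walkMean_succ]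
  congr! 5
  rw [eq_inv_mul_iff_mul_eq]

lemma walk_nonneg (n : ℕ) (x : Γ) : 0 ≤ walk a n x :=
  walkMean_nonneg a n fun y => by split_ifs <;> norm_num

lemma walk_inv (n : ℕ) (x : Γ) : walk a n x⁻¹ = walk a n x := by
  classical
  simp only [walk]
  rw [← walkMean_inv a n fun y => if y = x then 1 else 0]
  congr! 3
  rw [inv_eq_iff_eq_inv]

lemma sum_walk_mul [Fintype Γ] (n : ℕ) (F : Γ → ℝ) :
    ∑ x, walk a n x * F x = walkMean a n F := by
  classical
  simp_rw [walk, ← walkMean_mul_const]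
  rw [← walkMean_sum]
  congr 1
  ext y
  simp

lemma sum_walk [Fintype Γ] (n : ℕ) : ∑ x, walk a n x = 1 := by
  simpa [walkMean_const] using sum_walk_mul a n fun _ => 1

lemma walk_add [Fintype Γ] (m n : ℕ) (x : Γ) :
    walk a (m + n) x = ∑ y, walk a m y * walk a n (y⁻¹ * x) := by
  rw [sum_walk_mul a m fun y => walk a n (y⁻¹ * x), walk, walkMean_add]
  simp only [walk]
  congr! 4
  rw [eq_inv_mul_iff_mul_eq]

end Walk

section FreeGroup

open FreeGroup

lemma letter_of (i : Bool × Bool) : letter FreeGroup.of i = FreeGroup.mk [i] := by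
  rcases i with ⟨i, _ | _⟩ <;> simp [letter, FreeGroup.of, FreeGroup.invRev]

lemma toWord_letter_inv_mul (i : Bool × Bool) (w : FreeGroup Bool) :
    ((letter FreeGroup.of i)⁻¹ * w).toWord = reduce ((i.1, !i.2) :: w.toWord) := by
  rw [← letter_not, letter_of]
  conv_lhs => rw [← mk_toWord (x := w), mul_mk, toWord_mk]
  rfl

lemma sum_inv_sqrt_three_pow_norm_le (w : FreeGroup Bool) :
    (∑ i, (√3)⁻¹ ^ ((letter FreeGroup.of i)⁻¹ * w).norm) / 4 ≤ √3 / 2 * (√3)⁻¹ ^ w.norm := by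
  have h3 : √3 * √3 = 3 := Real.mul_self_sqrt (by norm_num)
  have hpos : 0 < √3 := Real.sqrt_pos.2 (by norm_num)
  have hi : (√3)⁻¹ = √3 / 3 := by field_simp; linarith
  simp only [FreeGroup.norm, toWord_letter_inv_mul, reduce.cons, reduce_toWord]
  rcases h : w.toWord with _ | ⟨⟨c, d⟩, L⟩
  · simp [hi]
    nlinarith
  · have e : √3 * (√3)⁻¹ = 1 := mul_inv_cancel₀ hpos.ne'
    have e2 : (√3)⁻¹ ^ (L.length + 2) = √3 / 3 * (√3)⁻¹ ^ (L.length + 1) := by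
      rw [pow_succ _ (L.length + 1), hi]; ring
    rcases c with _ | _ <;> rcases d with _ | _ <;>
    · simp [Fintype.sum_prod_type]
      rw [← inv_pow, ← inv_pow, e2]
      apply le_of_eq
      linear_combination (-(1 / 4) * (√3)⁻¹ ^ L.length) * e

lemma walk_freeGroup_le (n : ℕ) (w : FreeGroup Bool) :
    walk FreeGroup.of n w ≤ (√3 / 2) ^ n * (√3)⁻¹ ^ w.norm := by
  induction n generalizing w with
  | zero =>
    classical
    rw [walk_zero]
    split_ifs with h
    · simp [h]
    · positivity
  | succ n ih =>
    rw [walk_succ]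
    calc (∑ i, walk FreeGroup.of n ((letter FreeGroup.of i)⁻¹ * w)) / 4
        ≤ (∑ i, (√3 / 2) ^ n * (√3)⁻¹ ^ ((letter FreeGroup.of i)⁻¹ * w).norm) / 4 := by
          gcongr with i
          exact ih _
      _ = (√3 / 2) ^ n * ((∑ i, (√3)⁻¹ ^ ((letter FreeGroup.of i)⁻¹ * w).norm) / 4) := by
          rw [← Finset.mul_sum]; ring
      _ ≤ (√3 / 2) ^ n * (√3 / 2 * (√3)⁻¹ ^ w.norm) := by
          gcongr
          exact sum_inv_sqrt_three_pow_norm_le w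
      _ = _ := by ring

lemma walk_freeGroup_le' (n : ℕ) (w : FreeGroup Bool) :
    walk FreeGroup.of n w ≤ (√3 / 2) ^ n := by
  refine (walk_freeGroup_le n w).trans (mul_le_of_le_one_right (by positivity) ?_)
  exact pow_le_one₀ (by positivity) (inv_le_one_of_one_le₀ (Real.one_le_sqrt.2 (by norm_num)))

lemma norm_letter (i : Bool × Bool) : (letter FreeGroup.of i).norm = 1 := by
  rw [letter_of]; simp [FreeGroup.norm]

lemma walkMean_freeGroup_congr (n : ℕ) {F F' : FreeGroup Bool → ℝ}
    (h : ∀ w : FreeGroup Bool, w.norm ≤ n → F w = F' w) :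
    walkMean FreeGroup.of n F = walkMean FreeGroup.of n F' := by
  induction n generalizing F F' with
  | zero => exact h 1 (by simp)
  | succ n ih =>
    rw [walkMean_succ, walkMean_succ]
    congr 1
    refine Finset.sum_congr rfl fun i _ => ih fun w hw => h _ ?_
    have := norm_mul_le (letter FreeGroup.of i) w
    rw [norm_letter] at this
    omega

/-- The probability that the walk on the free group lies in a set whose elements of norm at most
`n` are contained in a finite set `X`. -/
lemma walkMean_freeGroup_indicator_le (n : ℕ) (P : FreeGroup Bool → Prop) [DecidablePred P]
    (X : Finset (FreeGroup Bool)) (hX : ∀ w : FreeGroup Bool, w.norm ≤ n → P w → w ∈ X) :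
    walkMean FreeGroup.of n (fun w => if P w then 1 else 0) ≤ X.card * (√3 / 2) ^ n := by
  classical
  have h1 : walkMean FreeGroup.of n (fun w => if P w then 1 else 0) ≤
      walkMean FreeGroup.of n (fun w => ∑ x ∈ X, if w = x then 1 else 0) := by
    rw [walkMean_freeGroup_congr n (F := fun w => if P w then 1 else 0)
      (F' := fun w => if P w ∧ w.norm ≤ n then 1 else 0) (fun w hw => by simp [hw])]
    refine walkMean_mono _ _ fun w => ?_
    rw [Finset.sum_ite_eq]
    by_cases h : P w ∧ w.norm ≤ n
    · simp [h, hX w h.2 h.1]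
    · simp only [h, if_false]
      split_ifs <;> norm_num
  refine h1.trans ?_
  rw [walkMean_sum, ← nsmul_eq_mul]
  refine Finset.sum_le_card_nsmul _ _ _ fun x _ => ?_
  refine le_trans (le_of_eq ?_) (walk_freeGroup_le' n x)
  simp only [walk]
  congr! 3

end FreeGroup

end BourgainGamburd

namespace BourgainGamburd

open FreeGroup
open scoped commutatorElement

section Centralizers

variable {α : Type*}

lemma subsingleton_of_central_ne_one {x : FreeGroup α} (hx : x ≠ 1)
    (hc : ∀ y, Commute x y) : Subsingleton α := by
  classical
  by_contra hns
  rw [not_subsingleton_iff_nontrivial] at hns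
  rcases h : x.toWord with _ | ⟨⟨c, d⟩, L⟩
  · exact hx (toWord_eq_nil_iff.1 h)
  obtain ⟨b, hb⟩ := exists_ne c
  have h1 : (of b * x).toWord = (b, true) :: (c, d) :: L := by
    rw [toWord_mul, toWord_of, h, List.singleton_append, reduce.cons, ← h, reduce_toWord, h]
    simp [hb]
  have h2 := congr_arg toWord (hc (of b)).eq
  rw [h1] at h2
  have h3 := toWord_mul_sublist x (of b)
  rw [h2, toWord_of, h] at h3
  have h4 := h3.length_le
  have h5 := h3.eq_of_length (by simp)
  simp at h5
  exact hb h5.1.1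

lemma isCyclic_of_central_ne_one {H : Type*} [Group H] [IsFreeGroup H] {x : H} (hx : x ≠ 1)
    (hc : ∀ y, Commute x y) : IsCyclic H := by
  let e := IsFreeGroup.toFreeGroup H
  have hx' : e x ≠ 1 := by simpa using hx
  have hs : Subsingleton (IsFreeGroup.Generators H) :=
    subsingleton_of_central_ne_one hx' fun y => by
      have := (hc (e.symm y)).map e
      simpa using this
  have hne : Nonempty (IsFreeGroup.Generators H) := by
    by_contra h
    rw [not_nonempty_iff] at h
    exact hx' (Subsingleton.elim _ _)
  have : Unique (IsFreeGroup.Generators H) :=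
    ⟨⟨hne.some⟩, fun _ => Subsingleton.elim _ _⟩
  exact isCyclic_of_surjective e.symm e.symm.surjective

lemma exists_generator_of_commute {x : FreeGroup α} (hx : x ≠ 1) :
    ∃ r, Commute x r ∧ ∀ y, Commute x y → ∃ k : ℤ, r ^ k = y := by
  have hc : IsCyclic (Subgroup.centralizer {x}) := by
    refine isCyclic_of_central_ne_one
      (x := ⟨x, by simp [Subgroup.mem_centralizer_singleton_iff]⟩) (by simpa using hx) ?_
    rintro ⟨y, hy⟩
    rw [Subgroup.mem_centralizer_singleton_iff] at hy
    exact Subtype.ext hy.symm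
  obtain ⟨⟨r, hr⟩, hgen⟩ := hc.exists_generator
  refine ⟨r, (Subgroup.mem_centralizer_singleton_iff.1 hr).symm, fun y hy => ?_⟩
  obtain ⟨k, hk⟩ := hgen ⟨y, Subgroup.mem_centralizer_singleton_iff.2 hy.eq.symm⟩
  exact ⟨k, congr_arg Subtype.val hk⟩

lemma commute_trans {x y z : FreeGroup α} (hx : x ≠ 1) (hy : Commute x y) (hz : Commute x z) :
    Commute y z := by
  obtain ⟨r, -, hr⟩ := exists_generator_of_commute hx
  obtain ⟨k, rfl⟩ := hr y hy
  obtain ⟨l, rfl⟩ := hr z hz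
  exact (Commute.refl r).zpow_zpow k l

lemma commute_of_commute_conj {u a : FreeGroup α} (hu : u ≠ 1) (h : Commute u (a * u * a⁻¹)) :
    Commute u a := by
  obtain ⟨r, hur, hr⟩ := exists_generator_of_commute hu
  set v := a * u * a⁻¹ with hv
  have hv1 : v ≠ 1 := by simpa [hv, conj_eq_one_iff] using hu
  have conj_iff : ∀ y z : FreeGroup α, Commute y z → Commute (a * y * a⁻¹) (a * z * a⁻¹) :=
    fun y z h => h.map (MulAut.conj a)
  have conj_iff' : ∀ y z : FreeGroup α, Commute y z → Commute (a⁻¹ * y * a) (a⁻¹ * z * a) := by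
    intro y z h
    simpa using h.map (MulAut.conj a⁻¹)
  obtain ⟨m, hm⟩ := hr (a * r * a⁻¹) (commute_trans hv1 h.symm (conj_iff _ _ hur))
  obtain ⟨k, hk⟩ := hr (a⁻¹ * r * a) (by
    have := conj_iff' _ _ (commute_trans hu hur h).symm
    simpa [hv, mul_assoc] using this)
  have hr1 : r ≠ 1 := by
    rintro rfl
    obtain ⟨k, hk⟩ := hr u (Commute.refl u)
    exact hu (by simpa using hk.symm)
  have hmk : m * k = 1 := by
    have h1 : r ^ (m * k) = r ^ (1 : ℤ) := by
      rw [zpow_mul, hm, conj_zpow, hk]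
      group
    have : Function.Injective fun n : ℤ => r ^ n := by
      rw [injective_zpow_iff_not_isOfFinOrder]
      intro hf
      exact hr1 ((isOfFinOrder_iff_eq_one _).1 hf)
    exact this h1
  have har : Commute r a := by
    rcases Int.eq_one_or_neg_one_of_mul_eq_one hmk with rfl | rfl
    · have : a * r = r * a := by
        rw [zpow_one] at hm
        rw [eq_mul_inv_iff_mul_eq] at hm
        exact hm.symm
      exact this.symm
    · by_cases ha : a = 1
      · subst ha; exact Commute.one_right r
      have ha2 : a ^ 2 ≠ 1 := by
        intro h2
        exact ha ((isOfFinOrder_iff_eq_one _).1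
          (isOfFinOrder_iff_pow_eq_one.2 ⟨2, by norm_num, h2⟩))
      have h2 : Commute (a ^ 2) r := by
        have e1 : a * r = r⁻¹ * a := by
          rw [zpow_neg_one, eq_mul_inv_iff_mul_eq] at hm
          exact hm.symm
        have e2 : a * r⁻¹ = r * a := by
          rw [mul_inv_eq_iff_eq_mul, mul_assoc, e1, mul_inv_cancel_left]
        show a ^ 2 * r = r * a ^ 2
        rw [pow_two, mul_assoc, e1, ← mul_assoc, e2, mul_assoc]
      exact commute_trans ha2 h2 ((Commute.refl a).pow_left 2)
  obtain ⟨k, rfl⟩ := hr u (Commute.refl u)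
  exact har.zpow_left k

lemma commute_of_commutator_commute {a b : FreeGroup α}
    (ha : Commute ⁅a, b⁆ (a * ⁅a, b⁆ * a⁻¹)) (hb : Commute ⁅a, b⁆ (b * ⁅a, b⁆ * b⁻¹)) :
    Commute a b := by
  by_cases h : ⁅a, b⁆ = 1
  · exact commutatorElement_eq_one_iff_commute.1 h
  · exact commute_trans h (commute_of_commute_conj h ha) (commute_of_commute_conj h hb)

lemma le_norm_pow [DecidableEq α] {r : FreeGroup α} (hr : r ≠ 1) (n : ℕ) : n ≤ (r ^ n).norm := by
  rcases n with _ | n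
  · simp
  have hpos : 1 ≤ (reduceCyclically r.toWord).length := by
    by_contra! h
    have h0 : reduceCyclically r.toWord = [] := List.length_eq_zero_iff.1 (by omega)
    have h1 := reduceCyclically.conj_conjugator_reduceCyclically r.toWord
    rw [h0, List.append_nil] at h1
    have h2 : FreeGroup.mk r.toWord = 1 := by
      rw [← h1, ← mul_mk, ← inv_mk, mul_inv_cancel]
    exact hr (by rwa [mk_toWord] at h2)
  rw [FreeGroup.norm, toWord_pow,
    reduceCyclically.reduce_flatten_replicate_succ isReduced_toWord]
  simp only [List.length_append, List.length_flatten, List.map_replicate, List.sum_replicate,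
    smul_eq_mul]
  nlinarith

lemma natAbs_le_norm_zpow [DecidableEq α] {r : FreeGroup α} (hr : r ≠ 1) (k : ℤ) :
    k.natAbs ≤ (r ^ k).norm := by
  rcases Int.natAbs_eq k with h | h
  · rw [h, zpow_natCast, Int.natAbs_natCast]; exact le_norm_pow hr _
  · rw [h, zpow_neg, norm_inv_eq, zpow_natCast, Int.natAbs_neg, Int.natAbs_natCast]
    exact le_norm_pow hr _

/-- Pairwise commuting elements of norm at most `m` in a free group are few. -/
lemma exists_finset_of_commute [DecidableEq α] (m : ℕ) (X : Set (FreeGroup α))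
    (hX : ∀ w ∈ X, w.norm ≤ m) (hc : ∀ w ∈ X, ∀ w' ∈ X, Commute w w') :
    ∃ Y : Finset (FreeGroup α), X ⊆ Y ∧ Y.card ≤ 2 * m + 1 := by
  by_cases h : ∃ x ∈ X, x ≠ 1
  · obtain ⟨x, hxX, hx⟩ := h
    obtain ⟨r, -, hr⟩ := exists_generator_of_commute hx
    have hr1 : r ≠ 1 := by
      rintro rfl
      obtain ⟨k, hk⟩ := hr x (Commute.refl x)
      exact hx (by simpa using hk.symm)
    refine ⟨(Finset.Icc (-m : ℤ) m).image fun k => r ^ k, fun y hy => ?_, ?_⟩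
    · obtain ⟨k, rfl⟩ := hr y (hc x hxX y hy)
      have h1 := natAbs_le_norm_zpow hr1 k
      have h2 := hX _ hy
      simp only [Finset.coe_image, Set.mem_image, Finset.mem_coe, Finset.mem_Icc]
      exact ⟨k, by omega, rfl⟩
    · refine Finset.card_image_le.trans ?_
      rw [Int.card_Icc]
      omega
  · push Not at h
    exact ⟨{1}, fun y hy => by simp [h y hy], by simp⟩

end Centralizers

section NonConcentration

variable {Γ : Type*} [Group Γ]

/-- A subgroup is metabelian if its commutators commute. -/
def IsMetabelian (H : Subgroup Γ) : Prop :=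
  ∀ a ∈ H, ∀ b ∈ H, ∀ c ∈ H, ∀ d ∈ H, Commute ⁅a, b⁆ ⁅c, d⁆

lemma eq_comp_lift (a : Bool → Γ) : a = FreeGroup.lift a ∘ FreeGroup.of := by
  ext i; simp

lemma norm_commutator_le {α : Type*} [DecidableEq α] (a b : FreeGroup α) :
    ⁅a, b⁆.norm ≤ 2 * a.norm + 2 * b.norm := by
  rw [commutatorElement_def]
  have h1 := norm_mul_le (a * b * a⁻¹) b⁻¹
  have h2 := norm_mul_le (a * b) a⁻¹
  have h3 := norm_mul_le a b
  simp only [norm_inv_eq] at *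
  omega

lemma norm_conj_le {α : Type*} [DecidableEq α] (a b : FreeGroup α) :
    (a * b * a⁻¹).norm ≤ 2 * a.norm + b.norm := by
  have h2 := norm_mul_le (a * b) a⁻¹
  have h3 := norm_mul_le a b
  simp only [norm_inv_eq] at *
  omega

lemma walkMean_metabelian_le (a : Bool → Γ) (H : Subgroup Γ) [DecidablePred (· ∈ H)]
    (hH : IsMetabelian H) (m : ℕ)
    (hrel : ∀ w : FreeGroup Bool, w ≠ 1 → w.norm ≤ 20 * m → FreeGroup.lift a w ≠ 1) :
    walkMean a m (fun x => if x ∈ H then 1 else 0) ≤ (2 * m + 1) * (√3 / 2) ^ m := by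
  set φ := FreeGroup.lift a with hφ
  have hcomm : ∀ x y : FreeGroup Bool, x.norm + y.norm ≤ 10 * m → Commute (φ x) (φ y) →
      Commute x y := by
    intro x y hxy h
    rw [← commutatorElement_eq_one_iff_commute]
    by_contra hne
    refine hrel _ hne ((norm_commutator_le x y).trans (by omega)) ?_
    rw [map_commutatorElement]
    exact commutatorElement_eq_one_iff_commute.2 h
  obtain ⟨Y, hY, hcard⟩ := exists_finset_of_commute m {w | φ w ∈ H ∧ w.norm ≤ m}
    (fun w hw => hw.2) (by
      rintro x ⟨hx, hxm⟩ y ⟨hy, hym⟩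
      have h1 := norm_commutator_le x y
      have h2 := norm_conj_le x ⁅x, y⁆
      have h3 := norm_conj_le y ⁅x, y⁆
      refine commute_of_commutator_commute (hcomm _ _ (by omega) ?_) (hcomm _ _ (by omega) ?_)
      · have e : φ (x * ⁅x, y⁆ * x⁻¹) = ⁅φ x, φ x * φ y * (φ x)⁻¹⁆ := by
          simp [commutatorElement_def, mul_assoc]
        rw [e, map_commutatorElement]
        exact hH _ hx _ hy _ hx _ (H.mul_mem (H.mul_mem hx hy) (H.inv_mem hx))
      · have e : φ (y * ⁅x, y⁆ * y⁻¹) = ⁅φ y * φ x * (φ y)⁻¹, φ y⁆ := by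
          simp [commutatorElement_def, mul_assoc]
        rw [e, map_commutatorElement]
        exact hH _ hx _ hy _ (H.mul_mem (H.mul_mem hy hx) (H.inv_mem hy)) _ hy)
  rw [eq_comp_lift a, walkMean_map]
  refine (walkMean_freeGroup_indicator_le m (fun w => φ w ∈ H) Y
    fun w hw hwH => hY ⟨hwH, hw⟩).trans ?_
  gcongr
  exact_mod_cast hcard

end NonConcentration

end BourgainGamburd

namespace BourgainGamburd

open Finset
open scoped commutatorElement

section BalogSzemerediGowers

lemma card_mul_le_card_of_fibers {α β : Type*} [DecidableEq β] (T : Finset α) (Y : Finset β)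
    (f : α → β) (t : ℝ) (h : ∀ y ∈ Y, t ≤ #{x ∈ T | f x = y}) : #Y * t ≤ #T := by
  have h1 : ∑ y ∈ Y, #{x ∈ T | f x = y} ≤ #T := by
    rw [Finset.sum_card_fiberwise_eq_card_filter]
    exact card_filter_le _ _
  calc #Y * t = ∑ y ∈ Y, t := by simp
    _ ≤ ∑ y ∈ Y, (#{x ∈ T | f x = y} : ℝ) := sum_le_sum h
    _ ≤ #T := by exact_mod_cast h1

lemma le_sum_popular {ι : Type*} [Fintype ι] (r : ι → ℝ) (N K : ℝ) (hN : 0 < N) (hK : 0 < K)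
    (h0 : ∀ x, 0 ≤ r x) (hr : ∀ x, r x ≤ N) (hs : ∑ x, r x ≤ N ^ 2)
    (hE : N ^ 3 / K ≤ ∑ x, r x ^ 2) :
    N ^ 2 / (2 * K) ≤ ∑ x with N / (2 * K) ≤ r x, r x := by
  have h1 := sum_filter_add_sum_filter_not univ (fun x => N / (2 * K) ≤ r x) fun x => r x ^ 2
  have h2 : ∑ x with N / (2 * K) ≤ r x, r x ^ 2 ≤ N * ∑ x with N / (2 * K) ≤ r x, r x := by
    rw [mul_sum]
    refine sum_le_sum fun x _ => ?_
    nlinarith [h0 x, hr x]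
  have h3 : ∑ x with ¬ N / (2 * K) ≤ r x, r x ^ 2 ≤ N / (2 * K) * N ^ 2 := by
    calc ∑ x with ¬ N / (2 * K) ≤ r x, r x ^ 2
        ≤ ∑ x with ¬ N / (2 * K) ≤ r x, N / (2 * K) * r x := by
          refine sum_le_sum fun x hx => ?_
          have := (mem_filter.1 hx).2
          nlinarith [h0 x]
      _ ≤ ∑ x, N / (2 * K) * r x :=
          sum_le_sum_of_subset_of_nonneg (filter_subset _ _) fun x _ _ =>
            mul_nonneg (by positivity) (h0 x)
      _ ≤ _ := by rw [← mul_sum]; gcongr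
  have h4 : N * (N ^ 2 / (2 * K)) ≤ N * ∑ x with N / (2 * K) ≤ r x, r x := by
    have : N * (N ^ 2 / (2 * K)) = N ^ 3 / K - N / (2 * K) * N ^ 2 := by
      field_simp; ring
    linarith
  exact le_of_mul_le_mul_left h4 hN

/-- Dependent random choice: a dense relation on `A` has a neighbourhood most of whose pairs have
many common neighbours. -/
lemma exists_dense_neighbourhood {α : Type*} [DecidableEq α] (A : Finset α) (E : α → α → Prop)
    [∀ a b, Decidable (E a b)] (K : ℝ) (hK : 0 < K) (hA : A.Nonempty)
    (hE : (#A : ℝ) ^ 2 / (2 * K) ≤ ∑ v ∈ A, (#{a ∈ A | E a v} : ℝ)) :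
    ∃ B₀ ⊆ A, ∃ B ⊆ B₀, (#A : ℝ) / (3 * K) ≤ #B₀ ∧ 3 / 4 * (#B₀ : ℝ) ≤ #B ∧
      ∀ b ∈ B, (#{c ∈ B₀ | (#{w ∈ A | E b w ∧ E c w} : ℝ) < #A / (128 * K ^ 2)} : ℝ) ≤
        #B₀ / 4 := by
  set N : ℝ := (#A : ℝ) with hN
  have hNpos : 0 < N := by rw [hN]; exact_mod_cast hA.card_pos
  set nb : α → Finset α := fun v => {a ∈ A | E a v} with hnb
  set bad : α → α → Prop := fun b c =>
    (#{w ∈ A | E b w ∧ E c w} : ℝ) < N / (128 * K ^ 2) with hbad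
  classical
  have h1 : ∑ v ∈ A, (#{x ∈ nb v ×ˢ nb v | bad x.1 x.2} : ℝ) ≤ N / (128 * K ^ 2) * N ^ 2 := by
    have e : ∑ v ∈ A, #{x ∈ nb v ×ˢ nb v | bad x.1 x.2} =
        ∑ x ∈ A ×ˢ A with bad x.1 x.2, #{w ∈ A | E x.1 w ∧ E x.2 w} := by
      refine Eq.trans ?_ (sum_card_bipartiteAbove_eq_sum_card_bipartiteBelow
        (fun v (x : α × α) => E x.1 v ∧ E x.2 v))
      refine sum_congr rfl fun v _ => congr_arg card ?_
      ext x
      simp only [bipartiteAbove, nb, mem_filter, mem_product]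
      tauto
    have e' : ∑ v ∈ A, (#{x ∈ nb v ×ˢ nb v | bad x.1 x.2} : ℝ) =
        ∑ x ∈ A ×ˢ A with bad x.1 x.2, (#{w ∈ A | E x.1 w ∧ E x.2 w} : ℝ) := by exact_mod_cast e
    rw [e']
    calc _ ≤ ∑ x ∈ A ×ˢ A with bad x.1 x.2, N / (128 * K ^ 2) :=
          sum_le_sum fun x hx => (mem_filter.1 hx).2.le
      _ ≤ ∑ x ∈ A ×ˢ A, N / (128 * K ^ 2) :=
          sum_le_sum_of_subset_of_nonneg (filter_subset _ _) fun _ _ _ => by positivity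
      _ = _ := by rw [sum_const, card_product, nsmul_eq_mul, Nat.cast_mul]; ring
  have h2 : N ^ 3 / (4 * K ^ 2) ≤ ∑ v ∈ A, (#(nb v) : ℝ) ^ 2 := by
    have := sq_sum_le_card_mul_sum_sq (s := A) (f := fun v => (#(nb v) : ℝ))
    have h3 : (N ^ 2 / (2 * K)) ^ 2 ≤ N * ∑ v ∈ A, (#(nb v) : ℝ) ^ 2 :=
      (pow_le_pow_left₀ (by positivity) hE 2).trans this
    refine le_of_mul_le_mul_left ((le_of_eq ?_).trans h3) hNpos
    field_simp; ring
  obtain ⟨v, hv, hvle⟩ : ∃ v ∈ A, N ^ 2 / (8 * K ^ 2) ≤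
      (#(nb v) : ℝ) ^ 2 - 16 * #{x ∈ nb v ×ˢ nb v | bad x.1 x.2} := by
    apply exists_le_of_sum_le hA
    rw [sum_const, nsmul_eq_mul, sum_sub_distrib, ← mul_sum, ← hN]
    have : N * (N ^ 2 / (8 * K ^ 2)) = N ^ 3 / (4 * K ^ 2) - 16 * (N / (128 * K ^ 2) * N ^ 2) := by
      field_simp; ring
    linarith
  refine ⟨nb v, filter_subset _ _,
    {b ∈ nb v | (#{c ∈ nb v | bad b c} : ℝ) ≤ #(nb v) / 4}, filter_subset _ _, ?_, ?_,
    fun b hb => (mem_filter.1 hb).2⟩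
  · refine le_of_sq_le_sq ?_ (by positivity)
    have : (N / (3 * K)) ^ 2 ≤ N ^ 2 / (8 * K ^ 2) := by
      rw [div_pow, mul_pow]
      gcongr; norm_num
    have h5 : (0 : ℝ) ≤ #{x ∈ nb v ×ˢ nb v | bad x.1 x.2} := by positivity
    linarith
  · have h5 := card_filter_add_card_filter_not (s := nb v)
      fun b => (#{c ∈ nb v | bad b c} : ℝ) ≤ #(nb v) / 4
    have h6 : (#{b ∈ nb v | ¬ (#{c ∈ nb v | bad b c} : ℝ) ≤ #(nb v) / 4} : ℝ) *
        (#(nb v) / 4) ≤ #{x ∈ nb v ×ˢ nb v | bad x.1 x.2} := by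
      refine card_mul_le_card_of_fibers _ _ Prod.fst _ fun b hb => ?_
      obtain ⟨hb1, hb2⟩ := mem_filter.1 hb
      refine (not_le.1 hb2).le.trans ?_
      norm_cast
      refine card_le_card_of_injOn (fun c => (b, c)) (fun c hc => ?_) (by simp)
      simp_all
    have h7 : (0 : ℝ) ≤ N ^ 2 / (8 * K ^ 2) := by positivity
    have h8 : (0:ℝ) < #(nb v) := by
      by_contra! h
      have h9 : (#(nb v) : ℝ) = 0 := le_antisymm h (by positivity)
      have : (0 : ℝ) ≤ #{x ∈ nb v ×ˢ nb v | bad x.1 x.2} := by positivity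
      have : 0 < N ^ 2 / (8 * K ^ 2) := by positivity
      rw [h9] at hvle
      linarith
    have h5' : (#{b ∈ nb v | (#{c ∈ nb v | bad b c} : ℝ) ≤ #(nb v) / 4} : ℝ) +
      #{b ∈ nb v | ¬ (#{c ∈ nb v | bad b c} : ℝ) ≤ #(nb v) / 4} = #(nb v) := by
      exact_mod_cast h5
    have h10 : (#{b ∈ nb v | ¬ (#{c ∈ nb v | bad b c} : ℝ) ≤ #(nb v) / 4} : ℝ) ≤ #(nb v) / 4 := by
      refine le_of_mul_le_mul_right ?_ (by positivity : (0:ℝ) < #(nb v) / 4)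
      nlinarith
    linarith

variable {G : Type*} [Group G] [DecidableEq G]

/-- The number of representations of `x` as `a * b⁻¹` with `a, b ∈ A`. -/
def divCount (A : Finset G) (x : G) : ℕ := #{q ∈ A ×ˢ A | q.1 * q.2⁻¹ = x}

lemma divCount_inv (A : Finset G) (x : G) : divCount A x⁻¹ = divCount A x := by
  refine card_nbij' Prod.swap Prod.swap ?_ ?_
    (fun _ _ => by simp) (fun _ _ => by simp) <;>
  · rintro ⟨a, b⟩ h
    simp only [coe_filter, mem_product, Set.mem_ofPred_eq, Prod.swap] at h ⊢
    refine ⟨h.1.symm, ?_⟩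
    rw [← inv_inj, mul_inv_rev, inv_inv, h.2]
    try simp

lemma divCount_le (A : Finset G) (x : G) : divCount A x ≤ #A := by
  refine card_le_card_of_injOn Prod.fst (fun q hq => ?_) ?_
  · exact (mem_product.1 (mem_filter.1 hq).1).1
  · rintro ⟨a, b⟩ h ⟨a', b'⟩ h' (rfl : a = a')
    have h1 := (mem_filter.1 h).2.trans (mem_filter.1 h').2.symm
    simpa using h1

lemma sum_divCount [Fintype G] (A : Finset G) : ∑ x, divCount A x = #A ^ 2 := by
  rw [pow_two, ← card_product]
  exact (card_eq_sum_card_fiberwise fun _ _ => mem_univ _).symm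

lemma card_eq_sum_divCount (A P : Finset G) :
    ∑ v ∈ A, #{a ∈ A | a * v⁻¹ ∈ P} = ∑ x ∈ P, divCount A x := by
  simp only [divCount]
  rw [sum_card_fiberwise_eq_card_filter, card_filter, sum_product, sum_comm]
  simp only [card_filter]

lemma sum_divCount_inv_sq [Fintype G] (B : Finset G) :
    ∑ x, divCount B⁻¹ x ^ 2 = ∑ x, divCount B x ^ 2 := by
  have key : ∀ A : Finset G, ∑ x, divCount A x ^ 2 =
      #{q ∈ (A ×ˢ A) ×ˢ (A ×ˢ A) | q.1.1 * q.1.2⁻¹ = q.2.1 * q.2.2⁻¹} := by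
    intro A
    rw [card_eq_sum_card_fiberwise (f := fun q => q.1.1 * q.1.2⁻¹) (t := univ)
      fun _ _ => mem_univ _]
    refine sum_congr rfl fun x _ => ?_
    rw [pow_two, divCount, ← card_product]
    congr 1
    ext q
    simp only [mem_product, mem_filter]
    constructor
    · rintro ⟨⟨h1, h2⟩, h3, h4⟩; exact ⟨⟨⟨h1, h3⟩, h2.trans h4.symm⟩, h2⟩
    · rintro ⟨⟨⟨h1, h3⟩, h2⟩, h4⟩; exact ⟨⟨h1, h4⟩, h3, h2.symm.trans h4⟩
  rw [key, key]
  refine card_nbij' (fun q => ((q.2.1⁻¹, q.1.1⁻¹), (q.2.2⁻¹, q.1.2⁻¹)))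
    (fun q => ((q.1.2⁻¹, q.2.2⁻¹), (q.1.1⁻¹, q.2.1⁻¹))) ?_ ?_
    (fun _ _ => by simp) (fun _ _ => by simp)
  · rintro ⟨⟨a, b⟩, c, d⟩ h
    simp only [coe_filter, mem_product, Set.mem_ofPred_eq, mem_inv', inv_inv] at h ⊢
    refine ⟨by tauto, ?_⟩
    have h2 := h.2
    rw [mul_inv_eq_iff_eq_mul, mul_assoc, ← inv_mul_eq_iff_eq_mul] at h2
    exact h2
  · rintro ⟨⟨a, b⟩, c, d⟩ h
    simp only [coe_filter, mem_product, Set.mem_ofPred_eq, mem_inv', inv_inv] at h ⊢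
    refine ⟨by tauto, ?_⟩
    have h2 := congr_arg (fun z => a⁻¹ * z * d) h.2
    simpa [mul_assoc] using h2

end BalogSzemerediGowers

section BalogSzemerediGowers

variable {G : Type*} [Group G] [DecidableEq G] [Fintype G]

/-- The elements with many representations as a quotient. -/
noncomputable def popular (A : Finset G) (K : ℝ) : Finset G :=
  {x | (#A : ℝ) / (2 * K) ≤ divCount A x}

lemma popular_inv (A : Finset G) (K : ℝ) : (popular A K)⁻¹ = popular A K := by
  ext x; simp [popular, divCount_inv]

lemma le_sum_popular_divCount (A : Finset G) (hA : A.Nonempty) {K : ℝ} (hK : 0 < K)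
    (hE : (#A : ℝ) ^ 3 / K ≤ ∑ x, (divCount A x : ℝ) ^ 2) :
    (#A : ℝ) ^ 2 / (2 * K) ≤ ∑ v ∈ A, (#{a ∈ A | a * v⁻¹ ∈ popular A K} : ℝ) := by
  have h1 : ∑ v ∈ A, (#{a ∈ A | a * v⁻¹ ∈ popular A K} : ℝ) =
      ∑ x ∈ popular A K, (divCount A x : ℝ) := by
    exact_mod_cast card_eq_sum_divCount A (popular A K)
  rw [h1]
  refine le_sum_popular _ _ _ (by exact_mod_cast hA.card_pos) hK (fun x => by positivity)
    (fun x => by exact_mod_cast divCount_le A x) ?_ hE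
  exact_mod_cast (sum_divCount A).le

lemma card_popular_le (A : Finset G) (hA : A.Nonempty) {K : ℝ} (hK : 0 < K) :
    (#(popular A K) : ℝ) ≤ 2 * K * #A := by
  have h := card_mul_le_card_of_fibers (A ×ˢ A) (popular A K) (fun q => q.1 * q.2⁻¹)
    (#A / (2 * K)) fun y hy => (mem_filter.1 hy).2
  have hN : (0 : ℝ) < #A := by exact_mod_cast hA.card_pos
  rw [card_product, Nat.cast_mul, ← mul_div_assoc, div_le_iff₀ (by positivity)] at h
  refine le_of_mul_le_mul_right (h.trans (le_of_eq ?_)) hN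
  ring

/-- The first half of the Balog–Szemerédi–Gowers theorem: a set with large multiplicative energy
has a large subset with small quotient set. -/
lemma exists_subset_card_div_le (A : Finset G) (hA : A.Nonempty) {K : ℝ} (hK : 1 ≤ K)
    (hE : (#A : ℝ) ^ 3 / K ≤ ∑ x, (divCount A x : ℝ) ^ 2) :
    ∃ B ⊆ A, (#A : ℝ) / (4 * K) ≤ #B ∧ (#(B * B⁻¹) : ℝ) ≤ 2 ^ 23 * K ^ 10 * #B := by
  have hK0 : 0 < K := by linarith
  set P := popular A K with hP
  obtain ⟨B₀, hB₀, B, hB, hc₀, hc, hbad⟩ := exists_dense_neighbourhood A (fun a b => a * b⁻¹ ∈ P) K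
    hK0 hA (le_sum_popular_divCount A hA hK0 hE)
  have hN : (0 : ℝ) < #A := by exact_mod_cast hA.card_pos
  set t : ℝ := #A / (128 * K ^ 2) with ht
  have ht0 : 0 < t := by positivity
  have hB₀pos : (0 : ℝ) < #B₀ := lt_of_lt_of_le (by positivity) hc₀
  refine ⟨B, hB.trans hB₀, ?_, ?_⟩
  · have : (#A : ℝ) / (4 * K) = 3 / 4 * (#A / (3 * K)) := by field_simp
    rw [this]
    linarith
  have key := card_mul_le_card_of_fibers ((P ×ˢ P) ×ˢ (P ×ˢ P)) (B * B⁻¹)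
    (fun q => q.1.1 * q.1.2⁻¹ * (q.2.1 * q.2.2⁻¹)) (#B₀ / 2 * (t * t)) fun y hy => by
      obtain ⟨b, hb, b'', hb'', rfl⟩ := mem_mul.1 hy
      obtain ⟨b', hb', rfl⟩ := mem_inv.1 hb''
      set good : Finset G := {c ∈ B₀ | t ≤ #{w ∈ A | b * w⁻¹ ∈ P ∧ c * w⁻¹ ∈ P} ∧
        t ≤ #{w ∈ A | b' * w⁻¹ ∈ P ∧ c * w⁻¹ ∈ P}} with hgood
      have hgc : (#B₀ : ℝ) / 2 ≤ #good := by
        have h1 := hbad b hb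
        have h2 := hbad b' hb'
        have h3 : B₀ ⊆ (good ∪ {c ∈ B₀ | (#{w ∈ A | b * w⁻¹ ∈ P ∧ c * w⁻¹ ∈ P} : ℝ) < t}) ∪
            {c ∈ B₀ | (#{w ∈ A | b' * w⁻¹ ∈ P ∧ c * w⁻¹ ∈ P} : ℝ) < t} := by
          intro c hc
          simp only [good, mem_union, mem_filter, hc, true_and]
          by_contra! h
          linarith [h.1.1 h.1.2, h.2]
        have h4 := (card_le_card h3).trans
          ((card_union_le _ _).trans (Nat.add_le_add_right (card_union_le _ _) _))
        have h5 : (#B₀ : ℝ) ≤ #good + #{c ∈ B₀ | (#{w ∈ A | b * w⁻¹ ∈ P ∧ c * w⁻¹ ∈ P} : ℝ) < t} +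
          #{c ∈ B₀ | (#{w ∈ A | b' * w⁻¹ ∈ P ∧ c * w⁻¹ ∈ P} : ℝ) < t} := by exact_mod_cast h4
        linarith
      set Z := good.sigma fun c => {w ∈ A | b * w⁻¹ ∈ P ∧ c * w⁻¹ ∈ P} ×ˢ
        {w ∈ A | b' * w⁻¹ ∈ P ∧ c * w⁻¹ ∈ P} with hZ
      have hZc : (#B₀ : ℝ) / 2 * (t * t) ≤ #Z := by
        rw [hZ, card_sigma, Nat.cast_sum]
        calc (#B₀ : ℝ) / 2 * (t * t) ≤ #good * (t * t) := by gcongr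
          _ = ∑ c ∈ good, t * t := by simp
          _ ≤ _ := by
            refine sum_le_sum fun c hc => ?_
            rw [card_product, Nat.cast_mul]
            have := (mem_filter.1 hc).2
            exact mul_le_mul this.1 this.2 ht0.le (ht0.le.trans this.1)
      refine hZc.trans ?_
      norm_cast
      refine card_le_card_of_injOn (fun z => ((b * z.2.1⁻¹, z.1 * z.2.1⁻¹),
        (z.1 * z.2.2⁻¹, b' * z.2.2⁻¹))) ?_ ?_
      · rintro ⟨c, w, w'⟩ h
        simp only [Z, coe_sigma, Set.mem_sigma_iff, mem_coe, mem_product, mem_filter] at h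
        simp only [coe_filter, mem_product, Set.mem_ofPred_eq]
        refine ⟨by tauto, ?_⟩
        group
      · rintro ⟨c, w, w'⟩ - ⟨d, u, u'⟩ - h
        simp only [Prod.mk.injEq, mul_right_inj, inv_inj] at h
        obtain ⟨⟨rfl, h2⟩, -, rfl⟩ := h
        rw [mul_left_inj] at h2
        rw [h2]
  rw [card_product, card_product, Nat.cast_mul, Nat.cast_mul] at key
  have hPc : (#P : ℝ) ≤ 2 * K * #A := card_popular_le A hA hK0
  have h1 : (#(B * B⁻¹) : ℝ) * (#B₀ / 2 * (t * t)) ≤ (2 * K * #A) ^ 4 := by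
    refine key.trans ?_
    calc (#P : ℝ) * #P * (#P * #P) = (#P : ℝ) ^ 4 := by ring
      _ ≤ _ := by gcongr
  have h2 : (2 * K * #A) ^ 4 ≤ 2 ^ 23 * K ^ 10 * #B * (#B₀ / 2 * (t * t)) := by
    have h3 : (2 * K * #A) ^ 4 = 2 ^ 18 * K ^ 8 * (#A : ℝ) ^ 2 * (t * t) := by
      rw [ht]; field_simp; norm_num
    have h4 : 3 / 4 * ((#A : ℝ) / (3 * K)) * (#A / (3 * K)) ≤ #B * #B₀ := by
      gcongr
      linarith
    have h5 : 3 / 4 * ((#A : ℝ) / (3 * K)) * (#A / (3 * K)) = #A ^ 2 / (12 * K ^ 2) := by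
      field_simp; norm_num
    rw [h5, div_le_iff₀ (by positivity)] at h4
    rw [h3]
    have h6 : 2 ^ 18 * K ^ 8 * (#A : ℝ) ^ 2 * (t * t) ≤
        2 ^ 18 * K ^ 8 * (#B * #B₀ * (12 * K ^ 2)) * (t * t) := by gcongr
    have h7 : 0 ≤ K ^ 10 * #B * #B₀ * (t * t) := by positivity
    nlinarith
  exact le_of_mul_le_mul_right (h1.trans h2) (by positivity)

/-- The Balog–Szemerédi–Gowers theorem in the form of Bourgain and Gamburd: a set with large
multiplicative energy has a large subset contained in few translates of an approximate group. -/
lemma exists_approximate_group (A : Finset G) (hA : A.Nonempty) {K L : ℝ} (hK : 1 ≤ K)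
    (hL : L = 2 ^ 23 * K ^ 10)
    (hE : (#A : ℝ) ^ 3 / K ≤ ∑ x, (divCount A x : ℝ) ^ 2) :
    ∃ D B : Finset G, D⁻¹ = D ∧ 1 ∈ D ∧ B ⊆ A ∧ (#A : ℝ) / (4 * K) ≤ #B ∧
      (∃ b ∈ B, (#B : ℝ) / (2 * L) ≤ #{x ∈ B | b⁻¹ * x ∈ D}) ∧
      ∀ n, (#(D ^ n) : ℝ) ≤ (2 * L ^ 2) ^ n * (L * #B) := by
  obtain ⟨B, hBA, hB, hBB⟩ := exists_subset_card_div_le A hA hK hE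
  rw [← hL] at hBB
  have hK0 : 0 < K := by linarith
  have hL0 : 0 < L := by rw [hL]; positivity
  have hN : (0 : ℝ) < #A := by exact_mod_cast hA.card_pos
  have hBpos : (0 : ℝ) < #B := lt_of_lt_of_le (by positivity) hB
  have hBne : B.Nonempty := by rw [← card_pos]; exact_mod_cast hBpos
  have hE' : (#B⁻¹ : ℝ) ^ 3 / L ≤ ∑ x, (divCount B⁻¹ x : ℝ) ^ 2 := by
    have h1 : ∑ x, (divCount B⁻¹ x : ℝ) ^ 2 = ∑ x, (divCount B x : ℝ) ^ 2 := by
      exact_mod_cast sum_divCount_inv_sq B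
    have h2 : ∑ x ∈ B * B⁻¹, (divCount B x : ℝ) = (#B : ℝ) ^ 2 := by
      have : ∑ x ∈ B * B⁻¹, divCount B x = #B ^ 2 := by
        rw [← sum_divCount]
        refine sum_subset (subset_univ _) fun x _ hx => ?_
        rw [divCount, card_eq_zero, filter_eq_empty_iff]
        rintro ⟨a, b⟩ hab rfl
        rw [mem_product] at hab
        exact hx (mul_mem_mul hab.1 (inv_mem_inv hab.2))
      exact_mod_cast this
    have h3 := sq_sum_le_card_mul_sum_sq (s := B * B⁻¹) (f := fun x => (divCount B x : ℝ))
    have h4 : ∑ x ∈ B * B⁻¹, (divCount B x : ℝ) ^ 2 ≤ ∑ x, (divCount B x : ℝ) ^ 2 :=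
      sum_le_sum_of_subset_of_nonneg (subset_univ _) fun _ _ _ => by positivity
    rw [h2] at h3
    rw [h1, card_inv, div_le_iff₀ hL0]
    have h5 : (0 : ℝ) ≤ ∑ x ∈ B * B⁻¹, (divCount B x : ℝ) ^ 2 :=
      sum_nonneg fun _ _ => by positivity
    refine le_of_mul_le_mul_left ?_ hBpos
    nlinarith
  set D := popular B⁻¹ L with hD
  have hD1 : 1 ∈ D := by
    have : divCount B⁻¹ 1 = #B := by
      rw [divCount, ← card_inv B]
      refine card_nbij' Prod.fst (fun b => (b, b)) ?_ ?_ ?_ ?_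
      · rintro ⟨a, b⟩ h; exact (mem_product.1 (mem_filter.1 h).1).1
      · intro b hb
        simpa using hb
      · rintro ⟨a, b⟩ h
        have := (mem_filter.1 h).2
        simp only [mul_inv_eq_one] at this
        simp [this]
      · intro b _; rfl
    simp only [hD, popular, mem_filter, mem_univ, true_and, this, card_inv]
    have hL1 : 1 ≤ L := by rw [hL]; nlinarith [one_le_pow₀ hK (n := 10)]
    exact div_le_self hBpos.le (by linarith)
  refine ⟨D, B, popular_inv _ _, hD1, hBA, hB, ?_, fun n => ?_⟩
  · have h := le_sum_popular_divCount B⁻¹ hBne.inv hL0 hE'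
    obtain ⟨v, hv, hle⟩ : ∃ v ∈ B⁻¹, (#B : ℝ) / (2 * L) ≤
        (#{a ∈ B⁻¹ | a * v⁻¹ ∈ popular B⁻¹ L} : ℝ) := by
      refine exists_le_of_sum_le hBne.inv ?_
      rw [sum_const, nsmul_eq_mul]
      refine (le_of_eq ?_).trans h
      rw [card_inv]; ring
    refine ⟨v⁻¹, by simpa using hv, hle.trans ?_⟩
    norm_cast
    refine card_le_card_of_injOn (fun a => a⁻¹) ?_ (inv_injective.injOn)
    intro a ha
    simp only [coe_filter, Set.mem_ofPred_eq, mem_inv', inv_inv] at ha ⊢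
    refine ⟨ha.1, ?_⟩
    rw [hD, ← popular_inv, mem_inv', mul_inv_rev, inv_inv]
    exact ha.2
  · have step : ∀ X : Finset G, (#(X * D * B⁻¹) : ℝ) ≤ 2 * L ^ 2 * #(X * B⁻¹) := by
      intro X
      have key := card_mul_le_card_of_fibers ((X * B⁻¹) ×ˢ (B * B⁻¹)) (X * D * B⁻¹)
        (fun q => q.1 * q.2) (#B / (2 * L)) fun y hy => by
          obtain ⟨xd, hxd, b, hb, rfl⟩ := mem_mul.1 hy
          obtain ⟨x, hx, d, hd, rfl⟩ := mem_mul.1 hxd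
          have h1 := (mem_filter.1 hd).2
          rw [card_inv] at h1
          refine h1.trans ?_
          rw [divCount]
          norm_cast
          refine card_le_card_of_injOn (fun q => (x * q.1, q.2⁻¹ * b)) ?_ ?_
          · rintro ⟨u, v⟩ h
            simp only [coe_filter, mem_product, Set.mem_ofPred_eq] at h ⊢
            refine ⟨⟨mul_mem_mul hx h.1.1, mul_mem_mul (by simpa using h.1.2) hb⟩, ?_⟩
            rw [← h.2]; group
          · rintro ⟨u, v⟩ - ⟨u', v'⟩ - h
            simpa using h
      rw [card_product, Nat.cast_mul] at key
      refine le_of_mul_le_mul_right (key.trans ?_) (by positivity : 0 < (#B : ℝ) / (2 * L))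
      calc (#(X * B⁻¹) : ℝ) * #(B * B⁻¹) ≤ #(X * B⁻¹) * (L * #B) := by gcongr
        _ = _ := by field_simp
    have h : ∀ n, (#(B * D ^ n * B⁻¹) : ℝ) ≤ (2 * L ^ 2) ^ n * (L * #B) := by
      intro n
      induction n with
      | zero => simpa using hBB
      | succ n ih =>
        rw [pow_succ, ← mul_assoc, pow_succ]
        refine (step _).trans ?_
        calc 2 * L ^ 2 * (#(B * D ^ n * B⁻¹) : ℝ) ≤ 2 * L ^ 2 * ((2 * L ^ 2) ^ n * (L * #B)) := by
              gcongr
          _ = _ := by ring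
    refine le_trans ?_ (h n)
    norm_cast
    exact (card_le_card_mul_left hBne).trans (card_le_card_mul_right hBne.inv)

end BalogSzemerediGowers

section TraceFibres

variable {F : Type*} [Field F]

/-- The trace of an element of `SL(2, F)`. -/
def tr (g : SL(2, F)) : F := g.1 0 0 + g.1 1 1

lemma det_eq (g : SL(2, F)) : g.1 0 0 * g.1 1 1 - g.1 0 1 * g.1 1 0 = 1 := by
  rw [← Matrix.det_fin_two]; exact g.2

lemma tr_mul (u g : SL(2, F)) : tr (u * g) = u.1 0 0 * g.1 0 0 + u.1 0 1 * g.1 1 0 +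
    (u.1 1 0 * g.1 0 1 + u.1 1 1 * g.1 1 1) := by
  simp [tr, Matrix.mul_apply, Fin.sum_univ_two]

lemma tr_mul_comm (u g : SL(2, F)) : tr (u * g) = tr (g * u) := by
  rw [tr_mul, tr_mul]; ring

lemma tr_conj (a g : SL(2, F)) : tr (a * g * a⁻¹) = tr g := by
  rw [tr_mul_comm]; simp

lemma tr_one : tr (1 : SL(2, F)) = 2 := by
  norm_num [tr]

lemma ext_entries {g h : SL(2, F)} (h1 : g.1 0 0 = h.1 0 0) (h2 : g.1 0 1 = h.1 0 1)
    (h3 : g.1 1 0 = h.1 1 0) (h4 : g.1 1 1 = h.1 1 1) : g = h := by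
  ext i j
  fin_cases i <;> fin_cases j <;> assumption

lemma trace_mul_fin_two (A B : Matrix (Fin 2) (Fin 2) F) : (A * B).trace =
    A 0 0 * B 0 0 + A 0 1 * B 1 0 + (A 1 0 * B 0 1 + A 1 1 * B 1 1) := by
  simp [Matrix.trace_fin_two, Matrix.mul_apply, Fin.sum_univ_two]

/-- A matrix orthogonal to a nilpotent `N` under the trace form preserves the kernel of `N`. -/
lemma exists_eigenvector_of_nilpotent {N : Matrix (Fin 2) (Fin 2) F} (h0 : N ≠ 0)
    (ht : N.trace = 0) (hd : N.det = 0) :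
    ∃ v : Fin 2 → F, v ≠ 0 ∧ N.mulVec v = 0 ∧
      ∀ A : Matrix (Fin 2) (Fin 2) F, (N * A).trace = 0 → ∃ l : F, A.mulVec v = l • v := by
  rw [Matrix.trace_fin_two] at ht
  rw [Matrix.det_fin_two] at hd
  simp only [trace_mul_fin_two, funext_iff, Matrix.mulVec, dotProduct, Fin.sum_univ_two,
    Fin.forall_fin_two, Pi.zero_apply, Pi.smul_apply, smul_eq_mul]
  have h11 : N 1 1 = - N 0 0 := by linear_combination ht
  rw [h11] at hd
  by_cases hc : N 1 0 = 0
  · have ha : N 0 0 = 0 := by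
      rw [hc] at hd
      have : N 0 0 * N 0 0 = 0 := by linear_combination -hd
      simpa using this
    have hb : N 0 1 ≠ 0 := by
      intro hb
      apply h0
      ext i j
      fin_cases i <;> fin_cases j <;> simp [*]
    refine ⟨![1, 0], by simp, by simp [*], fun A hA => ⟨A 0 0, by simp, ?_⟩⟩
    rw [h11, ha, hc] at hA
    have : A 1 0 = 0 := by simpa [hb] using hA
    simp [this]
  · refine ⟨![N 0 0, N 1 0], fun h => hc (congr_fun h 1), ?_, fun A hA =>
      ⟨(A 1 0 * N 0 0 + A 1 1 * N 1 0) / N 1 0, ?_, ?_⟩⟩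
    · simp only [Matrix.cons_val_zero, Matrix.cons_val_one, h11]
      exact ⟨by linear_combination -hd, by ring⟩
    · simp only [Matrix.cons_val_zero, Matrix.cons_val_one]
      rw [h11] at hA
      field_simp
      linear_combination N 1 0 * hA + A 1 0 * hd
    · simp only [Matrix.cons_val_zero, Matrix.cons_val_one]
      field_simp

lemma charpoly_eq_zero_of_eigenvector (g : SL(2, F)) {v : Fin 2 → F} (hv : v ≠ 0) {l : F}
    (h : g.1.mulVec v = l • v) : l ^ 2 - tr g * l + 1 = 0 := by
  simp only [funext_iff, Matrix.mulVec, dotProduct, Fin.sum_univ_two, Fin.forall_fin_two,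
    Pi.smul_apply, smul_eq_mul] at h
  obtain ⟨h1, h2⟩ := h
  have hd := det_eq g
  have e0 : (l ^ 2 - tr g * l + 1) * v 0 = 0 := by
    rw [tr]; linear_combination (g.1 1 1 - l) * h1 - g.1 0 1 * h2 - v 0 * hd
  have e1 : (l ^ 2 - tr g * l + 1) * v 1 = 0 := by
    rw [tr]; linear_combination (g.1 0 0 - l) * h2 - g.1 1 0 * h1 - v 1 * hd
  by_contra hne
  apply hv
  ext i
  fin_cases i
  · simpa [hne] using e0
  · simpa [hne] using e1

lemma tr_eq_two_of_fixed (g : SL(2, F)) {v : Fin 2 → F} (hv : v ≠ 0) (h : g.1.mulVec v = v) :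
    tr g = 2 := by
  have := charpoly_eq_zero_of_eigenvector g hv (l := 1) (by simpa using h)
  linear_combination -this

lemma mulVec_mul (g h : SL(2, F)) (v : Fin 2 → F) :
    (g * h).1.mulVec v = g.1.mulVec (h.1.mulVec v) := by
  rw [Matrix.mulVec_mulVec, ← Matrix.SpecialLinearGroup.coe_mul]

lemma mulVec_inv_of_eigen (g : SL(2, F)) {v : Fin 2 → F} (hv : v ≠ 0) {l : F}
    (h : g.1.mulVec v = l • v) : l ≠ 0 ∧ (g⁻¹).1.mulVec v = l⁻¹ • v := by
  have hl : l ≠ 0 := by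
    rintro rfl
    simpa using charpoly_eq_zero_of_eigenvector g hv h
  refine ⟨hl, ?_⟩
  have h1 : (g⁻¹).1.mulVec (g.1.mulVec v) = v := by
    rw [← mulVec_mul, inv_mul_cancel]; simp
  rw [h, Matrix.mulVec_smul] at h1
  rw [← h1, smul_smul, inv_mul_cancel₀ hl, one_smul, h1]

lemma exists_smul_of_orthogonal {x y z g₁ g₂ g₃ h₁ h₂ h₃ : F}
    (hg : x * g₁ + y * g₂ + z * g₃ = 0) (hh : x * h₁ + y * h₂ + z * h₃ = 0)
    (hne : ¬ (g₂ * h₃ - g₃ * h₂ = 0 ∧ g₃ * h₁ - g₁ * h₃ = 0 ∧ g₁ * h₂ - g₂ * h₁ = 0)) :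
    ∃ s, x = s * (g₂ * h₃ - g₃ * h₂) ∧ y = s * (g₃ * h₁ - g₁ * h₃) ∧
      z = s * (g₁ * h₂ - g₂ * h₁) := by
  by_cases h1 : g₂ * h₃ - g₃ * h₂ = 0
  · by_cases h2 : g₃ * h₁ - g₁ * h₃ = 0
    · by_cases h3 : g₁ * h₂ - g₂ * h₁ = 0
      · exact absurd ⟨h1, h2, h3⟩ hne
      · refine ⟨z / (g₁ * h₂ - g₂ * h₁), ?_, ?_, ?_⟩ <;> field_simp
        · linear_combination h₂ * hg - g₂ * hh
        · linear_combination g₁ * hh - h₁ * hg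
    · refine ⟨y / (g₃ * h₁ - g₁ * h₃), ?_, ?_, ?_⟩ <;> field_simp
      · linear_combination -h₃ * hg + g₃ * hh
      · linear_combination h₁ * hg - g₁ * hh
  · refine ⟨x / (g₂ * h₃ - g₃ * h₂), ?_, ?_, ?_⟩ <;> field_simp
    · linear_combination h₃ * hg - g₃ * hh
    · linear_combination -h₂ * hg + g₂ * hh

lemma exists_smul_of_cross_eq_zero {g₁ g₂ g₃ h₁ h₂ h₃ : F} (e1 : g₂ * h₃ - g₃ * h₂ = 0)
    (e2 : g₃ * h₁ - g₁ * h₃ = 0) (e3 : g₁ * h₂ - g₂ * h₁ = 0)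
    (hne : ¬ (g₁ = 0 ∧ g₂ = 0 ∧ g₃ = 0)) :
    ∃ s, h₁ = s * g₁ ∧ h₂ = s * g₂ ∧ h₃ = s * g₃ := by
  by_cases h3 : g₁ = 0
  · by_cases h4 : g₂ = 0
    · by_cases h5 : g₃ = 0
      · exact absurd ⟨h3, h4, h5⟩ hne
      · refine ⟨h₃ / g₃, ?_, ?_, ?_⟩ <;> field_simp
        · linear_combination e2
        · linear_combination -e1
    · refine ⟨h₂ / g₂, ?_, ?_, ?_⟩ <;> field_simp
      · linear_combination -e3
      · linear_combination e1
  · refine ⟨h₁ / g₁, ?_, ?_, ?_⟩ <;> field_simp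
    · linear_combination e3
    · linear_combination -e2

/-- If `u`, `ug`, `uh` have the same nonzero trace and pairwise quotients of trace different from
`2`, then `1`, `g`, `h` are linearly independent. -/
lemma cross_ne_zero {g h u : SL(2, F)} {τ : F} (hτ : τ ≠ 0) (hg : tr g ≠ 2) (hh : tr h ≠ 2)
    (hgh : tr (g⁻¹ * h) ≠ 2) (h0 : tr u = τ) (h1 : tr (u * g) = τ) (h2 : tr (u * h) = τ) :
    ¬ (g.1 1 0 * h.1 0 1 - g.1 0 1 * h.1 1 0 = 0 ∧
      g.1 0 1 * (h.1 0 0 - h.1 1 1) - (g.1 0 0 - g.1 1 1) * h.1 0 1 = 0 ∧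
      (g.1 0 0 - g.1 1 1) * h.1 1 0 - g.1 1 0 * (h.1 0 0 - h.1 1 1) = 0) := by
  rintro ⟨e1, e2, e3⟩
  obtain ⟨s, hs1, hs2, hs3⟩ : ∃ s, h.1 0 0 - h.1 1 1 = s * (g.1 0 0 - g.1 1 1) ∧
      h.1 1 0 = s * g.1 1 0 ∧ h.1 0 1 = s * g.1 0 1 := by
    refine exists_smul_of_cross_eq_zero e1 e2 e3 ?_
    rintro ⟨h3, h4, h5⟩
    apply hg
    rw [tr_mul, h4, h5] at h1
    rw [tr] at h0
    have e : g.1 1 1 = g.1 0 0 := by linear_combination -h3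
    rw [e] at h1
    have e' : τ * (g.1 0 0 - 1) = 0 := by linear_combination h1 - g.1 0 0 * h0
    rw [mul_eq_zero, or_iff_right hτ] at e'
    rw [tr, e]; linear_combination 2 * e'
  set t := h.1 1 1 - s * g.1 1 1 with ht
  have h11 : h.1 1 1 = s * g.1 1 1 + t := by rw [ht]; ring
  have h00 : h.1 0 0 = s * g.1 0 0 + t := by linear_combination hs1 + h11
  have hst : s + t = 1 := by
    rw [tr_mul, hs2, hs3, h11, h00] at h2
    rw [tr_mul] at h1
    rw [tr] at h0
    have : τ * (s + t - 1) = 0 := by linear_combination h2 - s * h1 - t * h0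
    rw [mul_eq_zero, or_iff_right hτ] at this
    linear_combination this
  have hd := det_eq h
  have hdg := det_eq g
  rw [hs2, hs3, h11, h00] at hd
  have ht' : t = 1 - s := by linear_combination hst
  have hss : s * (1 - s) * (tr g - 2) = 0 := by
    rw [tr]; rw [ht'] at hd; linear_combination hd - s ^ 2 * hdg
  rcases mul_eq_zero.1 hss with h3 | h3
  · rcases mul_eq_zero.1 h3 with h4 | h4
    · apply hh
      rw [tr, h00, h11, ht', h4]; ring
    · have hs : s = 1 := by linear_combination -h4
      apply hgh
      have : g = h := ext_entries (by rw [h00, ht', hs]; ring) (by rw [hs3, hs]; ring)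
        (by rw [hs2, hs]; ring) (by rw [h11, ht', hs]; ring)
      rw [this, inv_mul_cancel, tr_one]
  · exact hg (by linear_combination h3)

/-- If three distinct `u` share the traces of `u`, `ug` and `uh`, where `g` and `h` do not commute,
then they share an eigenvector with `g` and `h`. -/
lemma exists_common_eigenvector {g h u₁ u₂ u₃ : SL(2, F)}
    (hw : ¬ (g.1 1 0 * h.1 0 1 - g.1 0 1 * h.1 1 0 = 0 ∧
      g.1 0 1 * (h.1 0 0 - h.1 1 1) - (g.1 0 0 - g.1 1 1) * h.1 0 1 = 0 ∧
      (g.1 0 0 - g.1 1 1) * h.1 1 0 - g.1 1 0 * (h.1 0 0 - h.1 1 1) = 0))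
    (h2 : tr u₂ = tr u₁ ∧ tr (u₂ * g) = tr (u₁ * g) ∧ tr (u₂ * h) = tr (u₁ * h))
    (h3 : tr u₃ = tr u₁ ∧ tr (u₃ * g) = tr (u₁ * g) ∧ tr (u₃ * h) = tr (u₁ * h))
    (h12 : u₁ ≠ u₂) (h13 : u₁ ≠ u₃) (h23 : u₂ ≠ u₃) :
    ∃ v : Fin 2 → F, v ≠ 0 ∧ (∃ l : F, u₁.1.mulVec v = l • v) ∧ (∃ m : F, g.1.mulVec v = m • v) ∧
      ∃ n : F, h.1.mulVec v = n • v := by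
  set w₁ := g.1 1 0 * h.1 0 1 - g.1 0 1 * h.1 1 0 with hw1
  set w₂ := g.1 0 1 * (h.1 0 0 - h.1 1 1) - (g.1 0 0 - g.1 1 1) * h.1 0 1 with hw2
  set w₃ := (g.1 0 0 - g.1 1 1) * h.1 1 0 - g.1 1 0 * (h.1 0 0 - h.1 1 1) with hw3
  have key : ∀ u : SL(2, F),
      tr u = tr u₁ ∧ tr (u * g) = tr (u₁ * g) ∧ tr (u * h) = tr (u₁ * h) → ∃ s,
      u.1 0 0 = u₁.1 0 0 + s * w₁ ∧ u.1 0 1 = u₁.1 0 1 + s * w₂ ∧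
      u.1 1 0 = u₁.1 1 0 + s * w₃ ∧ u.1 1 1 = u₁.1 1 1 - s * w₁ := by
    rintro u ⟨hu1, hu2, hu3⟩
    rw [tr_mul, tr_mul] at hu2 hu3
    rw [tr, tr] at hu1
    obtain ⟨s, hx, hy, hz⟩ := exists_smul_of_orthogonal (x := u.1 0 0 - u₁.1 0 0)
      (y := u.1 0 1 - u₁.1 0 1) (z := u.1 1 0 - u₁.1 1 0) (g₁ := g.1 0 0 - g.1 1 1)
      (g₂ := g.1 1 0) (g₃ := g.1 0 1) (h₁ := h.1 0 0 - h.1 1 1) (h₂ := h.1 1 0) (h₃ := h.1 0 1)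
      (by linear_combination hu2 - g.1 1 1 * hu1)
      (by linear_combination hu3 - h.1 1 1 * hu1) hw
    exact ⟨s, by linear_combination hx, by linear_combination hy, by linear_combination hz,
      by linear_combination hu1 - hx⟩
  obtain ⟨s, a1, a2, a3, a4⟩ := key u₂ h2
  obtain ⟨t, b1, b2, b3, b4⟩ := key u₃ h3
  have hs : s ≠ 0 := by
    rintro rfl
    exact h12 (ext_entries (by simp [a1]) (by simp [a2]) (by simp [a3]) (by simp [a4]))
  have ht : t ≠ 0 := by
    rintro rfl
    exact h13 (ext_entries (by simp [b1]) (by simp [b2]) (by simp [b3]) (by simp [b4]))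
  have hst : s - t ≠ 0 := by
    intro hst
    have hst : s = t := sub_eq_zero.1 hst
    subst hst
    exact h23 (ext_entries (by rw [a1, b1]) (by rw [a2, b2]) (by rw [a3, b3]) (by rw [a4, b4]))
  have d1 := det_eq u₁
  have d2 := det_eq u₂
  have d3 := det_eq u₃
  rw [a1, a2, a3, a4] at d2
  rw [b1, b2, b3, b4] at d3
  set β := u₁.1 0 0 * w₁ + (u₁.1 0 1 * w₃ + u₁.1 1 0 * w₂) - u₁.1 1 1 * w₁ with hβ
  have q2 : s * (β + s * (w₁ ^ 2 + w₂ * w₃)) = 0 := by rw [hβ]; linear_combination d1 - d2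
  have q3 : t * (β + t * (w₁ ^ 2 + w₂ * w₃)) = 0 := by rw [hβ]; linear_combination d1 - d3
  rw [mul_eq_zero, or_iff_right hs] at q2
  rw [mul_eq_zero, or_iff_right ht] at q3
  have hq : w₁ ^ 2 + w₂ * w₃ = 0 := by
    have : (s - t) * (w₁ ^ 2 + w₂ * w₃) = 0 := by linear_combination q2 - q3
    rwa [mul_eq_zero, or_iff_right hst] at this
  have hβ0 : β = 0 := by rw [hq] at q2; linear_combination q2
  obtain ⟨v, hv, -, hA⟩ := exists_eigenvector_of_nilpotent (N := !![w₁, w₂; w₃, -w₁])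
    (by
      intro h0
      apply hw
      exact ⟨congr_fun (congr_fun h0 0) 0, congr_fun (congr_fun h0 0) 1,
        congr_fun (congr_fun h0 1) 0⟩)
    (by simp [Matrix.trace_fin_two]) (by simp [Matrix.det_fin_two]; linear_combination -hq)
  simp only [trace_mul_fin_two, Matrix.of_apply, Matrix.cons_val_zero, Matrix.cons_val_one] at hA
  exact ⟨v, hv, hA u₁.1 (by linear_combination hβ0), hA g.1 (by rw [hw1, hw2, hw3]; ring),
    hA h.1 (by rw [hw1, hw2, hw3]; ring)⟩

/-- The map `(u, y, z) ↦ (u⁻¹ y, u⁻¹ z)` is at most two-to-one on generic triples of elements of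
the same nonzero trace. -/
lemma trace_fibre {g h u₁ u₂ u₃ : SL(2, F)} {τ : F} (hτ : τ ≠ 0) (hg : tr g ≠ 2) (hh : tr h ≠ 2)
    (hgh : tr (g⁻¹ * h) ≠ 2) (h1 : tr u₁ = τ ∧ tr (u₁ * g) = τ ∧ tr (u₁ * h) = τ)
    (h2 : tr u₂ = τ ∧ tr (u₂ * g) = τ ∧ tr (u₂ * h) = τ)
    (h3 : tr u₃ = τ ∧ tr (u₃ * g) = τ ∧ tr (u₃ * h) = τ) : u₁ = u₂ ∨ u₁ = u₃ ∨ u₂ = u₃ := by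
  by_contra! hne
  obtain ⟨h12, h13, h23⟩ := hne
  obtain ⟨v, hv, ⟨l, hl⟩, ⟨m, hm⟩, n, hn⟩ := exists_common_eigenvector
    (cross_ne_zero hτ hg hh hgh h1.1 h1.2.1 h1.2.2)
    ⟨h2.1.trans h1.1.symm, h2.2.1.trans h1.2.1.symm, h2.2.2.trans h1.2.2.symm⟩
    ⟨h3.1.trans h1.1.symm, h3.2.1.trans h1.2.1.symm, h3.2.2.trans h1.2.2.symm⟩ h12 h13 h23
  have hl0 := (mulVec_inv_of_eigen u₁ hv hl).1
  have c1 := charpoly_eq_zero_of_eigenvector u₁ hv hl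
  have c2 := charpoly_eq_zero_of_eigenvector (u₁ * g) hv (l := l * m)
    (by rw [mulVec_mul, hm, Matrix.mulVec_smul, hl, smul_smul, mul_comm])
  have c3 := charpoly_eq_zero_of_eigenvector (u₁ * h) hv (l := l * n)
    (by rw [mulVec_mul, hn, Matrix.mulVec_smul, hl, smul_smul, mul_comm])
  rw [h1.1] at c1
  rw [h1.2.1] at c2
  rw [h1.2.2] at c3
  have hm1 : m - 1 ≠ 0 := by
    intro h0
    have : m = 1 := by linear_combination h0
    exact hg (tr_eq_two_of_fixed g hv (by rw [hm, this, one_smul]))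
  have hn1 : n - 1 ≠ 0 := by
    intro h0
    have : n = 1 := by linear_combination h0
    exact hh (tr_eq_two_of_fixed h hv (by rw [hn, this, one_smul]))
  have hmn : n - m ≠ 0 := by
    intro h0
    have : n = m := by linear_combination h0
    obtain ⟨hm0, hm'⟩ := mulVec_inv_of_eigen g hv hm
    exact hgh (tr_eq_two_of_fixed _ hv (by
      rw [mulVec_mul, hn, Matrix.mulVec_smul, hm', smul_smul, this, mul_inv_cancel₀ hm0, one_smul]))
  have e2 : l * m + l - τ = 0 := by
    have : l * (m - 1) * (l * m + l - τ) = 0 := by linear_combination c2 - c1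
    rwa [mul_eq_zero, or_iff_right (mul_ne_zero hl0 hm1)] at this
  have e3 : l * n + l - τ = 0 := by
    have : l * (n - 1) * (l * n + l - τ) = 0 := by linear_combination c3 - c1
    rwa [mul_eq_zero, or_iff_right (mul_ne_zero hl0 hn1)] at this
  exact mul_ne_zero hl0 hmn (by linear_combination e3 - e2)

end TraceFibres

section LarsenPink

variable {F : Type*} [Field F]

lemma exists_smul_of_det_eq_zero {v w : Fin 2 → F} (hv : v ≠ 0) (h : v 0 * w 1 - v 1 * w 0 = 0) :
    ∃ c : F, w = c • v := by
  by_cases h0 : v 0 = 0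
  · have h1 : v 1 ≠ 0 := by
      intro h1
      apply hv
      ext i; fin_cases i <;> simp [h0, h1]
    refine ⟨w 1 / v 1, ?_⟩
    ext i; fin_cases i
    · simp only [Fin.zero_eta, Pi.smul_apply, smul_eq_mul]
      field_simp
      linear_combination -h
    · simp [h1]
  · refine ⟨w 0 / v 0, ?_⟩
    ext i; fin_cases i
    · simp [h0]
    · simp only [Fin.mk_one, Pi.smul_apply, smul_eq_mul]
      field_simp
      linear_combination h

lemma parallel_of_eigen {g : SL(2, F)} (h2 : tr g ≠ 2) (h2' : tr g ≠ -2) {v w : Fin 2 → F}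
    (hv : v ≠ 0) {l : F} (hgv : g.1.mulVec v = l • v) (hgw : g.1.mulVec w = l • w) :
    ∃ c : F, w = c • v := by
  refine exists_smul_of_det_eq_zero hv ?_
  by_contra hd
  simp only [funext_iff, Matrix.mulVec, dotProduct, Fin.sum_univ_two, Fin.forall_fin_two,
    Pi.smul_apply, smul_eq_mul] at hgv hgw
  obtain ⟨a1, a2⟩ := hgv
  obtain ⟨b1, b2⟩ := hgw
  have e1 : (v 0 * w 1 - v 1 * w 0) * (g.1 0 0 - l) = 0 := by
    linear_combination w 1 * a1 - v 1 * b1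
  have e2 : (v 0 * w 1 - v 1 * w 0) * g.1 0 1 = 0 := by
    linear_combination v 0 * b1 - w 0 * a1
  have e4 : (v 0 * w 1 - v 1 * w 0) * (g.1 1 1 - l) = 0 := by
    linear_combination v 0 * b2 - w 0 * a2
  rw [mul_eq_zero, or_iff_right hd] at e1 e2 e4
  have hdet := det_eq g
  have e5 : (l - 1) * (l + 1) = 0 := by
    rw [e2] at hdet
    linear_combination hdet - g.1 1 1 * e1 - l * e4
  rcases mul_eq_zero.1 e5 with h | h
  · exact h2 (by rw [tr]; linear_combination e1 + e4 + 2 * h)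
  · exact h2' (by rw [tr]; linear_combination e1 + e4 + 2 * h)

/-- If `b` ranges over elements of trace `tr a` with `a⁻¹ b` unipotent, then `a⁻¹ b` fixes one of
two fixed vectors. -/
lemma exists_two_fixed_vectors {a : SL(2, F)} (h2 : tr a ≠ 2) (h2' : tr a ≠ -2) :
    ∃ v w : Fin 2 → F, v ≠ 0 ∧ w ≠ 0 ∧ ∀ b : SL(2, F), tr b = tr a → tr (a⁻¹ * b) = 2 →
      (a⁻¹ * b).1.mulVec v = v ∨ (a⁻¹ * b).1.mulVec w = w := by
  have key : ∀ b : SL(2, F), tr b = tr a → tr (a⁻¹ * b) = 2 → a⁻¹ * b = 1 ∨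
      ∃ v : Fin 2 → F, v ≠ 0 ∧ (a⁻¹ * b).1.mulVec v = v ∧ ∃ l : F, a.1.mulVec v = l • v := by
    intro b hb hab
    by_cases h1 : a⁻¹ * b = 1
    · exact Or.inl h1
    right
    set m := a⁻¹ * b with hm
    obtain ⟨v, hv, hNv, hA⟩ := exists_eigenvector_of_nilpotent (N := m.1 - 1)
      (by
        intro h
        exact h1 (Subtype.ext (sub_eq_zero.1 h)))
      (by
        rw [tr] at hab
        simp [Matrix.trace_fin_two]; linear_combination hab)
      (by
        rw [tr] at hab
        have := det_eq m
        simp [Matrix.det_fin_two]; linear_combination this - hab)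
    refine ⟨v, hv, ?_, hA a.1 ?_⟩
    · rw [Matrix.sub_mulVec, Matrix.one_mulVec] at hNv
      exact sub_eq_zero.1 hNv
    · have e1 : (m.1 * a.1).trace = tr (m * a) := by
        rw [trace_mul_fin_two, tr_mul]
      have e2 : a.1.trace = tr a := Matrix.trace_fin_two _
      rw [sub_mul, one_mul, Matrix.trace_sub, e1, e2, tr_mul_comm, hm, mul_inv_cancel_left, hb,
        sub_self]
  by_cases hex : ∃ (v : Fin 2 → F) (l : F), v ≠ 0 ∧ a.1.mulVec v = l • v
  swap
  · refine ⟨![1, 0], ![1, 0], by simp, by simp, fun b hb hab => Or.inl ?_⟩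
    rcases key b hb hab with h | ⟨v, hv, -, l, hl⟩
    · rw [h]; simp
    · exact absurd ⟨v, l, hv, hl⟩ hex
  obtain ⟨v, l, hv, hl⟩ := hex
  have fixed_smul : ∀ (m : SL(2, F)) (x y : Fin 2 → F), x ≠ 0 → y ≠ 0 → (∃ c : F, y = c • x) →
      m.1.mulVec x = x → m.1.mulVec y = y := by
    rintro m x y hx hy ⟨c, rfl⟩ h
    rw [Matrix.mulVec_smul, h]
  have hroot := charpoly_eq_zero_of_eigenvector a hv hl
  by_cases hex' : ∃ w : Fin 2 → F, w ≠ 0 ∧ a.1.mulVec w = (tr a - l) • w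
  · obtain ⟨w, hw, hlw⟩ := hex'
    refine ⟨v, w, hv, hw, fun b hb hab => ?_⟩
    rcases key b hb hab with h | ⟨x, hx, hbx, l', hl'⟩
    · rw [h]; simp
    · have hroot' := charpoly_eq_zero_of_eigenvector a hx hl'
      have : (l' - l) * (l' - (tr a - l)) = 0 := by linear_combination hroot' - hroot
      rcases mul_eq_zero.1 this with h | h <;> rw [sub_eq_zero] at h <;> subst h
      · exact Or.inl (fixed_smul _ x v hx hv (parallel_of_eigen h2 h2' hx hl' hl) hbx)
      · exact Or.inr (fixed_smul _ x w hx hw (parallel_of_eigen h2 h2' hx hl' hlw) hbx)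
  · refine ⟨v, v, hv, hv, fun b hb hab => Or.inl ?_⟩
    rcases key b hb hab with h | ⟨x, hx, hbx, l', hl'⟩
    · rw [h]; simp
    · have hroot' := charpoly_eq_zero_of_eigenvector a hx hl'
      have : (l' - l) * (l' - (tr a - l)) = 0 := by linear_combination hroot' - hroot
      rcases mul_eq_zero.1 this with h | h <;> rw [sub_eq_zero] at h <;> subst h
      · exact fixed_smul _ x v hx hv (parallel_of_eigen h2 h2' hx hl' hl) hbx
      · exact absurd ⟨x, hx, hl'⟩ hex'

lemma eq_one_of_fixed_two {m : SL(2, F)} {v w : Fin 2 → F} (hv : v ≠ 0)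
    (hvw : ¬ ∃ c : F, w = c • v) (h1 : m.1.mulVec v = v) (h2 : m.1.mulVec w = w) : m = 1 := by
  have hd : v 0 * w 1 - v 1 * w 0 ≠ 0 := fun h => hvw (exists_smul_of_det_eq_zero hv h)
  simp only [funext_iff, Matrix.mulVec, dotProduct, Fin.sum_univ_two, Fin.forall_fin_two] at h1 h2
  obtain ⟨a1, a2⟩ := h1
  obtain ⟨b1, b2⟩ := h2
  apply ext_entries <;> apply mul_left_cancel₀ hd <;>
    simp only [Matrix.SpecialLinearGroup.coe_one, Matrix.one_apply_eq, ne_eq, zero_ne_one,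
      one_ne_zero, not_false_eq_true, Matrix.one_apply_ne]
  · linear_combination w 1 * a1 - v 1 * b1
  · linear_combination v 0 * b1 - w 0 * a1
  · linear_combination w 1 * a2 - v 1 * b2
  · linear_combination v 0 * b2 - w 0 * a2

variable [DecidableEq F]

lemma card_fixing_sq_le (D : Finset SL(2, F)) (hD : D⁻¹ = D) {v : Fin 2 → F} (hv : v ≠ 0)
    (hmove : ∃ a ∈ D, ¬ ∃ c : F, a.1.mulVec v = c • v) (j : ℕ) :
    #{m ∈ D ^ j | m.1.mulVec v = v} ^ 2 ≤ #(D ^ (2 * j + 2)) := by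
  obtain ⟨a, ha, hav⟩ := hmove
  rw [pow_two, ← card_product]
  refine card_le_card_of_injOn (fun q => q.1 * a * (q.2 * a⁻¹)) ?_ ?_
  · rintro ⟨m, m'⟩ h
    simp only [mem_coe, mem_product, mem_filter] at h ⊢
    have e : 2 * j + 2 = (j + 1) + (j + 1) := by ring
    rw [e, pow_add, pow_succ]
    refine mul_mem_mul (mul_mem_mul h.1.1 ha) (mul_mem_mul h.2.1 ?_)
    rw [← hD]; exact inv_mem_inv ha
  · rintro ⟨m, m'⟩ h ⟨n, n'⟩ h' he
    simp only [mem_coe, mem_product, mem_filter] at h h' he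
    have inv_fix : ∀ g : SL(2, F), g.1.mulVec v = v → (g⁻¹).1.mulVec v = v := by
      intro g hg
      have := (mulVec_inv_of_eigen g hv (l := 1) (by simpa using hg)).2
      simpa using this
    have e1 : n⁻¹ * m = a * (n' * m'⁻¹) * a⁻¹ := by
      rw [← mul_assoc, ← mul_assoc] at he
      have h1 := mul_right_cancel he
      rw [inv_mul_eq_iff_eq_mul, eq_comm]
      calc n * (a * (n' * m'⁻¹) * a⁻¹) = (n * a * n') * m'⁻¹ * a⁻¹ := by group
        _ = (m * a * m') * m'⁻¹ * a⁻¹ := by rw [h1]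
        _ = m := by group
    have e2 : n⁻¹ * m = 1 := by
      refine eq_one_of_fixed_two hv hav ?_ ?_
      · rw [mulVec_mul, h.1.2, inv_fix _ h'.1.2]
      · rw [e1, ← mulVec_mul, inv_mul_cancel_right, mulVec_mul, mulVec_mul, inv_fix _ h.2.2,
          h'.2.2]
    have e3 : n = m := inv_mul_eq_one.1 e2
    subst e3
    have e4 : m' = n' := by simpa using he
    rw [e4]

set_option maxHeartbeats 800000 in
/-- The Larsen–Pink inequality for conjugacy classes of elements with `tr ∉ {0, 2, -2}`. -/
lemma card_trace_pow_three_le (D : Finset SL(2, F)) (hD : D⁻¹ = D) (h1 : 1 ∈ D)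
    (hmove : ∀ v : Fin 2 → F, v ≠ 0 → ∃ a ∈ D, ¬ ∃ c : F, a.1.mulVec v = c • v) (k : ℕ)
    {τ : F} (hτ : τ ≠ 0) (hτ2 : τ ≠ 2) (hτ2' : τ ≠ -2) :
    #{x ∈ D ^ k | tr x = τ} ^ 3 ≤ 1728 * #(D ^ (4 * k + 2)) ^ 2 := by
  set X := {x ∈ D ^ k | tr x = τ} with hX
  have hXmem : ∀ x ∈ X, x ∈ D ^ k ∧ tr x = τ := fun x hx => mem_filter.1 hx
  have hdiv : ∀ x ∈ X, ∀ y ∈ X, x⁻¹ * y ∈ D ^ (2 * k) := by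
    intro x hx y hy
    rw [two_mul, pow_add]
    refine mul_mem_mul ?_ (hXmem y hy).1
    rw [← hD, inv_pow]
    exact inv_mem_inv (hXmem x hx).1
  set P := {q ∈ X ×ˢ X | tr (q.1⁻¹ * q.2) = 2} with hP
  set s := Nat.sqrt #(D ^ (4 * k + 2)) with hs
  have hfix : ∀ v : Fin 2 → F, v ≠ 0 → #{m ∈ D ^ (2 * k) | m.1.mulVec v = v} ≤ s := by
    intro v hv
    rw [hs, Nat.le_sqrt']
    have := card_fixing_sq_le D hD hv (hmove v hv) (2 * k)
    rwa [← mul_assoc] at this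
  have hPc : #P ≤ 2 * s * #X := by
    refine card_le_mul_card_image_of_maps_to (f := Prod.fst) (fun q hq => 
      (mem_product.1 (mem_filter.1 hq).1).1) _ fun a ha => ?_
    obtain ⟨-, hat⟩ := hXmem a ha
    obtain ⟨v, w, hv, hw, hvw⟩ := exists_two_fixed_vectors (a := a) (hat ▸ hτ2) (hat ▸ hτ2')
    calc #{q ∈ P | q.1 = a} ≤ #({m ∈ D ^ (2 * k) | m.1.mulVec v = v} ∪
          {m ∈ D ^ (2 * k) | m.1.mulVec w = w}) := by
          refine card_le_card_of_injOn (fun q => a⁻¹ * q.2) ?_ ?_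
          · rintro ⟨a', b⟩ h
            simp only [P, coe_filter, mem_filter, mem_product, Set.mem_ofPred_eq] at h
            obtain ⟨⟨⟨-, hb⟩, hab⟩, rfl⟩ := h
            simp only [mem_coe, mem_union, mem_filter]
            have := hvw b ((hXmem b hb).2.trans hat.symm) hab
            have := hdiv _ ha _ hb
            tauto
          · rintro ⟨a', b⟩ h ⟨a'', b'⟩ h' he
            simp only [coe_filter, Set.mem_ofPred_eq] at h h'
            have e : b = b' := by simpa using he
            rw [e, h.2, h'.2]
      _ ≤ _ := (card_union_le _ _).trans (by linarith [hfix v hv, hfix w hw])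
  have hgood : #{q ∈ X ×ˢ X ×ˢ X | tr (q.1⁻¹ * q.2.1) ≠ 2 ∧ tr (q.1⁻¹ * q.2.2) ≠ 2 ∧
      tr (q.2.1⁻¹ * q.2.2) ≠ 2} ≤ 2 * #((D ^ (2 * k)) ×ˢ (D ^ (2 * k))) := by
    refine card_le_mul_card_image_of_maps_to (f := fun q => (q.1⁻¹ * q.2.1, q.1⁻¹ * q.2.2))
      ?_ _ ?_
    · rintro ⟨u, y, z⟩ h
      simp only [mem_filter, mem_product] at h ⊢
      exact ⟨hdiv _ h.1.1 _ h.1.2.1, hdiv _ h.1.1 _ h.1.2.2⟩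
    · rintro ⟨g, h⟩ -
      by_contra! hlt
      obtain ⟨⟨u₁, y₁, z₁⟩, m1, ⟨u₂, y₂, z₂⟩, m2, ⟨u₃, y₃, z₃⟩, m3, h12, h13, h23⟩ :=
        two_lt_card.1 hlt
      simp only [mem_filter, mem_product, Prod.mk.injEq, inv_mul_eq_iff_eq_mul] at m1 m2 m3
      obtain ⟨⟨⟨a1, a2, a3⟩, a4, a5, a6⟩, rfl, rfl⟩ := m1
      obtain ⟨⟨⟨b1, b2, b3⟩, -⟩, rfl, rfl⟩ := m2
      obtain ⟨⟨⟨c1, c2, c3⟩, -⟩, rfl, rfl⟩ := m3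
      rw [inv_mul_cancel_left] at a4 a5
      have a6' : tr (g⁻¹ * h) ≠ 2 := by
        have : (u₁ * g)⁻¹ * (u₁ * h) = g⁻¹ * h := by group
        rwa [this] at a6
      rcases trace_fibre hτ a4 a5 a6' ⟨(hXmem _ a1).2, (hXmem _ a2).2, (hXmem _ a3).2⟩
        ⟨(hXmem _ b1).2, (hXmem _ b2).2, (hXmem _ b3).2⟩
        ⟨(hXmem _ c1).2, (hXmem _ c2).2, (hXmem _ c3).2⟩ with rfl | rfl | rfl
      · exact h12 rfl
      · exact h13 rfl
      · exact h23 rfl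
  have hbad : ∀ f : SL(2, F) × SL(2, F) × SL(2, F) → (SL(2, F) × SL(2, F)) × SL(2, F),
      Function.Injective f →
      (∀ q ∈ X ×ˢ X ×ˢ X, (f q).1.1 ∈ X ∧ (f q).1.2 ∈ X ∧ (f q).2 ∈ X) →
      #{q ∈ X ×ˢ X ×ˢ X | tr ((f q).1.1⁻¹ * (f q).1.2) = 2} ≤ #P * #X := by
    intro f hf hmem
    rw [← card_product]
    refine card_le_card_of_injOn f (fun q hq => ?_) hf.injOn
    simp only [coe_filter, Set.mem_ofPred_eq] at hq
    have := hmem q hq.1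
    simp only [P, mem_coe, mem_product, mem_filter]
    tauto
  have b1 := hbad (fun q => ((q.1, q.2.1), q.2.2)) (by rintro ⟨_, _, _⟩ ⟨_, _, _⟩ h; simp_all)
    (by rintro ⟨_, _, _⟩ h; simp_all)
  have b2 := hbad (fun q => ((q.1, q.2.2), q.2.1)) (by rintro ⟨_, _, _⟩ ⟨_, _, _⟩ h; simp_all)
    (by rintro ⟨_, _, _⟩ h; simp_all)
  have b3 := hbad (fun q => ((q.2.1, q.2.2), q.1)) (by rintro ⟨_, _, _⟩ ⟨_, _, _⟩ h; simp_all)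
    (by rintro ⟨_, _, _⟩ h; simp_all)
  have hcover : X ×ˢ X ×ˢ X ⊆ ({q ∈ X ×ˢ X ×ˢ X | tr (q.1⁻¹ * q.2.1) ≠ 2 ∧
      tr (q.1⁻¹ * q.2.2) ≠ 2 ∧ tr (q.2.1⁻¹ * q.2.2) ≠ 2} ∪
      {q ∈ X ×ˢ X ×ˢ X | tr (q.1⁻¹ * q.2.1) = 2}) ∪
      ({q ∈ X ×ˢ X ×ˢ X | tr (q.1⁻¹ * q.2.2) = 2} ∪
      {q ∈ X ×ˢ X ×ˢ X | tr (q.2.1⁻¹ * q.2.2) = 2}) := by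
    intro q hq
    simp only [mem_union, mem_filter, hq, true_and]
    tauto
  have hc := card_le_card hcover
  have hc1 := hc.trans ((card_union_le _ _).trans (Nat.add_le_add (card_union_le _ _)
    (card_union_le _ _)))
  rw [card_product, card_product] at hc1
  rw [card_product] at hgood
  set W := #(D ^ (4 * k + 2)) with hW
  have hd : #(D ^ (2 * k)) ≤ W := card_le_card (pow_subset_pow_right h1 (by omega))
  have hsW : s ^ 2 ≤ W := by rw [hs]; exact Nat.sqrt_le' _
  set n := #X with hn
  have hmain : n ^ 3 ≤ 2 * W ^ 2 + 6 * s * n ^ 2 := by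
    have : #(D ^ (2 * k)) * #(D ^ (2 * k)) ≤ W * W := Nat.mul_le_mul hd hd
    have : #P * n ≤ 2 * s * n * n := Nat.mul_le_mul_right _ hPc
    nlinarith
  clear_value n W s
  rcases le_total n (12 * s) with h | h
  · have hW1 : s ≤ W := (Nat.le_self_pow two_ne_zero s).trans hsW
    calc n ^ 3 ≤ (12 * s) ^ 3 := Nat.pow_le_pow_left h 3
      _ = 1728 * (s * s ^ 2) := by ring
      _ ≤ 1728 * (W * W) := by gcongr
      _ = _ := by ring
  · have : 12 * s * n ^ 2 ≤ n * n ^ 2 := Nat.mul_le_mul_right _ h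
    nlinarith

end LarsenPink

section Commute

variable {F : Type*} [Field F]

/-- A matrix of `SL(2, F)` that is a multiple of the identity. -/
def IsScalar (g : SL(2, F)) : Prop := g.1 0 0 - g.1 1 1 = 0 ∧ g.1 1 0 = 0 ∧ g.1 0 1 = 0

lemma commute_iff (g h : SL(2, F)) : Commute g h ↔
    g.1 1 0 * h.1 0 1 - g.1 0 1 * h.1 1 0 = 0 ∧
      g.1 0 1 * (h.1 0 0 - h.1 1 1) - (g.1 0 0 - g.1 1 1) * h.1 0 1 = 0 ∧
      (g.1 0 0 - g.1 1 1) * h.1 1 0 - g.1 1 0 * (h.1 0 0 - h.1 1 1) = 0 := by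
  have key : ∀ x y : SL(2, F), (x * y).1 0 0 = x.1 0 0 * y.1 0 0 + x.1 0 1 * y.1 1 0 ∧
      (x * y).1 0 1 = x.1 0 0 * y.1 0 1 + x.1 0 1 * y.1 1 1 ∧
      (x * y).1 1 0 = x.1 1 0 * y.1 0 0 + x.1 1 1 * y.1 1 0 ∧
      (x * y).1 1 1 = x.1 1 0 * y.1 0 1 + x.1 1 1 * y.1 1 1 := by
    intro x y
    simp [Matrix.mul_apply, Fin.sum_univ_two]
  obtain ⟨a1, a2, a3, a4⟩ := key g h
  obtain ⟨b1, b2, b3, b4⟩ := key h g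
  constructor
  · intro e
    have e' : g * h = h * g := e
    rw [e'] at a1 a2 a3 a4
    exact ⟨by linear_combination b4 - a4, by linear_combination a2 - b2,
      by linear_combination a3 - b3⟩
  · rintro ⟨e1, e2, e3⟩
    refine ext_entries ?_ ?_ ?_ ?_
    · rw [a1, b1]; linear_combination -e1
    · rw [a2, b2]; linear_combination -e2
    · rw [a3, b3]; linear_combination -e3
    · rw [a4, b4]; linear_combination e1

lemma IsScalar.commute {g : SL(2, F)} (hg : IsScalar g) (h : SL(2, F)) : Commute g h := by
  obtain ⟨h1, h2, h3⟩ := hg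
  rw [commute_iff, h1, h2, h3]
  simp

lemma exists_smul_of_commute {h x : SL(2, F)} (hh : ¬ IsScalar h) (hx : Commute h x) :
    ∃ s, x.1 0 0 - x.1 1 1 = s * (h.1 0 0 - h.1 1 1) ∧ x.1 1 0 = s * h.1 1 0 ∧
      x.1 0 1 = s * h.1 0 1 := by
  obtain ⟨e1, e2, e3⟩ := (commute_iff h x).1 hx
  exact exists_smul_of_cross_eq_zero e1 e2 e3 hh

lemma commute_of_commute {x h y : SL(2, F)} (hh : ¬ IsScalar h) (hx : Commute h x)
    (hy : Commute h y) :
    Commute x y := by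
  obtain ⟨s, a1, a2, a3⟩ := exists_smul_of_commute hh hx
  obtain ⟨t, b1, b2, b3⟩ := exists_smul_of_commute hh hy
  rw [commute_iff, a1, a2, a3, b1, b2, b3]
  refine ⟨?_, ?_, ?_⟩ <;> ring

lemma IsScalar.tr_sq {g : SL(2, F)} (hg : IsScalar g) : tr g = 2 ∨ tr g = -2 := by
  obtain ⟨h1, h2, h3⟩ := hg
  have hd := det_eq g
  have e : (tr g - 2) * (tr g + 2) = 0 := by
    rw [tr]; linear_combination 4 * hd + (g.1 0 0 - g.1 1 1) * h1 + 4 * g.1 0 1 * h2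
  rcases mul_eq_zero.1 e with e | e
  · left; linear_combination e
  · right; linear_combination e

lemma not_isScalar {g : SL(2, F)} (h2 : tr g ≠ 2) (h2' : tr g ≠ -2) : ¬ IsScalar g :=
  fun h => h.tr_sq.elim h2 h2'

lemma discr_eq (g : SL(2, F)) :
    (g.1 0 0 - g.1 1 1) ^ 2 + 4 * g.1 0 1 * g.1 1 0 = (tr g - 2) * (tr g + 2) := by
  rw [tr]; linear_combination -4 * det_eq g

lemma discr_ne_zero {g : SL(2, F)} (h2 : tr g ≠ 2) (h2' : tr g ≠ -2) :
    (tr g - 2) * (tr g + 2) ≠ 0 :=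
  mul_ne_zero (sub_ne_zero.2 h2) (fun h => h2' (by linear_combination h))

/-- Elements of trace `± 2` commuting with a semisimple nonscalar element are scalar. -/
lemma isScalar_of_commute {h x : SL(2, F)} (h2 : tr h ≠ 2) (h2' : tr h ≠ -2) (hx : Commute h x)
    (hx2 : tr x = 2 ∨ tr x = -2) : IsScalar x := by
  obtain ⟨s, a1, a2, a3⟩ := exists_smul_of_commute (not_isScalar h2 h2') hx
  have e : s ^ 2 * ((tr h - 2) * (tr h + 2)) = 0 := by
    have e1 := discr_eq x
    rw [a1, a2, a3] at e1
    rw [← discr_eq h]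
    have : (tr x - 2) * (tr x + 2) = 0 := by rcases hx2 with e | e <;> rw [e] <;> ring
    linear_combination e1 + this
  have hs : s = 0 := by
    rcases mul_eq_zero.1 e with e | e
    · exact pow_eq_zero_iff (two_ne_zero) |>.1 e
    · exact absurd e (discr_ne_zero h2 h2')
  subst hs
  exact ⟨by simpa using a1, by simpa using a2, by simpa using a3⟩

lemma IsScalar.eq_of_tr_eq (hF : (2 : F) ≠ 0) {x y : SL(2, F)} (hx : IsScalar x) (hy : IsScalar y)
    (h : tr x = tr y) : x = y := by
  obtain ⟨a1, a2, a3⟩ := hx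
  obtain ⟨b1, b2, b3⟩ := hy
  rw [tr, tr] at h
  refine ext_entries ?_ (by rw [a3, b3]) (by rw [a2, b2]) ?_ <;> apply mul_left_cancel₀ hF
  · linear_combination h + a1 - b1
  · linear_combination h - a1 + b1

lemma eq_or_eq_inv_of_commute (hF : (2 : F) ≠ 0) {x y : SL(2, F)} (h2 : tr x ≠ 2) (h2' : tr x ≠ -2)
    (hxy : Commute x y) (h : tr y = tr x) : y = x ∨ y = x⁻¹ := by
  obtain ⟨s, a1, a2, a3⟩ := exists_smul_of_commute (not_isScalar h2 h2') hxy
  have e : (s - 1) * (s + 1) * ((tr x - 2) * (tr x + 2)) = 0 := by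
    have e1 := discr_eq y
    rw [a1, a2, a3, h] at e1
    rw [← discr_eq x] at e1 ⊢
    linear_combination e1
  rw [tr, tr] at h
  rcases mul_eq_zero.1 ((mul_eq_zero.1 e).resolve_right (discr_ne_zero h2 h2')) with e | e
  · left
    have hs : s = 1 := by linear_combination e
    subst hs
    refine ext_entries ?_ (by simpa using a3) (by simpa using a2) ?_ <;> apply mul_left_cancel₀ hF
    · linear_combination h + a1
    · linear_combination h - a1
  · right
    have hs : s = -1 := by linear_combination e
    subst hs
    rw [Matrix.SpecialLinearGroup.SL2_inv_expl]
    refine ext_entries ?_ (by simpa using a3) (by simpa using a2) ?_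
    · simp only [Matrix.cons_val', Matrix.cons_val_zero, Matrix.cons_val_fin_one]
      apply mul_left_cancel₀ hF
      linear_combination h + a1
    · simp only [Matrix.cons_val', Matrix.cons_val_one, Matrix.cons_val_fin_one]
      apply mul_left_cancel₀ hF
      linear_combination h - a1

end Commute

section Count

variable {F : Type*} [Field F] [DecidableEq F]

lemma card_commuting_trace_le (hF : (2 : F) ≠ 0) {h : SL(2, F)} (h2 : tr h ≠ 2) (h2' : tr h ≠ -2)
    (T : Finset SL(2, F)) (τ : F) (hT : ∀ x ∈ T, Commute h x ∧ tr x = τ) : #T ≤ 2 := by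
  rcases T.eq_empty_or_nonempty with rfl | ⟨x, hx⟩
  · simp
  refine (card_le_card (t := {x, x⁻¹}) fun y hy => ?_).trans card_le_two
  have hxτ := (hT x hx).2
  have hyτ := (hT y hy).2
  rw [mem_insert, mem_singleton]
  by_cases hs : tr x = 2 ∨ tr x = -2
  · left
    exact IsScalar.eq_of_tr_eq hF (isScalar_of_commute h2 h2' (hT y hy).1 (by rwa [hyτ, ← hxτ]))
      (isScalar_of_commute h2 h2' (hT x hx).1 hs) (by rw [hyτ, hxτ])
  · push Not at hs
    exact eq_or_eq_inv_of_commute hF hs.1 hs.2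
      (commute_of_commute (not_isScalar h2 h2') (hT x hx).1 (hT y hy).1) (by rw [hyτ, hxτ])

lemma card_commuting_le (hF : (2 : F) ≠ 0) {h : SL(2, F)} (h2 : tr h ≠ 2) (h2' : tr h ≠ -2)
    (T : Finset SL(2, F)) (hT : ∀ x ∈ T, Commute h x) (V : Finset F) (hV : ∀ x ∈ T, tr x ∈ V) :
    #T ≤ 2 * #V := by
  refine card_le_mul_card_image_of_maps_to hV 2 fun τ _ => ?_
  refine card_commuting_trace_le hF h2 h2' _ τ fun x hx => ?_
  rw [mem_filter] at hx
  exact ⟨hT x hx.1, hx.2⟩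

/-- A set of more than six elements commuting with a semisimple `h` has an element whose trace
is not `0`, `2` or `-2`. -/
lemma card_le_regular_add_six (hF : (2 : F) ≠ 0) {h : SL(2, F)} (h2 : tr h ≠ 2) (h2' : tr h ≠ -2)
    (T : Finset SL(2, F)) (hT : ∀ x ∈ T, Commute h x) :
    #T ≤ #{x ∈ T | tr x ≠ 0 ∧ tr x ≠ 2 ∧ tr x ≠ -2} + 6 := by
  rw [← card_filter_add_card_filter_not (s := T) (fun x => tr x ≠ 0 ∧ tr x ≠ 2 ∧ tr x ≠ -2)]
  gcongr
  refine (card_commuting_le hF h2 h2' _ (fun x hx => hT x (mem_filter.1 hx).1) {0, 2, -2}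
    fun x hx => ?_).trans (Nat.mul_le_mul_left 2 card_le_three)
  rw [mem_filter] at hx
  simp only [mem_insert, mem_singleton]
  tauto

end Count

section Regular

variable {F : Type*} [Field F]

/-- The elements of `SL(2, F)` whose trace is none of `0`, `2`, `-2`. -/
def IsRegular (g : SL(2, F)) : Prop := tr g ≠ 0 ∧ tr g ≠ 2 ∧ tr g ≠ -2

instance [DecidableEq F] : DecidablePred (IsRegular (F := F)) :=
  fun _ => inferInstanceAs (Decidable (_ ∧ _ ∧ _))

lemma IsRegular.conj {g : SL(2, F)} (hg : IsRegular g) (a : SL(2, F)) :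
    IsRegular (a * g * a⁻¹) := by
  rw [IsRegular, tr_conj]; exact hg

lemma IsRegular.not_isScalar {g : SL(2, F)} (hg : IsRegular g) : ¬ IsScalar g :=
  BourgainGamburd.not_isScalar hg.2.1 hg.2.2

lemma commute_of_two_eigenvectors {a c : SL(2, F)} {v w : Fin 2 → F} (hv : v ≠ 0)
    (hvw : ¬ ∃ l : F, w = l • v) (hav : ∃ l : F, a.1.mulVec v = l • v)
    (hcv : ∃ l : F, c.1.mulVec v = l • v) (haw : ∃ l : F, a.1.mulVec w = l • w)
    (hcw : ∃ l : F, c.1.mulVec w = l • w) : Commute a c := by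
  obtain ⟨l, hl⟩ := hav
  obtain ⟨m, hm⟩ := hcv
  obtain ⟨l', hl'⟩ := haw
  obtain ⟨m', hm'⟩ := hcw
  have key : ∀ {u : Fin 2 → F} {s t : F}, a.1.mulVec u = s • u → c.1.mulVec u = t • u →
      ((a * c)⁻¹ * (c * a)).1.mulVec u = u := by
    intro u s t hs ht
    have h1 : (c * a).1.mulVec u = (a * c).1.mulVec u := by
      rw [mulVec_mul, mulVec_mul, hs, ht, Matrix.mulVec_smul, Matrix.mulVec_smul, hs, ht, smul_smul,
        smul_smul, mul_comm]
    rw [mulVec_mul, h1, ← mulVec_mul, inv_mul_cancel]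
    simp
  have := eq_one_of_fixed_two hv hvw (key hl hm) (key hl' hm')
  exact (inv_mul_eq_one.1 this)

end Regular

section Pivot

variable {F : Type*} [Field F] [DecidableEq F]

lemma exists_isRegular {D : Finset SL(2, F)} (h1 : 1 ∈ D)
    (hmove : ∀ v : Fin 2 → F, v ≠ 0 → ∃ a ∈ D, ¬ ∃ c : F, a.1.mulVec v = c • v)
    (hnc : ∃ a ∈ D, ∃ c ∈ D, ¬ Commute a c) (hcard : 108 < #D) : ∃ h ∈ D ^ 3, IsRegular h := by
  by_contra! hirr
  obtain ⟨a, ha, c, hc, hac⟩ := hnc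
  set Z : Finset F := {0, 2, -2} with hZ
  have hZmem : ∀ x ∈ D ^ 3, tr x ∈ Z := by
    intro x hx
    have := hirr x hx
    rw [IsRegular] at this
    simp only [hZ, mem_insert, mem_singleton]
    tauto
  have hD2 : D ^ 2 ⊆ D ^ 3 := pow_subset_pow_right h1 (by norm_num)
  classical
  set P : SL(2, F) → Prop := fun x => ∃ v : Fin 2 → F, v ≠ 0 ∧ (∃ l : F, x.1.mulVec v = l • v) ∧
    (∃ m : F, a.1.mulVec v = m • v) ∧ ∃ n : F, c.1.mulVec v = n • v with hP
  set T := {x ∈ D ^ 2 | ¬ P x} with hT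
  have hTmem : ∀ x ∈ T, x ∈ D ^ 2 ∧ ¬ P x := fun x hx => mem_filter.1 hx
  have hT54 : #T ≤ 54 := by
    have := card_le_mul_card_image_of_maps_to (s := T) (t := Z ×ˢ Z ×ˢ Z)
      (f := fun x => (tr x, tr (x * a), tr (x * c))) (n := 2) ?_ ?_
    · refine this.trans ?_
      have hZ3 : #Z ≤ 3 := card_le_three
      rw [card_product, card_product]
      calc 2 * (#Z * (#Z * #Z)) ≤ 2 * (3 * (3 * 3)) := by gcongr
        _ = 54 := by norm_num
    · intro x hx
      have hx2 := (hTmem x hx).1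
      refine mem_product.2 ⟨hZmem _ (hD2 hx2), mem_product.2 ⟨hZmem _ ?_, hZmem _ ?_⟩⟩
      · rw [pow_succ]; exact mul_mem_mul hx2 ha
      · rw [pow_succ]; exact mul_mem_mul hx2 hc
    · intro y _
      by_contra! h
      obtain ⟨u₁, m1, u₂, m2, u₃, m3, h12, h13, h23⟩ := two_lt_card.1 h
      simp only [mem_filter, Prod.ext_iff] at m1 m2 m3
      exact (hTmem _ m1.1).2 (exists_common_eigenvector (fun e => hac ((commute_iff a c).2 e))
        ⟨m2.2.1.trans m1.2.1.symm, m2.2.2.1.trans m1.2.2.1.symm, m2.2.2.2.trans m1.2.2.2.symm⟩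
        ⟨m3.2.1.trans m1.2.1.symm, m3.2.2.1.trans m1.2.2.1.symm, m3.2.2.2.trans m1.2.2.2.symm⟩
        h12 h13 h23)
  have hDD : D ⊆ D ^ 2 := by
    simpa using pow_subset_pow_right h1 (show 1 ≤ 2 by norm_num)
  by_cases hex : ∃ x ∈ D, P x
  · obtain ⟨x₀, -, v, hv, -, hav, hcv⟩ := hex
    have hpar : ∀ x, P x → ∃ l : F, x.1.mulVec v = l • v := by
      rintro x ⟨w, hw, ⟨l, hl⟩, haw, hcw⟩
      by_cases hwv : ∃ s : F, v = s • w
      · obtain ⟨s, rfl⟩ := hwv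
        exact ⟨l, by rw [Matrix.mulVec_smul, hl, smul_comm]⟩
      · exact absurd (commute_of_two_eigenvectors hw hwv haw hcw hav hcv) hac
    obtain ⟨b, hb, hbv⟩ := hmove v hv
    have hcount : #{x ∈ D | P x} ≤ #T := by
      refine card_le_card_of_injOn (fun x => b * x) ?_ (fun x _ y _ h => mul_left_cancel h)
      intro x hx
      have hx' := mem_filter.1 hx
      refine mem_filter.2 ⟨by rw [pow_two]; exact mul_mem_mul hb hx'.1, fun hbx => ?_⟩
      obtain ⟨l, hl⟩ := hpar _ hbx
      obtain ⟨m, hm⟩ := hpar _ hx'.2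
      have hm0 := (mulVec_inv_of_eigen x hv hm).1
      rw [mulVec_mul, hm, Matrix.mulVec_smul] at hl
      exact hbv ⟨m⁻¹ * l, by rw [← smul_smul, ← hl, smul_smul, inv_mul_cancel₀ hm0, one_smul]⟩
    have hcount' : #{x ∈ D | ¬ P x} ≤ #T :=
      card_le_card (filter_subset_filter _ hDD)
    have := card_filter_add_card_filter_not (s := D) (fun x => P x)
    omega
  · push Not at hex
    have : #D ≤ #T := card_le_card fun x hx => mem_filter.2 ⟨hDD hx, hex x hx⟩
    omega

lemma card_le_card_trace_mul {D : Finset SL(2, F)} (hD : D⁻¹ = D) {k : ℕ} {h : SL(2, F)}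
    (hh : h ∈ D ^ k) : #D ≤ #{x ∈ D ^ (k + 2) | tr x = tr h} * #{x ∈ D ^ 2 | h * x = x * h} := by
  rw [mul_comm]
  refine card_le_mul_card_image_of_maps_to (f := fun d => d * h * d⁻¹) ?_ _ ?_
  · intro d hd
    refine mem_filter.2 ⟨?_, tr_conj _ _⟩
    rw [show k + 2 = 1 + k + 1 by ring, pow_add, pow_add, pow_one]
    exact mul_mem_mul (mul_mem_mul hd hh) (by rw [← hD]; exact inv_mem_inv hd)
  · intro y _
    rcases ({d ∈ D | d * h * d⁻¹ = y} : Finset SL(2, F)).eq_empty_or_nonempty with he | ⟨d₀, hd₀⟩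
    · rw [he]; simp
    rw [mem_filter] at hd₀
    refine card_le_card_of_injOn (fun d => d₀⁻¹ * d) ?_ (fun x _ y _ h => mul_left_cancel h)
    intro d hd
    have hd' := mem_filter.1 hd
    refine mem_filter.2 ⟨?_, ?_⟩
    · rw [pow_two]
      exact mul_mem_mul (by rw [← hD]; exact inv_mem_inv hd₀.1) hd'.1
    · have e : d * h * d⁻¹ = d₀ * h * d₀⁻¹ := hd'.2.trans hd₀.2.symm
      show h * (d₀⁻¹ * d) = d₀⁻¹ * d * h
      have hconj : d * h = d₀ * h * d₀⁻¹ * d := by rw [← e]; group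
      rw [mul_assoc d₀⁻¹, hconj]; group

/-- Elements of `D ^ 4` with generic trace have many elements of `D ^ 2` in their centralizer. -/
lemma card_pow_three_le_centralizer {D : Finset SL(2, F)} (hD : D⁻¹ = D) (h1 : 1 ∈ D)
    (hmove : ∀ v : Fin 2 → F, v ≠ 0 → ∃ a ∈ D, ¬ ∃ c : F, a.1.mulVec v = c • v)
    {h : SL(2, F)} (hh : h ∈ D ^ 4) (hr : IsRegular h) :
    #D ^ 3 ≤ 1728 * #(D ^ 26) ^ 2 * #{x ∈ D ^ 2 | h * x = x * h} ^ 3 := by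
  calc #D ^ 3 ≤ (#{x ∈ D ^ 6 | tr x = tr h} * #{x ∈ D ^ 2 | h * x = x * h}) ^ 3 :=
        Nat.pow_le_pow_left (card_le_card_trace_mul hD hh) 3
    _ = #{x ∈ D ^ 6 | tr x = tr h} ^ 3 * #{x ∈ D ^ 2 | h * x = x * h} ^ 3 := mul_pow _ _ _
    _ ≤ _ := Nat.mul_le_mul_right _
      (card_trace_pow_three_le D hD h1 hmove 6 hr.1 hr.2.1 hr.2.2)

end Pivot

section Growth

variable {F : Type*} [Field F] [DecidableEq F] [Fintype F]

lemma card_conjugators_le (hF : (2 : F) ≠ 0) {x h : SL(2, F)} (hx : IsRegular x)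
    (hh : IsRegular h) :
    #{g : SL(2, F) | g * h * g⁻¹ * x = x * (g * h * g⁻¹)} ≤ 4 * Fintype.card F := by
  set U : Finset SL(2, F) := {g : SL(2, F) | g * h * g⁻¹ * x = x * (g * h * g⁻¹)} with hU
  have hUmem : ∀ g ∈ U, g * h * g⁻¹ * x = x * (g * h * g⁻¹) := fun g hg => (mem_filter.1 hg).2
  have himg : #(U.image fun g => g⁻¹ * x * g) ≤ 2 := by
    refine card_commuting_trace_le hF hh.2.1 hh.2.2 _ (tr x) fun y hy => ?_
    obtain ⟨g, hg, rfl⟩ := mem_image.1 hy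
    refine ⟨?_, by simpa using tr_conj g⁻¹ x⟩
    show h * (g⁻¹ * x * g) = g⁻¹ * x * g * h
    calc h * (g⁻¹ * x * g) = g⁻¹ * (g * h * g⁻¹ * x) * g := by group
      _ = g⁻¹ * x * g * h := by rw [hUmem g hg]; group
  calc #U ≤ 2 * Fintype.card F * #(U.image fun g => g⁻¹ * x * g) := by
        refine card_le_mul_card_image _ _ fun y hy => ?_
        obtain ⟨g₀, hg₀, rfl⟩ := mem_image.1 hy
        rw [← card_univ]
        refine le_trans ?_ (card_commuting_le hF hx.2.1 hx.2.2
          ({g ∈ U | g⁻¹ * x * g = g₀⁻¹ * x * g₀}.image fun g => g * g₀⁻¹) ?_ univ (by simp))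
        · rw [card_image_of_injective _ (mul_left_injective _)]
        · intro z hz
          obtain ⟨g, hg, rfl⟩ := mem_image.1 hz
          have e := (mem_filter.1 hg).2
          show x * (g * g₀⁻¹) = g * g₀⁻¹ * x
          calc x * (g * g₀⁻¹) = g * (g⁻¹ * x * g) * g₀⁻¹ := by group
            _ = g * g₀⁻¹ * x := by rw [e]; group
    _ ≤ 2 * Fintype.card F * 2 := by gcongr
    _ = _ := by ring

/-- Growth of generating sets of `SL(2, F)`: sets that do not grow are large. -/
theorem card_pow_three_le_of_generating (hF : (2 : F) ≠ 0) {D : Finset SL(2, F)}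
    (hD : D⁻¹ = D) (h1 : 1 ∈ D)
    (hmove : ∀ v : Fin 2 → F, v ≠ 0 → ∃ a ∈ D, ¬ ∃ c : F, a.1.mulVec v = c • v)
    (hnc : ∃ a ∈ D, ∃ c ∈ D, ¬ Commute a c)
    (hgen : Subgroup.closure (D : Set SL(2, F)) = ⊤)
    (hbig : 1728 * 12 ^ 3 * #(D ^ 26) ^ 2 < #D ^ 3) :
    Fintype.card SL(2, F) ^ 3 * #D ^ 3 ≤ 884736 * Fintype.card F ^ 3 * #(D ^ 26) ^ 5 := by
  have hD26 : #D ≤ #(D ^ 26) := by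
    simpa using card_le_card (pow_subset_pow_right h1 (show 1 ≤ 26 by norm_num))
  have hD108 : 108 < #D := by
    by_contra! h
    have h2 := Nat.pow_le_pow_left hD26 2
    have : #D ^ 3 ≤ 108 * #D ^ 2 := by rw [pow_succ, mul_comm]; gcongr
    have : #D ^ 3 ≤ 1728 * 12 ^ 3 * #(D ^ 26) ^ 2 := by
      refine this.trans (Nat.mul_le_mul (by norm_num) h2)
    omega
  obtain ⟨h₀, hh₀, hr₀⟩ := exists_isRegular h1 hmove hnc hD108
  have hcent : ∀ {c : ℕ}, #D ^ 3 ≤ 1728 * #(D ^ 26) ^ 2 * c ^ 3 → 12 ≤ c := by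
    intro c hc
    by_contra! h
    have : c ^ 3 ≤ 12 ^ 3 := Nat.pow_le_pow_left h.le 3
    have := hc.trans (Nat.mul_le_mul_left (1728 * #(D ^ 26) ^ 2) this)
    nlinarith
  set c : SL(2, F) → ℕ := fun g => #{x ∈ D ^ 2 | g * h₀ * g⁻¹ * x = x * (g * h₀ * g⁻¹)} with hc
  have key : ∀ g, #D ^ 3 ≤ 1728 * #(D ^ 26) ^ 2 * c g ^ 3 := by
    have step : ∀ d ∈ D, ∀ g, #D ^ 3 ≤ 1728 * #(D ^ 26) ^ 2 * c g ^ 3 →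
        #D ^ 3 ≤ 1728 * #(D ^ 26) ^ 2 * c (d * g) ^ 3 := by
      intro d hd g hg
      have h12 := hcent hg
      have hrg := hr₀.conj g
      have hcard := card_le_regular_add_six hF hrg.2.1 hrg.2.2
        {x ∈ D ^ 2 | g * h₀ * g⁻¹ * x = x * (g * h₀ * g⁻¹)} (fun x hx => (mem_filter.1 hx).2)
      obtain ⟨w, hw⟩ := card_pos.1 (show 0 < #{x ∈ ({x ∈ D ^ 2 |
        g * h₀ * g⁻¹ * x = x * (g * h₀ * g⁻¹)} : Finset _) | tr x ≠ 0 ∧ tr x ≠ 2 ∧ tr x ≠ -2} by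
          change 12 ≤ #_ at h12; omega)
      obtain ⟨hw1, hwr⟩ := mem_filter.1 hw
      obtain ⟨hw2, hwc⟩ := mem_filter.1 hw1
      have hwr' : IsRegular (d * w * d⁻¹) := IsRegular.conj hwr d
      have hmem : d * w * d⁻¹ ∈ D ^ 4 := by
        rw [show 4 = 1 + 2 + 1 by norm_num, pow_add, pow_add, pow_one]
        exact mul_mem_mul (mul_mem_mul hd hw2) (by rw [← hD]; exact inv_mem_inv hd)
      refine (card_pow_three_le_centralizer hD h1 hmove hmem hwr').trans ?_
      gcongr
      refine card_le_card fun x hx => ?_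
      rw [mem_filter] at hx ⊢
      refine ⟨hx.1, ?_⟩
      have hcomm : Commute (d * w * d⁻¹) (d * g * h₀ * (d * g)⁻¹) := by
        show d * w * d⁻¹ * (d * g * h₀ * (d * g)⁻¹) = d * g * h₀ * (d * g)⁻¹ * (d * w * d⁻¹)
        calc d * w * d⁻¹ * (d * g * h₀ * (d * g)⁻¹) = d * (w * (g * h₀ * g⁻¹)) * d⁻¹ := by group
          _ = _ := by rw [← hwc]; group
      exact commute_of_commute hwr'.not_isScalar hcomm hx.2
    intro g
    have hg : g ∈ Subgroup.closure (D : Set SL(2, F)) := by rw [hgen]; trivial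
    induction hg using Subgroup.closure_induction_left with
    | one =>
      have := card_pow_three_le_centralizer hD h1 hmove
        (pow_subset_pow_right h1 (show 3 ≤ 4 by norm_num) hh₀) hr₀
      simpa [hc] using this
    | mul_left x hx y hy ih => exact step x hx y ih
    | inv_mul_cancel x hx y hy ih =>
      exact step x⁻¹ (by rw [← hD]; exact inv_mem_inv hx) y ih
  obtain ⟨g₀, -, hmin⟩ := exists_min_image (univ : Finset SL(2, F)) c ⟨1, mem_univ _⟩
  have h12 := hcent (key g₀)
  have hcount : #(univ : Finset SL(2, F)) * (c g₀ - 6) ≤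
      #{x ∈ D ^ 2 | tr x ≠ 0 ∧ tr x ≠ 2 ∧ tr x ≠ -2} * (4 * Fintype.card F) := by
    refine card_mul_le_card_mul (fun g x => g * h₀ * g⁻¹ * x = x * (g * h₀ * g⁻¹)) ?_ ?_
    · intro g _
      have hrg := hr₀.conj g
      have hcard := card_le_regular_add_six hF hrg.2.1 hrg.2.2
        {x ∈ D ^ 2 | g * h₀ * g⁻¹ * x = x * (g * h₀ * g⁻¹)} (fun x hx => (mem_filter.1 hx).2)
      have hm : c g₀ ≤ c g := hmin g (mem_univ g)
      rw [filter_filter] at hcard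
      rw [bipartiteAbove, filter_filter]
      simp only [and_comm] at hcard ⊢
      change c g ≤ _ at hcard
      omega
    · intro x hx
      exact card_conjugators_le hF (mem_filter.1 hx).2 hr₀
  have hD2 : #{x ∈ D ^ 2 | tr x ≠ 0 ∧ tr x ≠ 2 ∧ tr x ≠ -2} ≤ #(D ^ 26) :=
    (card_le_card (filter_subset _ _)).trans
      (card_le_card (pow_subset_pow_right h1 (by norm_num)))
  rw [card_univ] at hcount
  have hcount' : Fintype.card SL(2, F) * c g₀ ≤ 8 * Fintype.card F * #(D ^ 26) := by
    calc Fintype.card SL(2, F) * c g₀ ≤ Fintype.card SL(2, F) * (2 * (c g₀ - 6)) := by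
          gcongr; omega
      _ = 2 * (Fintype.card SL(2, F) * (c g₀ - 6)) := by ring
      _ ≤ 2 * (#(D ^ 26) * (4 * Fintype.card F)) :=
          Nat.mul_le_mul_left 2 (hcount.trans (Nat.mul_le_mul_right _ hD2))
      _ = _ := by ring
  calc Fintype.card SL(2, F) ^ 3 * #D ^ 3
      ≤ Fintype.card SL(2, F) ^ 3 * (1728 * #(D ^ 26) ^ 2 * c g₀ ^ 3) := by gcongr; exact key g₀
    _ = 1728 * #(D ^ 26) ^ 2 * (Fintype.card SL(2, F) * c g₀) ^ 3 := by ring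
    _ ≤ 1728 * #(D ^ 26) ^ 2 * (8 * Fintype.card F * #(D ^ 26)) ^ 3 := by gcongr
    _ = _ := by ring

end Growth

section ClassEquation

lemma card_dvd_sum_of_invariant {H α : Type*} [Group H] [Fintype H] [Fintype α] [DecidableEq α]
    (φ : H →* Equiv.Perm α) (f : α → ℕ) (hinv : ∀ g a, f (φ g a) = f a)
    (hdvd : ∀ a, #{g : H | φ g a = a} ∣ f a) : Fintype.card H ∣ ∑ a, f a := by
  classical
  let _ : MulAction H α := MulAction.compHom α φ
  have hsmul : ∀ (g : H) (a : α), g • a = φ g a := fun _ _ => rfl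
  rw [← (MulAction.selfEquivSigmaOrbits H α).symm.sum_comp, Fintype.sum_sigma]
  refine dvd_sum fun ω _ => ?_
  set a := Quotient.out ω with ha
  have hconst : ∀ y : MulAction.orbit H a,
      f ((MulAction.selfEquivSigmaOrbits H α).symm ⟨ω, y⟩) = f a := by
    rintro ⟨_, g, rfl⟩
    exact hinv g a
  rw [sum_congr rfl (fun y _ => hconst y), sum_const, card_univ, smul_eq_mul]
  obtain ⟨k, hk⟩ := hdvd a
  have hs : Fintype.card (MulAction.stabilizer H a) = #{g : H | φ g a = a} := by
    rw [Fintype.card_subtype]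
    rfl
  rw [hk, ← mul_assoc, ← hs, MulAction.card_orbit_mul_card_stabilizer_eq_card_group]
  exact dvd_mul_right _ _

lemma mem_center_conj {H : Type*} [Group H] {g x : H} :
    g * x * g⁻¹ ∈ Subgroup.center H ↔ x ∈ Subgroup.center H := by
  constructor
  · intro h
    have := (inferInstance : (Subgroup.center H).Normal).conj_mem _ h g⁻¹
    simpa [mul_assoc] using this
  · intro h
    exact (inferInstance : (Subgroup.center H).Normal).conj_mem _ h g

variable {H : Type*} [Group H] [Fintype H] [DecidableEq H]

/-- The centralizer of an element, as a finite set. -/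
def centralizerFinset (x : H) : Finset H := {y | x * y = y * x}

lemma mem_centralizerFinset {x y : H} : y ∈ centralizerFinset x ↔ Commute x y := by
  simp [centralizerFinset, Commute, SemiconjBy]

lemma centralizerFinset_eq {x y : H}
    (hCA : ∀ x : H, x ∉ Subgroup.center H → ∀ y z, Commute x y → Commute x z → Commute y z)
    (hx : x ∉ Subgroup.center H) (hy : y ∉ Subgroup.center H) (hxy : Commute x y) :
    centralizerFinset x = centralizerFinset y := by
  ext z
  rw [mem_centralizerFinset, mem_centralizerFinset]
  exact ⟨fun h => hCA x hx y z hxy h, fun h => hCA y hy x z hxy.symm h⟩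

lemma smul_centralizerFinset (g x : H) :
    MulAut.conj g • centralizerFinset x = centralizerFinset (g * x * g⁻¹) := by
  ext y
  rw [← inv_smul_mem_iff, ← map_inv, mem_centralizerFinset, mem_centralizerFinset]
  simp only [MulAut.smul_def, MulAut.conj_apply, inv_inv, Commute, SemiconjBy]
  constructor <;> intro h
  · calc g * x * g⁻¹ * y = g * (x * (g⁻¹ * y * g)) * g⁻¹ := by group
      _ = y * (g * x * g⁻¹) := by rw [h]; group
  · calc x * (g⁻¹ * y * g) = g⁻¹ * (g * x * g⁻¹ * y) * g := by group
      _ = g⁻¹ * y * g * x := by rw [h]; group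

lemma card_stabilizer_dvd
    (hCA : ∀ x : H, x ∉ Subgroup.center H → ∀ y z, Commute x y → Commute x z → Commute y z)
    (hinv : ∀ x : H, x ∉ Subgroup.center H → ∀ g, Commute x (g * x * g⁻¹) →
      g * x * g⁻¹ = x ∨ g * x * g⁻¹ = x⁻¹) {x : H} (hx : x ∉ Subgroup.center H) :
    #{g : H | MulAut.conj g • centralizerFinset x = centralizerFinset x} ∣
      2 * #(centralizerFinset x) := by
  set S : Finset H := {g : H | MulAut.conj g • centralizerFinset x = centralizerFinset x} with hS
  have hmem : ∀ g, g ∈ S ↔ Commute x (g * x * g⁻¹) := by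
    intro g
    rw [hS, mem_filter, smul_centralizerFinset]
    constructor
    · rintro ⟨-, h⟩
      have : x ∈ centralizerFinset (g * x * g⁻¹) := by
        rw [h, mem_centralizerFinset]
      exact (mem_centralizerFinset.1 this).symm
    · intro h
      refine ⟨mem_univ _, ?_⟩
      exact centralizerFinset_eq hCA (fun h' => hx (mem_center_conj.1 h')) hx h.symm
  have hC : ∀ g, g ∈ centralizerFinset x ↔ g * x * g⁻¹ = x := by
    intro g
    rw [mem_centralizerFinset, mul_inv_eq_iff_eq_mul]
    exact eq_comm
  have hCS : centralizerFinset x ⊆ S := by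
    intro g hg
    rw [hmem, (hC g).1 hg]
  by_cases hSC : S ⊆ centralizerFinset x
  · rw [Subset.antisymm hSC hCS]; exact dvd_mul_left _ _
  · obtain ⟨n, hnS, hnC⟩ := not_subset.1 hSC
    have hn : n * x * n⁻¹ = x⁻¹ :=
      (hinv x hx n ((hmem n).1 hnS)).resolve_left (fun h => hnC ((hC n).2 h))
    have hne : x⁻¹ ≠ x := fun h => hnC ((hC n).2 (hn.trans h))
    have : #(S \ centralizerFinset x) = #(centralizerFinset x) := by
      refine card_nbij' (fun g => n⁻¹ * g) (fun g => n * g) ?_ ?_ (fun _ _ => by simp)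
        (fun _ _ => by simp)
      · intro g hg
        rw [mem_coe, mem_sdiff] at hg
        have e : g * x * g⁻¹ = x⁻¹ :=
          (hinv x hx g ((hmem g).1 hg.1)).resolve_left (fun h => hg.2 ((hC g).2 h))
        rw [mem_coe, hC]
        calc n⁻¹ * g * x * (n⁻¹ * g)⁻¹ = n⁻¹ * (g * x * g⁻¹) * n := by group
          _ = n⁻¹ * (n * x * n⁻¹) * n := by rw [e, hn]
          _ = x := by group
      · intro g hg
        rw [mem_coe, hC] at hg
        have e : n * g * x * (n * g)⁻¹ = x⁻¹ := by
          calc n * g * x * (n * g)⁻¹ = n * (g * x * g⁻¹) * n⁻¹ := by group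
            _ = x⁻¹ := by rw [hg, hn]
        rw [mem_coe, mem_sdiff, hmem, hC]
        simp only [e]
        exact ⟨(Commute.refl x).inv_right, hne⟩
    have h2 := card_sdiff_add_card_eq_card hCS
    rw [← h2, this, two_mul]

/-- The class equation of a finite group with abelian centralizers, all of which are either tiny
or large: such a group has a normal centralizer. -/
theorem exists_normal_centralizer
    (hCA : ∀ x : H, x ∉ Subgroup.center H → ∀ y z, Commute x y → Commute x z → Commute y z)
    (hinv : ∀ x : H, x ∉ Subgroup.center H → ∀ g, Commute x (g * x * g⁻¹) →
      g * x * g⁻¹ = x ∨ g * x * g⁻¹ = x⁻¹)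
    (hZ : #{x : H | x ∈ Subgroup.center H} ≤ 2)
    (hC : ∀ x : H, x ∉ Subgroup.center H →
      #(centralizerFinset x) ≤ 6 ∨ 123 ≤ #(centralizerFinset x))
    (hH : 120 < Fintype.card H) :
    ∃ x : H, x ∉ Subgroup.center H ∧ ∀ g, g * x * g⁻¹ = x ∨ g * x * g⁻¹ = x⁻¹ := by
  classical
  set Z : Finset H := {x : H | x ∈ Subgroup.center H} with hZdef
  set X : Finset H := {x : H | x ∉ Subgroup.center H} with hXdef
  set Xs : Finset H := {x ∈ X | #(centralizerFinset x) ≤ 6} with hXs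
  set Xb : Finset H := {x ∈ X | ¬ #(centralizerFinset x) ≤ 6} with hXb
  have hXX : #Xs + #Xb = #X := card_filter_add_card_filter_not _
  have hZX : #Z + #X = Fintype.card H := card_filter_add_card_filter_not _
  have hmemX : ∀ x, x ∈ X ↔ x ∉ Subgroup.center H := fun x => by simp [hXdef]
  have hmemZ : ∀ x, x ∈ Z ↔ x ∈ Subgroup.center H := fun x => by simp [hZdef]
  have hmemXs : ∀ x, x ∈ Xs ↔ x ∉ Subgroup.center H ∧ #(centralizerFinset x) ≤ 6 :=
    fun x => by simp [hXs, hXdef]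
  have hmemXb : ∀ x, x ∈ Xb ↔ x ∉ Subgroup.center H ∧ ¬ #(centralizerFinset x) ≤ 6 :=
    fun x => by simp [hXb, hXdef]
  set Θ : Finset (Finset H) := Xb.image centralizerFinset with hΘ
  have hcardconj : ∀ g x : H, #(centralizerFinset (g * x * g⁻¹)) = #(centralizerFinset x) := by
    intro g x
    rw [← smul_centralizerFinset, card_smul_finset]
  have hXb_conj : ∀ g x : H, x ∈ Xb → g * x * g⁻¹ ∈ Xb := by
    intro g x hx
    rw [hmemXb] at hx ⊢
    rwa [mem_center_conj, hcardconj]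
  have hXs_conj : ∀ g x : H, g * x * g⁻¹ ∈ Xs ↔ x ∈ Xs := by
    intro g x
    rw [hmemXs, hmemXs, mem_center_conj, hcardconj]
  have d1 : Fintype.card H ∣ 60 * #Xs := by
    have := card_dvd_sum_of_invariant
      ((MulAction.toPermHom (MulAut H) H).comp (MulAut.conj (G := H)))
      (fun x => if x ∈ Xs then 60 else 0) ?_ ?_
    · rwa [← sum_filter, filter_mem_eq_inter, univ_inter, sum_const, smul_eq_mul, mul_comm] at this
    · intro g x
      simp [hXs_conj]
    · intro x
      by_cases hx : x ∈ Xs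
      · simp only [hx, if_true]
        have e : ({g : H |
            ((MulAction.toPermHom (MulAut H) H).comp (MulAut.conj (G := H))) g x = x} :
            Finset H) = centralizerFinset x := by
          ext g
          simp only [mem_filter, mem_univ, true_and, mem_centralizerFinset]
          change g * x * g⁻¹ = x ↔ _
          rw [mul_inv_eq_iff_eq_mul]
          exact eq_comm
        rw [e]
        have h6 := ((hmemXs x).1 hx).2
        have h0 : 0 < #(centralizerFinset x) := card_pos.2 ⟨1, mem_centralizerFinset.2 (by simp)⟩
        generalize #(centralizerFinset x) = c at *
        interval_cases c <;> norm_num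
      · simp [hx]
  have hΘ_conj' : ∀ (g : H) (C : Finset H), C ∈ Θ → MulAut.conj g • C ∈ Θ := by
    intro g C hC
    obtain ⟨x, hx, rfl⟩ := mem_image.1 hC
    rw [smul_centralizerFinset]
    exact mem_image_of_mem _ (hXb_conj g x hx)
  have hΘ_conj : ∀ (g : H) (C : Finset H), MulAut.conj g • C ∈ Θ ↔ C ∈ Θ := by
    intro g C
    refine ⟨fun h => ?_, hΘ_conj' g C⟩
    have := hΘ_conj' g⁻¹ _ h
    rwa [map_inv, inv_smul_smul] at this
  have d2 : Fintype.card H ∣ 2 * ∑ C ∈ Θ, #C := by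
    have := card_dvd_sum_of_invariant
      ((MulAction.toPermHom (MulAut H) (Finset H)).comp (MulAut.conj (G := H)))
      (fun C => if C ∈ Θ then 2 * #C else 0) ?_ ?_
    · rwa [← sum_filter, filter_mem_eq_inter, univ_inter, ← mul_sum] at this
    · intro g C
      change (if MulAut.conj g • C ∈ Θ then 2 * #(MulAut.conj g • C) else 0) = _
      simp only [hΘ_conj, card_smul_finset]
    · intro C
      by_cases hCΘ : C ∈ Θ
      · simp only [hCΘ, if_true]
        obtain ⟨x, hx, rfl⟩ := mem_image.1 hCΘ
        exact card_stabilizer_dvd hCA hinv ((hmemXb x).1 hx).1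
      · simp [hCΘ]
  have hfib : ∀ C ∈ Θ, #{x ∈ Xb | centralizerFinset x = C} + #Z = #C := by
    intro C hCΘ
    obtain ⟨x, hx, rfl⟩ := mem_image.1 hCΘ
    have hx' := (hmemXb x).1 hx
    have hZC : Z ⊆ centralizerFinset x := fun y hy =>
      mem_centralizerFinset.2 (Subgroup.mem_center_iff.1 ((hmemZ y).1 hy) x)
    rw [← card_sdiff_add_card_eq_card hZC]
    congr 2
    ext y
    rw [mem_filter, mem_sdiff, hmemXb, hmemZ, mem_centralizerFinset]
    constructor
    · rintro ⟨⟨h1, -⟩, h2⟩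
      refine ⟨mem_centralizerFinset.1 ?_, h1⟩
      rw [← h2, mem_centralizerFinset]
    · rintro ⟨h1, h2⟩
      have e := centralizerFinset_eq hCA hx'.1 h2 h1
      exact ⟨⟨h2, e ▸ hx'.2⟩, e.symm⟩
  have hsum : ∑ C ∈ Θ, #C = #Xb + #Θ * #Z := by
    rw [card_eq_sum_card_image centralizerFinset Xb, ← sum_congr rfl hfib, sum_add_distrib,
      sum_const, smul_eq_mul]
  have hbig : #Θ * 123 ≤ ∑ C ∈ Θ, #C := by
    rw [← smul_eq_mul]
    refine card_nsmul_le_sum _ _ _ fun C hCΘ => ?_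
    obtain ⟨x, hx, rfl⟩ := mem_image.1 hCΘ
    have hx' := (hmemXb x).1 hx
    exact (hC x hx'.1).resolve_left hx'.2
  have hZpos : 0 < #Z := card_pos.2 ⟨1, (hmemZ 1).2 (one_mem _)⟩
  have d3 : Fintype.card H ∣ 60 * #Xs + 30 * (2 * ∑ C ∈ Θ, #C) :=
    dvd_add d1 (Dvd.dvd.mul_left d2 30)
  have hΘZ : #Θ * #Z ≤ #Θ * 2 := Nat.mul_le_mul_left _ hZ
  rcases Nat.lt_trichotomy #Θ 1 with h0 | h1 | h2
  · have h0' : #Θ = 0 := by omega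
    rw [h0'] at hsum
    have e : 60 * #Xs + 30 * (2 * ∑ C ∈ Θ, #C) + 60 * #Z = 60 * Fintype.card H := by omega
    have d4 : Fintype.card H ∣ 60 * #Z :=
      (Nat.dvd_add_right d3).1 (e ▸ dvd_mul_left _ _)
    have := Nat.le_of_dvd (by omega) d4
    omega
  · obtain ⟨C, hCΘ⟩ := card_eq_one.1 h1
    obtain ⟨x, hx, hxC⟩ := mem_image.1 (show C ∈ Θ by rw [hCΘ]; exact mem_singleton_self C)
    have hx' := (hmemXb x).1 hx
    refine ⟨x, hx'.1, fun g => hinv x hx'.1 g ?_⟩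
    have hg : centralizerFinset (g * x * g⁻¹) = C := by
      have : centralizerFinset (g * x * g⁻¹) ∈ Θ := mem_image_of_mem _ (hXb_conj g x hx)
      rw [hCΘ] at this
      exact mem_singleton.1 this
    rw [← mem_centralizerFinset, hxC, ← hg, mem_centralizerFinset]
  · exfalso
    obtain ⟨k, hk⟩ : ∃ k, #Θ = k + 2 := ⟨#Θ - 2, by omega⟩
    have e : 60 * #Xs + 30 * (2 * ∑ C ∈ Θ, #C) = 60 * Fintype.card H + 60 * ((k + 1) * #Z) := by
      have : #Θ * #Z = (k + 1) * #Z + #Z := by rw [hk]; ring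
      omega
    have d4 : Fintype.card H ∣ 60 * ((k + 1) * #Z) :=
      (Nat.dvd_add_right (dvd_mul_left _ 60)).1 (e ▸ d3)
    have hpos : 0 < (k + 1) * #Z := by positivity
    have hle := Nat.le_of_dvd (by omega) d4
    have : (k + 1) * #Z ≤ (k + 1) * 2 := Nat.mul_le_mul_left _ hZ
    omega

end ClassEquation

section Metabelian

lemma commutator_mem {Γ : Type*} [Group Γ] {H : Subgroup Γ} {a b : Γ} (ha : a ∈ H) (hb : b ∈ H) :
    ⁅a, b⁆ ∈ H :=
  mul_mem (mul_mem (mul_mem ha hb) (inv_mem ha)) (inv_mem hb)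

lemma isMetabelian_of_commute {Γ : Type*} [Group Γ] {H : Subgroup Γ}
    (h : ∀ a ∈ H, ∀ b ∈ H, Commute a b) : IsMetabelian H := fun _ ha _ hb _ hc _ hd =>
  h _ (commutator_mem ha hb) _ (commutator_mem hc hd)

lemma commute_commutator_of_conj {Γ : Type*} [Group Γ] {a b x : Γ}
    (ha : a * x * a⁻¹ = x ∨ a * x * a⁻¹ = x⁻¹) (hb : b * x * b⁻¹ = x ∨ b * x * b⁻¹ = x⁻¹) :
    Commute x ⁅a, b⁆ := by
  have key : ∀ g, (g * x * g⁻¹ = x ∨ g * x * g⁻¹ = x⁻¹) →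
      SemiconjBy g x x ∨ SemiconjBy g x x⁻¹ := by
    intro g hg
    simpa only [SemiconjBy, mul_inv_eq_iff_eq_mul] using hg
  rw [commutatorElement_def]
  refine SemiconjBy.eq (a := _) ?_ |>.symm
  have hs : ∀ {g}, SemiconjBy g x x⁻¹ → SemiconjBy g x⁻¹ x := fun h => by
    simpa using h.inv_right
  rcases key a ha with ha | ha <;> rcases key b hb with hb | hb
  · exact ((ha.mul_left hb).mul_left ha.inv_symm_left).mul_left hb.inv_symm_left
  · exact ((ha.mul_left (hs hb)).mul_left ha.inv_right.inv_symm_left).mul_left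
      (hs hb).inv_symm_left
  · exact (((hs ha).mul_left hb.inv_right).mul_left (hs ha).inv_symm_left).mul_left
      hb.inv_symm_left
  · exact (((hs ha).mul_left hb).mul_left ha.inv_symm_left).mul_left
      (hs hb).inv_symm_left

variable {F : Type*} [Field F]

lemma commute_of_fixed {x y : SL(2, F)} {v : Fin 2 → F} (hv : v ≠ 0) (hx : x.1.mulVec v = v)
    (hy : y.1.mulVec v = v) : Commute x y := by
  have tx := tr_eq_two_of_fixed x hv hx
  have ty := tr_eq_two_of_fixed y hv hy
  rw [tr] at tx ty
  simp only [funext_iff, Matrix.mulVec, dotProduct, Fin.sum_univ_two, Fin.forall_fin_two]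
    at hx hy
  obtain ⟨a1, a2⟩ := hx
  obtain ⟨b1, b2⟩ := hy
  rw [commute_iff]
  have hne : v 0 ≠ 0 ∨ v 1 ≠ 0 := by
    by_contra! h
    exact hv (by ext i; fin_cases i <;> simp [h])
  have ex : x.1 1 1 = 2 - x.1 0 0 := by linear_combination tx
  have ey : y.1 1 1 = 2 - y.1 0 0 := by linear_combination ty
  rw [ex] at a2 ⊢
  rw [ey] at b2 ⊢
  rcases hne with h0 | h1
  · obtain ⟨t, ht⟩ : ∃ t, v 1 = t * v 0 := ⟨v 1 / v 0, by field_simp⟩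
    rw [ht] at a1 a2 b1 b2
    have a1' : x.1 0 0 = 1 - x.1 0 1 * t := mul_right_cancel₀ h0 (by linear_combination a1)
    have b1' : y.1 0 0 = 1 - y.1 0 1 * t := mul_right_cancel₀ h0 (by linear_combination b1)
    have a2' : x.1 1 0 = t - (2 - x.1 0 0) * t := mul_right_cancel₀ h0 (by linear_combination a2)
    have b2' : y.1 1 0 = t - (2 - y.1 0 0) * t := mul_right_cancel₀ h0 (by linear_combination b2)
    rw [a2', b2', a1', b1']
    refine ⟨?_, ?_, ?_⟩ <;> ring
  · obtain ⟨t, ht⟩ : ∃ t, v 0 = t * v 1 := ⟨v 0 / v 1, by field_simp⟩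
    rw [ht] at a1 a2 b1 b2
    have a2' : x.1 0 0 = 1 + x.1 1 0 * t := mul_right_cancel₀ h1 (by linear_combination -a2)
    have b2' : y.1 0 0 = 1 + y.1 1 0 * t := mul_right_cancel₀ h1 (by linear_combination -b2)
    have a1' : x.1 0 1 = t - x.1 0 0 * t := mul_right_cancel₀ h1 (by linear_combination a1)
    have b1' : y.1 0 1 = t - y.1 0 0 * t := mul_right_cancel₀ h1 (by linear_combination b1)
    rw [a1', b1', a2', b2']
    refine ⟨?_, ?_, ?_⟩ <;> ring

lemma isMetabelian_of_fixed_line {H : Subgroup SL(2, F)} {v : Fin 2 → F} (hv : v ≠ 0)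
    (h : ∀ a ∈ H, ∃ c : F, a.1.mulVec v = c • v) : IsMetabelian H := by
  have key : ∀ a ∈ H, ∀ b ∈ H, (⁅a, b⁆ : SL(2, F)).1.mulVec v = v := by
    intro a ha b hb
    obtain ⟨l, hl⟩ := h a ha
    obtain ⟨m, hm⟩ := h b hb
    obtain ⟨hl0, hl'⟩ := mulVec_inv_of_eigen a hv hl
    obtain ⟨hm0, hm'⟩ := mulVec_inv_of_eigen b hv hm
    rw [commutatorElement_def, mulVec_mul, mulVec_mul, mulVec_mul, hm', Matrix.mulVec_smul, hl',
      Matrix.mulVec_smul, Matrix.mulVec_smul, Matrix.mulVec_smul, Matrix.mulVec_smul, hm,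
      Matrix.mulVec_smul, hl, smul_smul, smul_smul, smul_smul]
    rw [show m⁻¹ * l⁻¹ * m * l = 1 by field_simp, one_smul]
  exact fun a ha b hb c hc d hd => commute_of_fixed hv (key a ha b hb) (key c hc d hd)

end Metabelian

section Transvections

variable {F : Type*} [Field F]

/-- The upper unitriangular matrices. -/
def upper (t : F) : SL(2, F) := ⟨!![1, t; 0, 1], by simp⟩

/-- The lower unitriangular matrices. -/
def lower (t : F) : SL(2, F) := ⟨!![1, 0; t, 1], by simp⟩

lemma upper_coe (t : F) : (upper t).1 = !![1, t; 0, 1] := rfl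

lemma lower_coe (t : F) : (lower t).1 = !![1, 0; t, 1] := rfl

lemma upper_add (s t : F) : upper (s + t) = upper s * upper t := by
  apply ext_entries <;>
    simp [upper_coe, Matrix.mul_apply, Fin.sum_univ_two, add_comm]

lemma lower_add (s t : F) : lower (s + t) = lower s * lower t := by
  apply ext_entries <;>
    simp [lower_coe, Matrix.mul_apply, Fin.sum_univ_two]

lemma eq_top_of_unipotent {K : Subgroup SL(2, F)} (hU : ∀ t : F, upper t ∈ K)
    (hL : ∀ t : F, lower t ∈ K) : K = ⊤ := by
  have key : ∀ g : SL(2, F), g.1 1 0 ≠ 0 → g ∈ K := by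
    intro g hg
    have e : g = upper ((g.1 0 0 - 1) / g.1 1 0) * lower (g.1 1 0) *
        upper ((g.1 1 1 - 1) / g.1 1 0) := by
      have hd := det_eq g
      apply ext_entries <;>
        simp only [Matrix.SpecialLinearGroup.coe_mul, upper_coe, lower_coe, Matrix.mul_apply,
          Fin.sum_univ_two] <;> simp <;> field_simp
      · ring
      · linear_combination -hd
      · ring
    rw [e]
    exact mul_mem (mul_mem (hU _) (hL _)) (hU _)
  refine eq_top_iff.2 fun g _ => ?_
  by_cases hg : g.1 1 0 = 0
  · have h1 : lower 1 * g ∈ K := by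
      apply key
      have hd := det_eq g
      rw [hg] at hd
      simp only [Matrix.SpecialLinearGroup.coe_mul, lower_coe, Matrix.mul_apply, Fin.sum_univ_two]
      simp only [Matrix.of_apply, Matrix.cons_val', Matrix.cons_val_zero, Matrix.cons_val_one,
        Matrix.cons_val_fin_one, hg]
      rintro h0
      rw [one_mul, mul_zero, add_zero] at h0
      rw [h0] at hd
      simp at hd
    simpa using mul_mem (inv_mem (hL 1)) h1
  · exact key g hg

end Transvections

section Generation

lemma exists_eigenvector_of_tr {F : Type*} [Field F] {u : SL(2, F)} (hu : ¬ IsScalar u) {ε : F}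
    (hε : ε ^ 2 = 1) (htr : tr u = 2 * ε) : ∃ v : Fin 2 → F, v ≠ 0 ∧ u.1.mulVec v = ε • v := by
  rw [tr] at htr
  have hd := det_eq u
  have h0 : !![u.1 0 0 - ε, u.1 0 1; u.1 1 0, u.1 1 1 - ε] ≠ 0 := by
    intro h0
    have h00 := congrFun (congrFun h0 0) 0
    have h01 := congrFun (congrFun h0 0) 1
    have h10 := congrFun (congrFun h0 1) 0
    have h11 := congrFun (congrFun h0 1) 1
    simp at h00 h01 h10 h11
    exact hu ⟨by linear_combination h00 - h11, h10, h01⟩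
  have ht : (!![u.1 0 0 - ε, u.1 0 1; u.1 1 0, u.1 1 1 - ε]).trace = 0 := by
    rw [Matrix.trace_fin_two]
    simp
    linear_combination htr
  have hdet : (!![u.1 0 0 - ε, u.1 0 1; u.1 1 0, u.1 1 1 - ε]).det = 0 := by
    rw [Matrix.det_fin_two]
    simp
    linear_combination hd - ε * htr - hε
  obtain ⟨v, hv, hNv, -⟩ := exists_eigenvector_of_nilpotent h0 ht hdet
  refine ⟨v, hv, ?_⟩
  simp only [funext_iff, Matrix.mulVec, dotProduct, Fin.sum_univ_two, Fin.forall_fin_two,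
    Pi.smul_apply, smul_eq_mul, Pi.zero_apply] at hNv ⊢
  simp only [Matrix.of_apply, Matrix.cons_val', Matrix.cons_val_zero, Matrix.cons_val_one,
    Matrix.cons_val_fin_one] at hNv
  exact ⟨by linear_combination hNv.1, by linear_combination hNv.2⟩

lemma exists_upper_of_eigenvector {F : Type*} [Field F] (h2 : (2 : F) ≠ 0) {x : SL(2, F)} {ε : F}
    (hε : ε ^ 2 = 1) (hx : ¬ IsScalar x) (h : x.1.mulVec ![1, 0] = ε • ![1, 0]) :
    ∃ s : F, s ≠ 0 ∧ upper s = x * x := by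
  have hε0 : ε ≠ 0 := by rintro rfl; simp at hε
  have e0 : x.1 0 0 = ε := by simpa [Matrix.mulVec, dotProduct] using congrFun h 0
  have e1 : x.1 1 0 = 0 := by simpa [Matrix.mulVec, dotProduct] using congrFun h 1
  have hdx := det_eq x
  have e2 : x.1 1 1 = ε := by
    rw [e0, e1] at hdx
    linear_combination ε * hdx - x.1 1 1 * hε
  refine ⟨2 * ε * x.1 0 1, mul_ne_zero (mul_ne_zero h2 hε0)
    fun h => hx ⟨by rw [e0, e2, sub_self], e1, h⟩, ?_⟩
  apply ext_entries <;>
    simp only [Matrix.SpecialLinearGroup.coe_mul, Matrix.mul_apply, Fin.sum_univ_two, e0, e1,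
      e2, upper_coe] <;> simp
  · linear_combination -hε
  · ring
  · linear_combination -hε

lemma exists_lower_of_eigenvector {F : Type*} [Field F] (h2 : (2 : F) ≠ 0) {x : SL(2, F)} {ε : F}
    (hε : ε ^ 2 = 1) (hx : ¬ IsScalar x) (h : x.1.mulVec ![0, 1] = ε • ![0, 1]) :
    ∃ s : F, s ≠ 0 ∧ lower s = x * x := by
  have hε0 : ε ≠ 0 := by rintro rfl; simp at hε
  have e0 : x.1 0 1 = 0 := by simpa [Matrix.mulVec, dotProduct] using congrFun h 0
  have e1 : x.1 1 1 = ε := by simpa [Matrix.mulVec, dotProduct] using congrFun h 1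
  have hdx := det_eq x
  have e2 : x.1 0 0 = ε := by
    rw [e0, e1] at hdx
    linear_combination ε * hdx - x.1 0 0 * hε
  refine ⟨2 * ε * x.1 1 0, mul_ne_zero (mul_ne_zero h2 hε0)
    fun h => hx ⟨by rw [e1, e2, sub_self], h, e0⟩, ?_⟩
  apply ext_entries <;>
    simp only [Matrix.SpecialLinearGroup.coe_mul, Matrix.mul_apply, Fin.sum_univ_two, e0, e1,
      e2, lower_coe] <;> simp
  · linear_combination -hε
  · ring
  · linear_combination -hε

lemma isScalar_of_conj {F : Type*} [Field F] {g Q : SL(2, F)} (h : IsScalar (Q⁻¹ * g * Q)) :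
    IsScalar g := by
  have h' := (h.commute Q⁻¹).eq
  have : Q⁻¹ * g * Q = g := by
    calc Q⁻¹ * g * Q = Q * (Q⁻¹ * (Q⁻¹ * g * Q)) := by group
      _ = Q * (Q⁻¹ * g * Q * Q⁻¹) := by rw [h']
      _ = g := by group
  rwa [this] at h

variable {F : Type*} [Field F]

lemma forall_mem_of_hom (hF : Function.Surjective (Nat.cast : ℕ → F)) {K : Subgroup SL(2, F)}
    (φ : F → SL(2, F))
    (hφ : ∀ s t, φ (s + t) = φ s * φ t) {s : F} (hs : s ≠ 0)
    (h : φ s ∈ K) (t : F) :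
    φ t ∈ K := by
  have h0 : φ 0 = 1 := by simpa using hφ 0 0
  have key : ∀ n : ℕ, φ (n * s) ∈ K := by
    intro n
    induction n with
    | zero => simp [h0]
    | succ n ih =>
      rw [Nat.cast_succ, add_mul, one_mul, hφ]
      exact mul_mem ih h
  obtain ⟨n, hn⟩ := hF (t / s)
  have := key n
  rwa [hn, div_mul_cancel₀ _ hs] at this

lemma eq_top_of_mem_of_tr (hF : Function.Surjective (Nat.cast : ℕ → F)) (h2 : (2 : F) ≠ 0)
    {H : Subgroup SL(2, F)}
    (hmove : ∀ v : Fin 2 → F, v ≠ 0 → ∃ a ∈ H, ¬ ∃ c : F, a.1.mulVec v = c • v)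
    {u : SL(2, F)} (hu : u ∈ H) (hns : ¬ IsScalar u) (htr : tr u = 2 ∨ tr u = -2) :
    H = ⊤ := by
  obtain ⟨ε, hε, hεtr⟩ : ∃ ε : F, ε ^ 2 = 1 ∧ tr u = 2 * ε := by
    rcases htr with h | h
    · exact ⟨1, by ring, by rw [h]; ring⟩
    · exact ⟨-1, by ring, by rw [h]; ring⟩
  obtain ⟨v, hv, huv⟩ := exists_eigenvector_of_tr hns hε hεtr
  obtain ⟨a, ha, hav⟩ := hmove v hv
  set w := a.1.mulVec v with hw
  have hd : v 0 * w 1 - v 1 * w 0 ≠ 0 := fun h => hav (exists_smul_of_det_eq_zero hv h)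
  set d := v 0 * w 1 - v 1 * w 0 with hddef
  obtain ⟨P, hP⟩ : ∃ P : SL(2, F), P.1 = !![v 0, d⁻¹ * w 0; v 1, d⁻¹ * w 1] := by
    refine ⟨⟨!![v 0, d⁻¹ * w 0; v 1, d⁻¹ * w 1], ?_⟩, rfl⟩
    rw [Matrix.det_fin_two]
    simp only [Matrix.of_apply, Matrix.cons_val', Matrix.cons_val_zero, Matrix.cons_val_one,
      Matrix.cons_val_fin_one]
    calc _ = d⁻¹ * d := by rw [hddef]; ring
      _ = 1 := inv_mul_cancel₀ hd
  have hP1 : P.1.mulVec ![1, 0] = v := by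
    ext i; fin_cases i <;> simp [hP, Matrix.mulVec, dotProduct, Fin.sum_univ_two]
  have hP2 : P.1.mulVec ![0, 1] = d⁻¹ • w := by
    ext i; fin_cases i <;> simp [hP, Matrix.mulVec, dotProduct, Fin.sum_univ_two]
  have hconj : ∀ {g : SL(2, F)} {e x : Fin 2 → F}, P.1.mulVec e = x →
      g.1.mulVec x = ε • x → (P⁻¹ * g * P).1.mulVec e = ε • e := by
    intro g e x he hg
    rw [mulVec_mul, mulVec_mul, he, hg, Matrix.mulVec_smul, ← he, ← mulVec_mul, inv_mul_cancel]
    simp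
  obtain ⟨K, hK⟩ : ∃ K : Subgroup SL(2, F), K = H.comap (MulAut.conj P).toMonoidHom :=
    ⟨_, rfl⟩
  have hKmem : ∀ g, g ∈ H → P⁻¹ * g * P ∈ K := by
    intro g hg
    rw [hK, Subgroup.mem_comap]
    simpa [mul_assoc] using hg
  have hKtop : K = ⊤ := by
    refine eq_top_of_unipotent ?_ ?_
    · obtain ⟨s, hs, hsx⟩ := exists_upper_of_eigenvector h2 hε
        (fun h => hns (isScalar_of_conj h)) (hconj hP1 huv)
      exact forall_mem_of_hom hF upper upper_add hs (hsx ▸ mul_mem (hKmem u hu) (hKmem u hu))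
    · have hw' : (a * u * a⁻¹).1.mulVec (d⁻¹ • w) = ε • d⁻¹ • w := by
        rw [Matrix.mulVec_smul, hw, ← mulVec_mul, inv_mul_cancel_right, mulVec_mul, huv,
          Matrix.mulVec_smul, smul_comm]
      have hns' : ¬ IsScalar (a * u * a⁻¹) := fun h =>
        hns (isScalar_of_conj (Q := a⁻¹) (by rwa [inv_inv]))
      obtain ⟨s, hs, hsx⟩ := exists_lower_of_eigenvector h2 hε
        (fun h => hns' (isScalar_of_conj h)) (hconj hP2 hw')
      have hmem := hKmem _ (mul_mem (mul_mem ha hu) (inv_mem ha))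
      exact forall_mem_of_hom hF lower lower_add hs (hsx ▸ mul_mem hmem hmem)
  refine eq_top_iff.2 fun g _ => ?_
  have : P⁻¹ * g * P ∈ K := by rw [hKtop]; trivial
  rw [hK, Subgroup.mem_comap] at this
  simpa [mul_assoc] using this

end Generation

section Dickson

lemma pow_subset_of_coe_subgroup {Γ : Type*} [Group Γ] [DecidableEq Γ] {D : Finset Γ}
    {H : Subgroup Γ} (hD : ∀ x ∈ D, x ∈ H) (n : ℕ) : ∀ x ∈ D ^ n, x ∈ H := by
  induction n with
  | zero => simp [one_mem]
  | succ n ih =>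
    intro x hx
    rw [pow_succ] at hx
    obtain ⟨y, hy, z, hz, rfl⟩ := mem_mul.1 hx
    exact mul_mem (ih y hy) (hD z hz)

variable {F : Type*} [Field F]

lemma card_le_card_centralizer [Fintype F] [DecidableEq F] {H : Subgroup SL(2, F)} [Fintype H]
    (hmove : ∀ v : Fin 2 → F, v ≠ 0 → ∃ a ∈ H, ¬ ∃ c : F, a.1.mulVec v = c • v)
    {y : H} (hy : IsRegular y.1) :
    Fintype.card H ≤ 1728 * #(centralizerFinset y) ^ 3 := by
  obtain ⟨D, hD⟩ : ∃ D : Finset SL(2, F), D = univ.map (Function.Embedding.subtype (· ∈ H)) :=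
    ⟨_, rfl⟩
  have hmem : ∀ x, x ∈ D ↔ x ∈ H := by simp [hD]
  have hcard : #D = Fintype.card H := by rw [hD, card_map]; rfl
  have h1 : 1 ∈ D := (hmem 1).2 (one_mem H)
  have hinv : D⁻¹ = D := by ext x; simp [hmem]
  have hsub : D ⊆ D ^ 4 := subset_pow h1 (by norm_num)
  have hpow : ∀ n : ℕ, D ^ n ⊆ D := fun n x hx => (hmem x).2
    (pow_subset_of_coe_subgroup (fun x hx => (hmem x).1 hx) n x hx)
  have key := card_pow_three_le_centralizer (D := D) (h := y.1) hinv h1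
    (fun v hv => (hmove v hv).imp fun a ha => ⟨(hmem a).2 ha.1, ha.2⟩)
    (hsub ((hmem _).2 y.2)) hy
  have h26 : #(D ^ 26) ≤ #D := card_le_card (hpow 26)
  have hC : #{x ∈ D ^ 2 | y.1 * x = x * y.1} ≤ #(centralizerFinset y) := by
    rw [← card_map (Function.Embedding.subtype (· ∈ H))]
    refine card_le_card fun x hx => ?_
    rw [mem_filter] at hx
    exact mem_map.2 ⟨⟨x, (hmem x).1 (hpow 2 hx.1)⟩, mem_centralizerFinset.2 (Subtype.ext hx.2), rfl⟩
  have hpos : 0 < #D := card_pos.2 ⟨1, h1⟩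
  have : #D ^ 2 * #D ≤ #D ^ 2 * (1728 * #(centralizerFinset y) ^ 3) := by
    calc #D ^ 2 * #D = #D ^ 3 := by ring
      _ ≤ 1728 * #D ^ 2 * #(centralizerFinset y) ^ 3 :=
        key.trans (Nat.mul_le_mul (Nat.mul_le_mul_left _ (Nat.pow_le_pow_left h26 2))
          (Nat.pow_le_pow_left hC 3))
      _ = _ := by ring
  rw [← hcard]
  exact Nat.le_of_mul_le_mul_left this (by positivity)

/-- A large subgroup of `SL(2, p)` that satisfies no metabelian law is everything. -/
theorem eq_top_of_not_isMetabelian [Fintype F] (hcast : Function.Surjective (Nat.cast : ℕ → F))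
    (hF : (2 : F) ≠ 0) {H : Subgroup SL(2, F)} (hH : ¬ IsMetabelian H)
    (hcard : 4 * 10 ^ 9 < Nat.card H) : H = ⊤ := by
  let _ : DecidableEq F := Classical.decEq F
  have : Fintype H := Fintype.ofFinite _
  rw [Nat.card_eq_fintype_card] at hcard
  have hmove : ∀ v : Fin 2 → F, v ≠ 0 → ∃ a ∈ H, ¬ ∃ c : F, a.1.mulVec v = c • v := by
    intro v hv
    by_contra! h
    exact hH (isMetabelian_of_fixed_line hv h)
  by_contra htop
  have htr : ∀ u ∈ H, ¬ IsScalar u → tr u ≠ 2 ∧ tr u ≠ -2 := by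
    intro u hu hns
    by_contra h
    exact htop (eq_top_of_mem_of_tr hcast hF hmove hu hns (by tauto))
  have hcenter : ∀ x : H, x ∉ Subgroup.center H ↔ ¬ IsScalar x.1 := by
    intro x
    rw [not_iff_not]
    constructor
    · intro hx
      by_contra hns
      refine hH (isMetabelian_of_commute fun a ha b hb => commute_of_commute hns ?_ ?_)
      · exact (congrArg Subtype.val (Subgroup.mem_center_iff.1 hx ⟨a, ha⟩)).symm
      · exact (congrArg Subtype.val (Subgroup.mem_center_iff.1 hx ⟨b, hb⟩)).symm
    · exact fun hx => Subgroup.mem_center_iff.2 fun g => Subtype.ext (hx.commute g.1).eq.symm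
  have hval : ∀ {x y : H}, Commute x y ↔ Commute x.1 y.1 := by
    intro x y
    exact ⟨fun h => congrArg Subtype.val h, fun h => Subtype.ext h⟩
  have hCA : ∀ x : H, x ∉ Subgroup.center H → ∀ y z, Commute x y → Commute x z →
      Commute y z := by
    intro x hx y z hxy hxz
    exact hval.2 (commute_of_commute ((hcenter x).1 hx) (hval.1 hxy) (hval.1 hxz))
  have hinv : ∀ x : H, x ∉ Subgroup.center H → ∀ g, Commute x (g * x * g⁻¹) →
      g * x * g⁻¹ = x ∨ g * x * g⁻¹ = x⁻¹ := by
    intro x hx g hg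
    have h2 := htr x.1 x.2 ((hcenter x).1 hx)
    rcases eq_or_eq_inv_of_commute hF h2.1 h2.2 (hval.1 hg) (tr_conj _ _) with h | h
    · exact Or.inl (Subtype.ext h)
    · exact Or.inr (Subtype.ext h)
  have hZ : #{x : H | x ∈ Subgroup.center H} ≤ 2 := by
    calc #{x : H | x ∈ Subgroup.center H} ≤ #({2, -2} : Finset F) := by
          refine card_le_card_of_injOn (fun x => tr x.1) ?_ ?_
          · intro x hx
            have : IsScalar x.1 := not_not.1 fun h => (hcenter x).2 h (mem_filter.1 hx).2
            simpa using this.tr_sq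
          · intro x hx y hy hxy
            have h1 : IsScalar x.1 := not_not.1 fun h => (hcenter x).2 h (mem_filter.1 hx).2
            have h2 : IsScalar y.1 := not_not.1 fun h => (hcenter y).2 h (mem_filter.1 hy).2
            exact Subtype.ext (h1.eq_of_tr_eq hF h2 hxy)
      _ ≤ 2 := card_le_two
  have hC : ∀ x : H, x ∉ Subgroup.center H →
      #(centralizerFinset x) ≤ 6 ∨ 123 ≤ #(centralizerFinset x) := by
    intro x hx
    have h2 := htr x.1 x.2 ((hcenter x).1 hx)
    by_cases hreg : ∃ y ∈ centralizerFinset x, IsRegular y.1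
    · right
      obtain ⟨y, hy, hyr⟩ := hreg
      have hyc : y ∉ Subgroup.center H := (hcenter y).2 hyr.not_isScalar
      rw [centralizerFinset_eq hCA hx hyc (mem_centralizerFinset.1 hy)]
      have := card_le_card_centralizer hmove hyr
      by_contra! h
      have h3 : #(centralizerFinset y) ^ 3 ≤ 122 ^ 3 := Nat.pow_le_pow_left (by omega) 3
      omega
    · left
      rw [← card_map (Function.Embedding.subtype (· ∈ H))]
      refine (card_le_regular_add_six hF h2.1 h2.2 _ ?_).trans ?_
      · intro y hy
        obtain ⟨z, hz, rfl⟩ := mem_map.1 hy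
        exact hval.1 (mem_centralizerFinset.1 hz)
      · rw [filter_eq_empty_iff.2, card_empty]
        intro y hy hyr
        obtain ⟨z, hz, rfl⟩ := mem_map.1 hy
        exact hreg ⟨z, hz, hyr⟩
  obtain ⟨x, hx, hxg⟩ := exists_normal_centralizer hCA hinv hZ hC (by omega)
  refine hH fun a ha b hb c hc d hd => commute_of_commute ((hcenter x).1 hx) ?_ ?_
  · exact hval.1 (commute_commutator_of_conj (hxg ⟨a, ha⟩) (hxg ⟨b, hb⟩))
  · exact hval.1 (commute_commutator_of_conj (hxg ⟨c, hc⟩) (hxg ⟨d, hd⟩))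

end Dickson

section Coset

variable {Γ : Type*} [Group Γ] (a : Bool → Γ) (H : Subgroup Γ) [DecidablePred (· ∈ H)]

lemma walkMean_coset_sq_le (n : ℕ) (b : Γ) :
    walkMean a n (fun x => if b⁻¹ * x ∈ H then 1 else 0) ^ 2 ≤
      walkMean a (n + n) fun x => if x ∈ H then 1 else 0 := by
  rw [walkMean_add, ← walkMean_inv a n fun x =>
      walkMean a n fun y => if x * y ∈ H then (1 : ℝ) else 0,
    sq, ← walkMean_mul_const]
  refine walkMean_mono a n fun x => ?_
  rw [mul_comm, ← walkMean_mul_const]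
  refine walkMean_mono a n fun y => ?_
  by_cases hx : b⁻¹ * x ∈ H
  · by_cases hy : b⁻¹ * y ∈ H
    · have : x⁻¹ * y ∈ H := by simpa [mul_assoc] using mul_mem (inv_mem hx) hy
      simp [hx, hy, this]
    · rw [if_neg hy, zero_mul]
      split_ifs <;> norm_num
  · rw [if_neg hx, mul_zero]
    split_ifs <;> norm_num

lemma walkMean_coset_le {k n : ℕ} (hkn : k ≤ n) (b : Γ) {β : ℝ} (hβ : 0 ≤ β)
    (h : walkMean a (k + k) (fun x => if x ∈ H then 1 else 0) ≤ β ^ 2) :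
    walkMean a n (fun x => if b⁻¹ * x ∈ H then 1 else 0) ≤ β := by
  have key : ∀ c, walkMean a k (fun x => if c⁻¹ * x ∈ H then 1 else 0) ≤ β := fun c =>
    (pow_le_pow_iff_left₀ (walkMean_nonneg a k fun x => by split_ifs <;> norm_num) hβ
      two_ne_zero).1 ((walkMean_coset_sq_le a H k c).trans h)
  obtain ⟨m, rfl⟩ := Nat.exists_eq_add_of_le' hkn
  rw [walkMean_add, ← walkMean_const a m β]
  refine walkMean_mono a m fun x => ?_
  simpa [mul_assoc] using key (x⁻¹ * b)

end Coset

section Return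

variable {G : Type*} [Group G] [Fintype G] (a : Bool → G)

lemma walk_two_one (n : ℕ) : walk a (n + n) 1 = ∑ x, walk a n x ^ 2 := by
  rw [walk_add]
  refine sum_congr rfl fun x _ => ?_
  rw [mul_one, walk_inv, sq]

lemma walk_two_le (n : ℕ) (x : G) : walk a (n + n) x ≤ walk a (n + n) 1 := by
  rw [walk_two_one, walk_add]
  have h : ∑ y, walk a n (y⁻¹ * x) ^ 2 = ∑ y, walk a n y ^ 2 := by
    refine Fintype.sum_equiv ((Equiv.inv G).trans (Equiv.mulRight x)) _ _ fun y => ?_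
    simp
  have : ∀ y, walk a n y * walk a n (y⁻¹ * x) ≤ (walk a n y ^ 2 + walk a n (y⁻¹ * x) ^ 2) / 2 :=
    fun y => by nlinarith [sq_nonneg (walk a n y - walk a n (y⁻¹ * x))]
  calc _ ≤ ∑ y, (walk a n y ^ 2 + walk a n (y⁻¹ * x) ^ 2) / 2 := sum_le_sum fun y _ => this y
    _ = _ := by rw [← sum_div, sum_add_distrib, h]; ring

variable [DecidableEq G]

lemma walk_add_le_divCount (n : ℕ) {θ : ℝ} (hθ : 0 ≤ θ) (x : G) :
    walk a (n + n + (n + n)) x ≤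
      walk a (n + n) 1 ^ 2 * divCount {y | θ ≤ walk a (n + n) y} x + 2 * θ := by
  set f := walk a (n + n) with hf
  set A : Finset G := {y | θ ≤ f y} with hA
  have h0 : ∀ y, 0 ≤ f y := walk_nonneg a _
  have hA' : ∀ y, y ∈ A ↔ θ ≤ f y := by simp [hA]
  have hcount : (divCount A x : ℝ) = ∑ y, if y ∈ A ∧ y⁻¹ * x ∈ A then 1 else 0 := by
    rw [divCount, sum_boole, Nat.cast_inj]
    refine card_nbij' Prod.fst (fun y => (y, x⁻¹ * y)) ?_ ?_ ?_ ?_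
    · rintro ⟨y, z⟩ h
      simp only [coe_filter, mem_product, Set.mem_ofPred_eq] at h
      obtain ⟨⟨hy, hz⟩, rfl⟩ := h
      have : f z⁻¹ = f z := walk_inv a _ z
      simp only [coe_filter, mem_univ, true_and, Set.mem_ofPred_eq]
      refine ⟨hy, ?_⟩
      rw [inv_mul_cancel_left, hA', this, ← hA']
      exact hz
    · intro y h
      simp only [coe_filter, mem_univ, true_and, Set.mem_ofPred_eq] at h
      simp only [coe_filter, mem_product, Set.mem_ofPred_eq]
      refine ⟨⟨h.1, ?_⟩, by group⟩
      have : f (y⁻¹ * x)⁻¹ = f (y⁻¹ * x) := walk_inv a _ _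
      rw [mul_inv_rev, inv_inv] at this
      rw [hA', this, ← hA']
      exact h.2
    · rintro ⟨y, z⟩ h
      simp only [coe_filter, mem_product, Set.mem_ofPred_eq] at h
      rw [← h.2]
      simp
    · intro y _; rfl
  have hpt : ∀ y, f y * f (y⁻¹ * x) ≤
      f 1 ^ 2 * (if y ∈ A ∧ y⁻¹ * x ∈ A then 1 else 0) + θ * (f y + f (y⁻¹ * x)) := by
    intro y
    by_cases h1 : y ∈ A
    · by_cases h2 : y⁻¹ * x ∈ A
      · rw [if_pos ⟨h1, h2⟩, mul_one, sq]
        have h3 := mul_le_mul (walk_two_le a n y) (walk_two_le a n (y⁻¹ * x)) (h0 _) (h0 1)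
        exact h3.trans (le_add_of_nonneg_right (mul_nonneg hθ (add_nonneg (h0 _) (h0 _))))
      · rw [if_neg (fun h => h2 h.2), mul_zero, zero_add]
        rw [hA', not_le] at h2
        nlinarith [h0 y, h0 (y⁻¹ * x), mul_nonneg (h0 y) (sub_nonneg.2 h2.le)]
    · rw [if_neg (fun h => h1 h.1), mul_zero, zero_add]
      rw [hA', not_le] at h1
      nlinarith [h0 y, h0 (y⁻¹ * x), mul_nonneg (h0 (y⁻¹ * x)) (sub_nonneg.2 h1.le)]
  have h1 : ∑ y, f (y⁻¹ * x) = 1 := by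
    rw [← sum_walk a (n + n)]
    refine Fintype.sum_equiv ((Equiv.inv G).trans (Equiv.mulRight x)) _ _ fun y => ?_
    simp [hf]
  rw [walk_add, hcount]
  calc _ ≤ ∑ y, (f 1 ^ 2 * (if y ∈ A ∧ y⁻¹ * x ∈ A then 1 else 0) + θ * (f y + f (y⁻¹ * x))) :=
        sum_le_sum fun y _ => hpt y
    _ = _ := by
        rw [sum_add_distrib, ← mul_sum, ← mul_sum, sum_add_distrib, h1, sum_walk]
        ring

end Return

section LevelSet

variable {G : Type*} [Group G] [Fintype G] [DecidableEq G] (a : Bool → G)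

lemma exists_level_set (n : ℕ) {R : ℝ} (hR : 2 ≤ R)
    (h : walk a (n + n) 1 ≤ R * walk a (n + n + (n + n) + (n + n + (n + n))) 1) :
    ∃ A : Finset G, A.Nonempty ∧ (∀ y ∈ A, walk a (n + n) 1 ≤ 8 * R * walk a (n + n) y) ∧
      #A * walk a (n + n) 1 ≤ 8 * R ∧ 1 ≤ 2 * R * (#A * walk a (n + n) 1) ∧
      (#A : ℝ) ^ 3 / R ^ 14 ≤ ∑ x, (divCount A x : ℝ) ^ 2 := by
  set M := walk a (n + n) 1 with hM
  have hR0 : 0 < R := by linarith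
  have hM0 : 0 < M := by
    refine lt_of_le_of_ne (walk_nonneg a _ 1) fun h0 => ?_
    have h1 := sum_walk a (n + n)
    rw [sum_eq_zero fun x _ => le_antisymm (h0 ▸ walk_two_le a n x) (walk_nonneg a _ x)] at h1
    norm_num at h1
  set A : Finset G := {y | M / (8 * R) ≤ walk a (n + n) y} with hA
  have hθ : 0 ≤ M / (8 * R) := by positivity
  have hmem : ∀ y ∈ A, M / (8 * R) ≤ walk a (n + n) y := by simp [hA]
  have hcard : #A * M ≤ 8 * R := by
    have : #A • (M / (8 * R)) ≤ 1 := by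
      calc _ ≤ ∑ x ∈ A, walk a (n + n) x := card_nsmul_le_sum _ _ _ hmem
        _ ≤ ∑ x, walk a (n + n) x :=
          sum_le_univ_sum_of_nonneg fun x => walk_nonneg a _ x
        _ = 1 := sum_walk a _
    rwa [nsmul_eq_mul, ← mul_div_assoc, div_le_one (by positivity)] at this
  have henergy : M ≤ 2 * R * (M ^ 4 * ∑ x, (divCount A x : ℝ) ^ 2) := by
    have hpt : ∀ x, walk a (n + n + (n + n)) x ^ 2 ≤
        M ^ 4 * (divCount A x : ℝ) ^ 2 + 4 * (M / (8 * R)) * walk a (n + n + (n + n)) x := by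
      intro x
      have h1 := walk_add_le_divCount a n hθ x
      have h2 := walk_nonneg a (n + n + (n + n)) x
      nlinarith [mul_le_mul_of_nonneg_right h1 h2,
        sq_nonneg (walk a (n + n + (n + n)) x - M ^ 2 * divCount A x)]
    have hsum := sum_le_sum fun x (_ : x ∈ (univ : Finset G)) => hpt x
    rw [← walk_two_one, sum_add_distrib, ← mul_sum, ← mul_sum, sum_walk, mul_one] at hsum
    have e : R * (4 * (M / (8 * R))) = M / 2 := by field_simp; norm_num
    nlinarith [mul_le_mul_of_nonneg_left hsum hR0.le]
  have henergy' : 1 ≤ 2 * R * (M ^ 3 * ∑ x, (divCount A x : ℝ) ^ 2) := by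
    refine le_of_mul_le_mul_left ?_ hM0
    calc M * 1 ≤ 2 * R * (M ^ 4 * ∑ x, (divCount A x : ℝ) ^ 2) := by rw [mul_one]; exact henergy
      _ = _ := by ring
  have htriv : ∑ x, (divCount A x : ℝ) ^ 2 ≤ (#A : ℝ) ^ 3 := by
    have h1 : ∑ x, (divCount A x : ℝ) = (#A : ℝ) ^ 2 := by exact_mod_cast sum_divCount A
    calc _ ≤ ∑ x, (#A : ℝ) * divCount A x := by
          refine sum_le_sum fun x _ => ?_
          rw [sq]
          exact mul_le_mul_of_nonneg_right (by exact_mod_cast divCount_le A x) (by positivity)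
      _ = _ := by rw [← mul_sum, h1]; ring
  have hlow : 1 ≤ 2 * R * (#A * M) := by
    by_contra! hlt
    have h1 : 1 ≤ 2 * R * (#A * M) ^ 3 := by
      refine henergy'.trans ?_
      rw [mul_pow, mul_comm ((#A : ℝ) ^ 3)]
      gcongr
    have h2 : 0 ≤ #A * M := by positivity
    have h3 : #A * M ≤ 1 := by nlinarith
    have h4 : (#A * M) ^ 3 ≤ #A * M := by
      simpa using pow_le_pow_of_le_one h2 h3 (show 1 ≤ 3 by norm_num)
    nlinarith
  refine ⟨A, ⟨1, ?_⟩, ?_, hcard, hlow, ?_⟩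
  · simp only [hA, mem_filter, mem_univ, true_and]
    exact div_le_self hM0.le (by linarith)
  · intro y hy
    have := hmem y hy
    rwa [div_le_iff₀' (by positivity)] at this
  · have hR10 : (1024 : ℝ) ≤ R ^ 10 := by
      calc (1024 : ℝ) = 2 ^ 10 := by norm_num
        _ ≤ R ^ 10 := by gcongr
    rw [div_le_iff₀ (by positivity)]
    refine le_of_mul_le_mul_left ?_ (pow_pos hM0 3)
    calc M ^ 3 * #A ^ 3 = (#A * M) ^ 3 := by ring
      _ ≤ (8 * R) ^ 3 := by gcongr
      _ = 512 * R ^ 3 * 1 := by ring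
      _ ≤ 512 * R ^ 3 * (2 * R * (M ^ 3 * ∑ x, (divCount A x : ℝ) ^ 2)) := by gcongr
      _ = 1024 * (R ^ 4 * (M ^ 3 * ∑ x, (divCount A x : ℝ) ^ 2)) := by ring
      _ ≤ R ^ 10 * (R ^ 4 * (M ^ 3 * ∑ x, (divCount A x : ℝ) ^ 2)) := by gcongr
      _ = _ := by ring

theorem exists_dense_approximate_group (n : ℕ) {R : ℝ} (hR : 2 ≤ R)
    (h : walk a (n + n) 1 ≤ R * walk a (n + n + (n + n) + (n + n + (n + n))) 1) :
    ∃ (D : Finset G) (b : G), D⁻¹ = D ∧ 1 ∈ D ∧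
      1 ≤ R ^ 186 * walkMean a (n + n) (fun x => if b⁻¹ * x ∈ D then 1 else 0) ∧
      1 ≤ R ^ 186 * (#D * walk a (n + n) 1) ∧
      ∀ k, #(D ^ k) * walk a (n + n) 1 ≤ R ^ (327 * k + 167) := by
  obtain ⟨A, hA, hAf, hAM, hAM', hE⟩ := exists_level_set a n hR h
  set M := walk a (n + n) 1 with hM
  have hR0 : 0 < R := by linarith
  have hR1 : 1 ≤ R := by linarith
  have hM0 : 0 ≤ M := walk_nonneg a _ 1
  have h2R : ∀ k : ℕ, (2 : ℝ) ^ k ≤ R ^ k := fun k => pow_le_pow_left₀ (by norm_num) hR k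
  obtain ⟨D, B, hD, h1, hBA, hB, ⟨b, -, hb⟩, hpow⟩ :=
    exists_approximate_group A hA (K := R ^ 14) (one_le_pow₀ hR1) rfl hE
  set L : ℝ := 2 ^ 23 * (R ^ 14) ^ 10 with hL
  have hL0 : 0 < L := by positivity
  have hLR : L ≤ R ^ 163 := by
    calc L ≤ R ^ 23 * (R ^ 14) ^ 10 := by
          rw [hL]; exact mul_le_mul_of_nonneg_right (h2R 23) (by positivity)
      _ = R ^ 163 := by ring
  have hBM : #B * M ≤ R ^ 4 := by
    calc #B * M ≤ #A * M :=
          mul_le_mul_of_nonneg_right (by exact_mod_cast card_le_card hBA) hM0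
      _ ≤ 2 ^ 3 * R := by linarith
      _ ≤ R ^ 3 * R := mul_le_mul_of_nonneg_right (h2R 3) hR0.le
      _ = R ^ 4 := by ring
  have hBM' : 1 ≤ R ^ 18 * (#B * M) := by
    have : (#A : ℝ) ≤ 4 * R ^ 14 * #B := by rwa [div_le_iff₀' (by positivity)] at hB
    calc 1 ≤ 2 * R * (#A * M) := hAM'
      _ ≤ 2 * R * ((4 * R ^ 14 * #B) * M) := by gcongr
      _ = 2 ^ 3 * (R ^ 15 * (#B * M)) := by ring
      _ ≤ R ^ 3 * (R ^ 15 * (#B * M)) :=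
        mul_le_mul_of_nonneg_right (h2R 3) (by positivity)
      _ = _ := by ring
  set C := #{x ∈ B | b⁻¹ * x ∈ D} with hC
  have hCM : 1 ≤ R ^ 182 * (C * M) := by
    have : (#B : ℝ) ≤ 2 * L * C := by rwa [div_le_iff₀' (by positivity)] at hb
    calc 1 ≤ R ^ 18 * (#B * M) := hBM'
      _ ≤ R ^ 18 * ((2 * L * C) * M) := by gcongr
      _ ≤ R ^ 18 * ((R * R ^ 163 * C) * M) := by gcongr
      _ = _ := by ring
  have hdense : 1 ≤ R ^ 186 * walkMean a (n + n) (fun x => if b⁻¹ * x ∈ D then 1 else 0) := by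
    have : C * M ≤ 8 * R * walkMean a (n + n) (fun x => if b⁻¹ * x ∈ D then 1 else 0) := by
      rw [← sum_walk_mul, hC, ← nsmul_eq_mul, mul_sum]
      calc _ ≤ ∑ x ∈ B with b⁻¹ * x ∈ D,
            8 * R * (walk a (n + n) x * if b⁻¹ * x ∈ D then 1 else 0) := by
            refine card_nsmul_le_sum _ _ _ fun x hx => ?_
            rw [mem_filter] at hx
            rw [if_pos hx.2, mul_one]
            exact hAf x (hBA hx.1)
        _ ≤ _ := sum_le_univ_sum_of_nonneg fun x => mul_nonneg (by positivity)
          (mul_nonneg (walk_nonneg a _ x) (by split_ifs <;> norm_num))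
    have h0 : 0 ≤ walkMean a (n + n) (fun x => if b⁻¹ * x ∈ D then (1 : ℝ) else 0) :=
      walkMean_nonneg a _ fun x => by split_ifs <;> norm_num
    set P := walkMean a (n + n) (fun x => if b⁻¹ * x ∈ D then (1 : ℝ) else 0)
    calc 1 ≤ R ^ 182 * (C * M) := hCM
      _ ≤ R ^ 182 * (8 * R * P) := by gcongr
      _ = 2 ^ 3 * (R ^ 183 * P) := by ring
      _ ≤ R ^ 3 * (R ^ 183 * P) := mul_le_mul_of_nonneg_right (h2R 3) 
        (mul_nonneg (pow_nonneg hR0.le _) h0)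
      _ = _ := by ring
  refine ⟨D, b, hD, h1, hdense, hdense.trans ?_, fun k => ?_⟩
  · refine mul_le_mul_of_nonneg_left ?_ (by positivity)
    rw [← sum_walk_mul]
    calc _ ≤ ∑ x, M * (if b⁻¹ * x ∈ D then 1 else 0) := by
          refine sum_le_sum fun x _ => mul_le_mul_of_nonneg_right (walk_two_le a n x) ?_
          split_ifs <;> norm_num
      _ = #D * M := by
          rw [← mul_sum, sum_boole, mul_comm]
          congr 2
          refine card_nbij' (b⁻¹ * ·) (b * ·) ?_ ?_ ?_ ?_ <;> intro x <;> simp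
  · calc #(D ^ k) * M ≤ (2 * L ^ 2) ^ k * (L * #B) * M :=
          mul_le_mul_of_nonneg_right (hpow k) hM0
      _ = (2 * L ^ 2) ^ k * L * (#B * M) := by ring
      _ ≤ (R * (R ^ 163) ^ 2) ^ k * R ^ 163 * R ^ 4 := by gcongr
      _ = _ := by ring

end LevelSet

section Flattening

lemma isMetabelian_bot {Γ : Type*} [Group Γ] : IsMetabelian (⊥ : Subgroup Γ) :=
  isMetabelian_of_commute fun a ha b _ => by rw [Subgroup.mem_bot.1 ha]; exact Commute.one_left b

lemma isMetabelian_closure_of_commute {Γ : Type*} [Group Γ] {D : Set Γ}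
    (h : ∀ a ∈ D, ∀ b ∈ D, Commute a b) : IsMetabelian (Subgroup.closure D) := by
  refine isMetabelian_of_commute fun a ha b hb => ?_
  have h1 : Subgroup.closure D ≤ Subgroup.centralizer D :=
    (Subgroup.closure_le _).2 fun x hx => Subgroup.mem_centralizer_iff.2 fun y hy => h y hy x hx
  have h2 : Subgroup.closure D ≤ Subgroup.centralizer (Subgroup.closure D : Set Γ) :=
    (Subgroup.closure_le _).2 fun x hx => Subgroup.mem_centralizer_iff.2 fun y hy =>
      (Subgroup.mem_centralizer_iff.1 (h1 hy) x hx).symm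
  exact (Subgroup.mem_centralizer_iff.1 (h2 ha) b hb).symm

variable {F : Type*} [Field F]

lemma isMetabelian_closure_of_fixed_line {D : Set SL(2, F)} {v : Fin 2 → F} (hv : v ≠ 0)
    (h : ∀ a ∈ D, ∃ c : F, a.1.mulVec v = c • v) : IsMetabelian (Subgroup.closure D) := by
  refine isMetabelian_of_fixed_line hv fun a ha => ?_
  induction ha using Subgroup.closure_induction with
  | mem x hx => exact h x hx
  | one => exact ⟨1, by simp⟩
  | mul x y _ _ hx hy =>
    obtain ⟨c, hc⟩ := hx
    obtain ⟨d, hd⟩ := hy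
    exact ⟨d * c, by rw [mulVec_mul, hd, Matrix.mulVec_smul, hc, smul_smul]⟩
  | inv x _ hx =>
    obtain ⟨c, hc⟩ := hx
    exact ⟨c⁻¹, (mulVec_inv_of_eigen x hv hc).2⟩

variable [Fintype F] [DecidableEq F]

/-- If the `L²` norm of the walk nearly stops decreasing, then the walk is already
equidistributed up to a power of `R`. -/
theorem card_pow_mul_walk_sq_le (hcast : Function.Surjective (Nat.cast : ℕ → F))
    (hF : (2 : F) ≠ 0) (a : Bool → SL(2, F)) {k n : ℕ} (hkn : k ≤ n + n) {R β : ℝ}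
    (hR : 2 ≤ R) (hβ0 : 0 ≤ β) (hβ : R ^ 18000 * β < 1)
    (hNC : ∀ (H : Subgroup SL(2, F)) [DecidablePred (· ∈ H)], IsMetabelian H →
      walkMean a (k + k) (fun x => if x ∈ H then 1 else 0) ≤ β ^ 2)
    (h : walk a (n + n) 1 ≤ R * walk a (n + n + (n + n) + (n + n + (n + n))) 1) :
    (Fintype.card SL(2, F) : ℝ) ^ 3 * walk a (n + n) 1 ^ 2 ≤
      R ^ 45300 * (Fintype.card F : ℝ) ^ 3 := by
  obtain ⟨D, b, hD, h1, hdense, hDM, hpow⟩ := exists_dense_approximate_group a n hR h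
  set M := walk a (n + n) 1 with hM
  have hR0 : 0 < R := by linarith
  have hR1 : 1 ≤ R := by linarith
  have hM0 : 0 ≤ M := walk_nonneg a _ 1
  have h2R : ∀ k : ℕ, (2 : ℝ) ^ k ≤ R ^ k := fun k => pow_le_pow_left₀ (by norm_num) hR k
  have hβ' : ∀ {x : ℝ} {i j : ℕ}, 1 ≤ R ^ i * x * β → x ≤ R ^ j → i + j ≤ 18000 → False := by
    intro x i j h1 hx hij
    have : R ^ i * x * β ≤ R ^ 18000 * β := by
      refine mul_le_mul_of_nonneg_right ?_ hβ0
      calc R ^ i * x ≤ R ^ i * R ^ j := mul_le_mul_of_nonneg_left hx (pow_nonneg hR0.le i)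
        _ = R ^ (i + j) := (pow_add R i j).symm
        _ ≤ R ^ 18000 := pow_le_pow_right₀ hR1 hij
    linarith
  have hMβ : M ≤ β := by
    classical
    have := walkMean_coset_le a ⊥ hkn 1 hβ0 (hNC ⊥ isMetabelian_bot)
    simp only [inv_one, one_mul, Subgroup.mem_bot] at this
    rw [hM, walk]
    convert this
  have hDβ : 1 ≤ R ^ 186 * #D * β := by
    refine hDM.trans ?_
    rw [mul_assoc]
    exact mul_le_mul_of_nonneg_left (mul_le_mul_of_nonneg_left hMβ (Nat.cast_nonneg _))
      (pow_nonneg hR0.le _)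
  have hnm : ¬ IsMetabelian (Subgroup.closure (D : Set SL(2, F))) := by
    classical
    intro hmet
    refine hβ' (x := 1) (i := 186) (j := 0) ?_ (by norm_num) (by norm_num)
    rw [mul_one]
    refine hdense.trans (mul_le_mul_of_nonneg_left ?_ (pow_nonneg hR0.le _))
    refine le_trans (walkMean_mono a _ fun x => ?_) (walkMean_coset_le a _ hkn b hβ0 (hNC _ hmet))
    by_cases hx : b⁻¹ * x ∈ D
    · rw [if_pos hx, if_pos (show b⁻¹ * x ∈ Subgroup.closure (D : Set SL(2, F)) from
        Subgroup.subset_closure (mem_coe.2 hx))]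
    · rw [if_neg hx]
      split_ifs <;> norm_num
  have hgen : Subgroup.closure (D : Set SL(2, F)) = ⊤ := by
    refine eq_top_of_not_isMetabelian hcast hF hnm ?_
    have h2 : #D ≤ Nat.card (Subgroup.closure (D : Set SL(2, F))) := by
      rw [← Set.ncard_coe_finset, ← Nat.card_coe_set_eq]
      exact Nat.card_mono (Set.toFinite _) Subgroup.subset_closure
    refine lt_of_lt_of_le ?_ h2
    by_contra! hle
    refine hβ' (i := 186) (j := 32) hDβ ?_ (by norm_num)
    calc (#D : ℝ) ≤ 4 * 10 ^ 9 := by exact_mod_cast hle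
      _ ≤ 2 ^ 32 := by norm_num
      _ ≤ R ^ 32 := h2R 32
  have hmove : ∀ v : Fin 2 → F, v ≠ 0 → ∃ a ∈ D, ¬ ∃ c : F, a.1.mulVec v = c • v := by
    intro v hv
    by_contra! hfix
    exact hnm (isMetabelian_closure_of_fixed_line hv hfix)
  have hnc : ∃ a ∈ D, ∃ c ∈ D, ¬ Commute a c := by
    by_contra! hcomm
    exact hnm (isMetabelian_closure_of_commute hcomm)
  obtain ⟨E, hE⟩ : ∃ E, E = R ^ 8855 := ⟨_, rfl⟩
  have h26 : (#(D ^ 26) : ℝ) ≤ E * #D := by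
    have hMpos : 0 < M := by
      refine lt_of_le_of_ne hM0 fun h0 => ?_
      rw [← h0, mul_zero, mul_zero] at hDM
      norm_num at hDM
    refine le_of_mul_le_mul_right ?_ hMpos
    calc #(D ^ 26) * M ≤ R ^ (327 * 26 + 167) * 1 := by rw [mul_one]; exact hpow 26
      _ ≤ R ^ (327 * 26 + 167) * (R ^ 186 * (#D * M)) :=
        mul_le_mul_of_nonneg_left hDM (pow_nonneg hR0.le _)
      _ = E * #D * M := by rw [hE]; ring
  have hE0 : 0 < E := hE ▸ pow_pos hR0 _
  have hM9 := card_pow_three_le_of_generating hF hD h1 hmove hnc hgen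
  generalize #(D ^ 26) = e at h26 hM9
  have hbig : 1728 * 12 ^ 3 * e ^ 2 < #D ^ 3 := by
    have hlt : R ^ 17732 < #D := by
      by_contra! hle
      exact hβ' hDβ hle (by norm_num)
    have hDpos : (0 : ℝ) < #D := by exact_mod_cast card_pos.2 ⟨1, h1⟩
    have : (1728 * 12 ^ 3 * e ^ 2 : ℝ) < #D ^ 3 := by
      calc (1728 * 12 ^ 3 * e ^ 2 : ℝ) ≤ 2 ^ 22 * e ^ 2 := by
            gcongr; norm_num
        _ ≤ R ^ 22 * (E * #D) ^ 2 := by gcongr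
        _ = R ^ 17732 * #D ^ 2 := by rw [hE]; ring
        _ < #D * #D ^ 2 := mul_lt_mul_of_pos_right hlt (pow_pos hDpos 2)
        _ = #D ^ 3 := by ring
    exact_mod_cast this
  have key : (Fintype.card SL(2, F) : ℝ) ^ 3 * #D ^ 3 ≤
      884736 * (Fintype.card F : ℝ) ^ 3 * e ^ 5 := by
    exact_mod_cast hM9 hbig
  have hDpos : (0 : ℝ) < #D := by exact_mod_cast card_pos.2 ⟨1, h1⟩
  refine le_of_mul_le_mul_right ?_ (pow_pos hDpos 3)
  have hD1 : #D * M ≤ R ^ 494 := by simpa using hpow 1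
  calc (Fintype.card SL(2, F) : ℝ) ^ 3 * M ^ 2 * #D ^ 3
      = (Fintype.card SL(2, F) : ℝ) ^ 3 * #D ^ 3 * M ^ 2 := by ring
    _ ≤ 884736 * (Fintype.card F : ℝ) ^ 3 * e ^ 5 * M ^ 2 := by gcongr
    _ ≤ R ^ 20 * (Fintype.card F : ℝ) ^ 3 * (E * #D) ^ 5 * M ^ 2 := by
        have : (884736 : ℝ) ≤ R ^ 20 := le_trans (by norm_num) (h2R 20)
        gcongr
    _ = R ^ 20 * E ^ 5 * (Fintype.card F : ℝ) ^ 3 * (#D * M) ^ 2 * #D ^ 3 := by ring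
    _ ≤ R ^ 20 * E ^ 5 * (Fintype.card F : ℝ) ^ 3 * (R ^ 494) ^ 2 * #D ^ 3 := by gcongr
    _ = R ^ 45283 * ((Fintype.card F : ℝ) ^ 3 * #D ^ 3) := by rw [hE]; ring
    _ ≤ R ^ 45300 * ((Fintype.card F : ℝ) ^ 3 * #D ^ 3) :=
        mul_le_mul_of_nonneg_right (pow_le_pow_right₀ hR1 (by norm_num)) (by positivity)
    _ = _ := by ring

end Flattening

section Quasirandom

/-- Right translation of functions on a group. -/
def translate {G : Type*} [Group G] (g : G) : (G → ℂ) →ₗ[ℂ] (G → ℂ) :=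
  LinearMap.funLeft ℂ ℂ (· * g)

lemma translate_apply {G : Type*} [Group G] (g : G) (f : G → ℂ) (x : G) :
    translate g f x = f (x * g) := rfl

lemma translate_mul {G : Type*} [Group G] (g h : G) (f : G → ℂ) :
    translate (g * h) f = translate g (translate h f) := by
  ext x; simp [translate_apply, mul_assoc]

lemma translate_one {G : Type*} [Group G] (f : G → ℂ) : translate 1 f = f := by
  ext x; simp [translate_apply]

lemma translate_ne_zero {G : Type*} [Group G] (g : G) {f : G → ℂ} (hf : f ≠ 0) :
    translate g f ≠ 0 := by
  intro h
  apply hf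
  rw [← translate_one f, ← inv_mul_cancel g, translate_mul, h, map_zero]

variable {F : Type*} [Field F]

lemma eq_top_of_normal_of_upper (hcast : Function.Surjective (Nat.cast : ℕ → F))
    {K : Subgroup SL(2, F)} [K.Normal] (h : upper 1 ∈ K) : K = ⊤ := by
  have hU : ∀ t : F, upper t ∈ K := forall_mem_of_hom hcast upper upper_add one_ne_zero h
  refine eq_top_of_unipotent hU fun t => ?_
  obtain ⟨w, hw⟩ : ∃ w : SL(2, F), lower t * w = w * upper (-t) := by
    obtain ⟨w, hw⟩ : ∃ w : SL(2, F), (w : Matrix (Fin 2) (Fin 2) F) = !![0, -1; 1, 0] :=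
      ⟨⟨_, by simp⟩, rfl⟩
    refine ⟨w, ?_⟩
    apply ext_entries <;> simp [Matrix.SpecialLinearGroup.coe_mul, hw, upper_coe, lower_coe]
  rw [eq_mul_inv_of_mul_eq hw]
  exact Subgroup.Normal.conj_mem inferInstance _ (hU _) _

lemma exists_translate_upper_ne [Fintype F] [DecidableEq F]
    (hcast : Function.Surjective (Nat.cast : ℕ → F)) {V : Submodule ℂ (SL(2, F) → ℂ)}
    (hV : ∀ f ∈ V, ∀ g, translate g f ∈ V) (hne : ∃ f ∈ V, f ≠ 0)
    (h0 : ∀ f ∈ V, ∑ x, f x = 0) : ∃ f ∈ V, translate (upper 1) f ≠ f := by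
  by_contra! hall
  let K : Subgroup SL(2, F) :=
    { carrier := {g | ∀ f ∈ V, translate g f = f}
      one_mem' := fun f _ => translate_one f
      mul_mem' := fun {g h} hg hh f hf => by rw [translate_mul, hh f hf, hg f hf]
      inv_mem' := fun {g} hg f hf => by
        conv_lhs => rw [← hg f hf]
        rw [← translate_mul, inv_mul_cancel, translate_one] }
  have hK : K.Normal := ⟨fun g hg h f hf => by
    rw [translate_mul, translate_mul, hg _ (hV f hf _), ← translate_mul, mul_inv_cancel,
      translate_one]⟩
  have htop := eq_top_of_normal_of_upper hcast (K := K) hall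
  obtain ⟨f, hf, hf0⟩ := hne
  have hconst : ∀ g, f g = f 1 := by
    intro g
    have hg : g ∈ K := by rw [htop]; trivial
    have := congrFun (hg f hf) 1
    rwa [translate_apply, one_mul] at this
  have := h0 f hf
  rw [sum_congr rfl fun g _ => hconst g, sum_const, smul_eq_zero] at this
  rcases this with h | h
  · simp at h
  · exact hf0 (funext fun g => by rw [hconst g, h]; rfl)

lemma exists_eigenvector_upper [Fintype F] [DecidableEq F]
    (hcast : Function.Surjective (Nat.cast : ℕ → F)) {V : Submodule ℂ (SL(2, F) → ℂ)}
    (hV : ∀ f ∈ V, ∀ g, translate g f ∈ V) (hne : ∃ f ∈ V, f ≠ 0)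
    (h0 : ∀ f ∈ V, ∑ x, f x = 0) :
    ∃ w ∈ V, w ≠ 0 ∧ ∃ e : F → ℂ, Function.Injective e ∧
      ∀ t, translate (upper t) w = e t • w := by
  obtain ⟨f, hf, hfu⟩ := exists_translate_upper_ne hcast hV hne h0
  set A : Module.End ℂ (SL(2, F) → ℂ) := translate (upper 1) with hA
  have hpow : ∀ n : ℕ, translate (upper (n : F)) = A ^ n := by
    intro n
    induction n with
    | zero =>
      have : (upper 0 : SL(2, F)) = 1 := by simpa using upper_add (0 : F) 0
      ext g x
      simp [this, translate_apply]
    | succ n ih =>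
      rw [Nat.cast_succ, upper_add, pow_succ, ← ih]
      ext g x
      simp [translate_mul, hA]
  set W : Submodule ℂ (SL(2, F) → ℂ) := V.map (A - 1) with hW
  have hWV : W ≤ V := by
    rintro _ ⟨v, hv, rfl⟩
    exact sub_mem (hV v hv _) hv
  have hWA : ∀ w ∈ W, A w ∈ W := by
    rintro _ ⟨v, hv, rfl⟩
    refine ⟨A v, hV v hv _, ?_⟩
    simp
  have : Nontrivial W := ⟨⟨⟨(A - 1) f, f, hf, rfl⟩, 0, fun h => hfu (by
    have := congrArg Subtype.val h
    simpa [sub_eq_zero] using this)⟩⟩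
  obtain ⟨ζ, hζ⟩ := Module.End.exists_eigenvalue (A.restrict hWA)
  obtain ⟨⟨w, hwW⟩, hw⟩ := hζ.exists_hasEigenvector
  have hw0 : w ≠ 0 := fun h => hw.2 (Subtype.ext h)
  have hAw : A w = ζ • w := congrArg Subtype.val hw.apply_eq_smul
  have hAn : ∀ n : ℕ, (A ^ n) w = ζ ^ n • w := by
    intro n
    induction n with
    | zero => simp
    | succ n ih => rw [pow_succ', Module.End.mul_apply, ih, map_smul, hAw, smul_smul, pow_succ]
  have hζ1 : ζ ≠ 1 := by
    rintro rfl
    obtain ⟨v, hv, hvw⟩ := hwW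
    have hvn : ∀ n : ℕ, (A ^ n) v = v + (n : ℂ) • w := by
      intro n
      induction n with
      | zero => simp
      | succ n ih =>
        have : A v = v + w := by rw [← hvw]; simp
        rw [pow_succ', Module.End.mul_apply, ih, map_add, map_smul, hAw, this, one_smul]
        push_cast
        module
    have h1 := hvn (ringChar F)
    rw [← hpow, CharP.cast_eq_zero] at h1
    rw [← Nat.cast_zero, hpow, pow_zero] at h1
    have : ((ringChar F : ℕ) : ℂ) • w = 0 := by simpa using h1
    rcases smul_eq_zero.1 this with h | h
    · exact CharP.ringChar_ne_zero_of_finite F (by exact_mod_cast h)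
    · exact hw0 h
  choose n hn using hcast
  have he : ∀ t, translate (upper t) w = ζ ^ n t • w := fun t => by
    conv_lhs => rw [← hn t, hpow, hAn]
  have hadd : ∀ s t, ζ ^ n (s + t) = ζ ^ n s * ζ ^ n t := by
    intro s t
    refine smul_left_injective ℂ hw0 ?_
    change ζ ^ n (s + t) • w = (ζ ^ n s * ζ ^ n t) • w
    rw [← he, upper_add, translate_mul, he, map_smul, he, smul_smul, mul_comm]
  have h00 : ζ ^ n 0 = 1 := by
    have h1 := hadd 0 0
    rw [add_zero] at h1
    have h2 : ζ ^ n 0 ≠ 0 := by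
      intro h3
      have := he 0
      rw [h3, zero_smul] at this
      exact translate_ne_zero _ hw0 this
    exact mul_left_cancel₀ h2 (by rw [← h1, mul_one])
  have hmul : ∀ (k : ℕ) t, ζ ^ n (k * t) = (ζ ^ n t) ^ k := by
    intro k t
    induction k with
    | zero => simp [h00]
    | succ k ih => rw [Nat.cast_succ, add_mul, one_mul, hadd, ih, pow_succ]
  have h10 : ζ ^ n 1 = ζ := by
    refine smul_left_injective ℂ hw0 ?_
    change ζ ^ n 1 • w = ζ • w
    rw [← he, ← hAw]
  refine ⟨w, hWV hwW, hw0, fun t => ζ ^ n t, fun s t hst => ?_, he⟩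
  by_contra hne
  have h1 : ζ ^ n (s - t) = 1 := by
    have h2 := hadd (s - t) t
    rw [sub_add_cancel] at h2
    have h3 : ζ ^ n t ≠ 0 := by
      intro h3
      have := he t
      rw [h3, zero_smul] at this
      exact translate_ne_zero _ hw0 this
    exact mul_right_cancel₀ h3 (by rw [← h2, one_mul]; exact hst)
  have h4 := hmul (n (s - t)⁻¹) (s - t)
  rw [hn, inv_mul_cancel₀ (sub_ne_zero.2 hne), h1, one_pow, h10] at h4
  exact hζ1 h4

lemma card_sub_one_le_two_mul_card_squares [Fintype F] [DecidableEq F] :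
    Fintype.card F - 1 ≤ 2 * #(image (fun x : F => x ^ 2) {x | x ≠ 0}) := by
  have h : #({x : F | x ≠ 0} : Finset F) = Fintype.card F - 1 := by
    rw [filter_ne', card_erase_of_mem (mem_univ _), card_univ]
  rw [← h]
  refine card_le_mul_card_image (f := fun x : F => x ^ 2) _ _ fun b hb => ?_
  obtain ⟨c, hc, rfl⟩ := mem_image.1 hb
  refine (card_le_card (t := ({c, -c} : Finset F)) fun x hx => ?_).trans
    (card_le_two (a := c) (b := -c))
  have := sq_eq_sq_iff_eq_or_eq_neg.1 (mem_filter.1 hx).2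
  simpa using this

/-- Nontrivial constituents of the regular representation of `SL(2, p)` are large. -/
theorem card_sub_one_le_two_mul_finrank [Fintype F] [DecidableEq F]
    (hcast : Function.Surjective (Nat.cast : ℕ → F)) {V : Submodule ℂ (SL(2, F) → ℂ)}
    (hV : ∀ f ∈ V, ∀ g, translate g f ∈ V) (hne : ∃ f ∈ V, f ≠ 0)
    (h0 : ∀ f ∈ V, ∑ x, f x = 0) : Fintype.card F - 1 ≤ 2 * Module.finrank ℂ V := by
  obtain ⟨w, hwV, hw0, e, he, hw⟩ := exists_eigenvector_upper hcast hV hne h0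
  refine card_sub_one_le_two_mul_card_squares.trans (Nat.mul_le_mul_left 2 ?_)
  set Q : Finset F := image (fun x : F => x ^ 2) {x | x ≠ 0} with hQ
  have hd : ∀ t : Q, ∃ v ∈ V, v ≠ 0 ∧ translate (upper 1) v = e t • v := by
    rintro ⟨t, ht⟩
    obtain ⟨c, hc, rfl⟩ := mem_image.1 ht
    have hc0 : c ≠ 0 := by simpa using hc
    obtain ⟨d, hd⟩ : ∃ d : SL(2, F), upper 1 * d = d * upper (c ^ 2) := by
      obtain ⟨d, hd⟩ : ∃ d : SL(2, F), (d : Matrix (Fin 2) (Fin 2) F) = !![c⁻¹, 0; 0, c] :=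
        ⟨⟨_, by simp [hc0]⟩, rfl⟩
      refine ⟨d, ?_⟩
      apply ext_entries <;> simp [Matrix.SpecialLinearGroup.coe_mul, hd, upper_coe]
      field_simp
    refine ⟨translate d w, hV w hwV d, translate_ne_zero d hw0, ?_⟩
    rw [← translate_mul, hd, translate_mul, hw, map_smul]
  choose v hvV hv0 hv using hd
  have hli : LinearIndependent ℂ v :=
    Module.End.eigenvectors_linearIndependent' (translate (upper 1)) (fun t : Q => e t)
      (he.comp Subtype.val_injective) v fun t =>
        ⟨Module.End.mem_eigenspace_iff.2 (hv t), hv0 t⟩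
  have hli' : LinearIndependent ℂ fun t : Q => (⟨v t, hvV t⟩ : V) :=
    LinearIndependent.of_comp V.subtype hli
  simpa using hli'.fintype_card_le_finrank

end Quasirandom

section Spectral

/-- The multiplicity of an eigenvalue is controlled by the Hilbert–Schmidt norm. -/
lemma finrank_mul_norm_sq_le {ι : Type*} [Fintype ι] (Q : ι → ι → ℂ)
    (V : Submodule ℂ (ι → ℂ)) {c : ℂ} (h : ∀ f ∈ V, ∀ x, ∑ y, Q x y * f y = c * f x) :
    Module.finrank ℂ V * ‖c‖ ^ 2 ≤ ∑ x, ∑ y, ‖Q x y‖ ^ 2 := by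
  let V' : Submodule ℂ (EuclideanSpace ℂ ι) :=
    V.map (WithLp.linearEquiv 2 ℂ (ι → ℂ)).symm.toLinearMap
  have hfin : Module.finrank ℂ V' = Module.finrank ℂ V :=
    LinearEquiv.finrank_map_eq _ V
  let b := stdOrthonormalBasis ℂ V'
  have hb : Orthonormal ℂ fun i => (b i : EuclideanSpace ℂ ι) :=
    b.orthonormal.comp_linearIsometry V'.subtypeₗᵢ
  have hbV : ∀ i, (b i : EuclideanSpace ℂ ι).ofLp ∈ V := by
    intro i
    obtain ⟨v, hv, hvb⟩ := (b i).2
    rw [← hvb]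
    exact hv
  have hrow : ∀ x, ∑ i, ‖c * (b i : EuclideanSpace ℂ ι).ofLp x‖ ^ 2 ≤ ∑ y, ‖Q x y‖ ^ 2 := by
    intro x
    have := hb.sum_inner_products_le (s := univ) (WithLp.toLp 2 fun y => star (Q x y))
    rw [EuclideanSpace.norm_sq_eq] at this
    simp only [norm_star] at this
    refine (sum_le_sum fun i _ => le_of_eq ?_).trans this
    rw [← h _ (hbV i), EuclideanSpace.inner_eq_star_dotProduct, dotProduct,
      ← norm_star (∑ y, _)]
    simp [star_sum]
  refine le_trans (le_of_eq ?_) (sum_le_sum fun x _ => hrow x)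
  rw [sum_comm]
  have hi : ∀ i, ∑ x, ‖c * (b i : EuclideanSpace ℂ ι).ofLp x‖ ^ 2 = ‖c‖ ^ 2 := by
    intro i
    simp_rw [norm_mul, mul_pow]
    rw [← mul_sum, ← EuclideanSpace.norm_sq_eq, hb.1 i]
    simp
  rw [sum_congr rfl fun i _ => hi i, sum_const, card_univ, Fintype.card_fin, hfin, nsmul_eq_mul]

variable {G : Type*} [Group G] [Fintype G]

lemma sum_walk_mul_eq_pow_mul (a : Bool → G) {c : ℂ} {g : G → ℂ}
    (hg : ∀ x, (∑ i, g (letter a i * x)) / 4 = c * g x) (k : ℕ) (x : G) :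
    ∑ y, (walk a k y : ℂ) * g (y * x) = c ^ k * g x := by
  classical
  induction k with
  | zero => simp [walk_zero, apply_ite (fun r : ℝ => (r : ℂ))]
  | succ k ih =>
    have h1 : ∀ i, ∑ y, (walk a k ((letter a i)⁻¹ * y) : ℂ) * g (y * x) =
        ∑ z, (walk a k z : ℂ) * g (letter a i * (z * x)) := fun i =>
      (Fintype.sum_equiv (Equiv.mulLeft (letter a i)) _ _ fun z => by simp [mul_assoc]).symm
    calc ∑ y, (walk a (k + 1) y : ℂ) * g (y * x)
        = (∑ i, ∑ y, (walk a k ((letter a i)⁻¹ * y) : ℂ) * g (y * x)) / 4 := by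
          rw [sum_comm, sum_div]
          refine sum_congr rfl fun y _ => ?_
          rw [walk_succ]
          push_cast
          rw [← sum_mul]
          ring
      _ = ∑ z, (walk a k z : ℂ) * ((∑ i, g (letter a i * (z * x))) / 4) := by
          rw [sum_congr rfl fun i _ => h1 i, sum_comm, sum_div]
          refine sum_congr rfl fun z _ => ?_
          rw [← mul_sum, mul_div_assoc]
      _ = c * ∑ z, (walk a k z : ℂ) * g (z * x) := by
          rw [mul_sum]
          refine sum_congr rfl fun z _ => ?_
          rw [hg]
          ring
      _ = c ^ (k + 1) * g x := by rw [ih]; ring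

lemma sum_walk_one_mul (a : Bool → G) (f : G → ℝ) (x : G) :
    ∑ y, walk a 1 (y * x⁻¹) * f y = (∑ i, f (letter a i * x)) / 4 := by
  classical
  rw [← Fintype.sum_equiv (Equiv.mulRight x) (fun z => walk a 1 z * f (z * x)) _
    fun z => by simp, sum_walk_mul, walkMean_succ]
  simp [walkMean]

variable {F : Type*} [Field F] [Fintype F] [DecidableEq F]

lemma pow_mul_card_le_of_eigenvector (hcast : Function.Surjective (Nat.cast : ℕ → F))
    (a : Bool → SL(2, F)) {c : ℝ} {v : SL(2, F) → ℝ} (hv0 : v ≠ 0) (hsum : ∑ x, v x = 0)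
    (hv : ∀ x, (∑ i, v (letter a i * x)) / 4 = c * v x) (k : ℕ) :
    c ^ (k + k) * (Fintype.card F - 1) ≤ 2 * (Fintype.card SL(2, F) * walk a (k + k) 1) := by
  let V : Submodule ℂ (SL(2, F) → ℂ) :=
    { carrier := {g | (∀ x, (∑ i, g (letter a i * x)) / 4 = c * g x) ∧ ∑ x, g x = 0}
      zero_mem' := by simp
      add_mem' := fun {f g} hf hg => by
        refine ⟨fun x => ?_, ?_⟩
        · simp only [Pi.add_apply, sum_add_distrib, add_div, hf.1, hg.1, mul_add]
        · simp only [Pi.add_apply, sum_add_distrib, hf.2, hg.2, add_zero]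
      smul_mem' := fun r f hf => by
        refine ⟨fun x => ?_, ?_⟩
        · simp only [Pi.smul_apply, smul_eq_mul, ← mul_sum, mul_div_assoc, hf.1]
          ring
        · simp only [Pi.smul_apply, smul_eq_mul, ← mul_sum, hf.2, mul_zero] }
  have hV : ∀ f ∈ V, ∀ g, translate g f ∈ V := by
    refine fun f hf g => ⟨fun x => ?_, ?_⟩
    · simpa [translate_apply, mul_assoc] using hf.1 (x * g)
    · rw [← hf.2]
      exact Fintype.sum_equiv (Equiv.mulRight g) _ _ fun x => rfl
  have hvV : (fun x => (v x : ℂ)) ∈ V := by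
    refine ⟨fun x => ?_, ?_⟩
    · have := congrArg (fun r : ℝ => (r : ℂ)) (hv x)
      push_cast at this
      exact this
    · have := congrArg (fun r : ℝ => (r : ℂ)) hsum
      push_cast at this
      exact this
  have hne : ∃ f ∈ V, f ≠ 0 := ⟨_, hvV, fun h => hv0 (funext fun x => by
    simpa using congrFun h x)⟩
  have hdim := card_sub_one_le_two_mul_finrank hcast hV hne fun f hf => hf.2
  have hdim' : (Fintype.card F : ℝ) - 1 ≤ 2 * Module.finrank ℂ V := by
    have : (Fintype.card F : ℝ) ≤ 2 * Module.finrank ℂ V + 1 := by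
      exact_mod_cast Nat.sub_le_iff_le_add.1 hdim
    linarith
  have hB := finrank_mul_norm_sq_le (fun x y => (walk a k (y * x⁻¹) : ℂ)) V (c := (c : ℂ) ^ k)
    fun f hf x => by
      rw [← sum_walk_mul_eq_pow_mul a hf.1 k x]
      exact (Fintype.sum_equiv (Equiv.mulRight x) _ _ fun z => by simp).symm
  have hQ : ∑ x : SL(2, F), ∑ y, ‖(walk a k (y * x⁻¹) : ℂ)‖ ^ 2 =
      Fintype.card SL(2, F) * walk a (k + k) 1 := by
    rw [walk_two_one, ← nsmul_eq_mul, ← card_univ, ← sum_const]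
    refine sum_congr rfl fun x _ => ?_
    refine (Fintype.sum_equiv (Equiv.mulRight x) _ _ fun z => ?_).symm
    simp
  rw [hQ] at hB
  have hc : ‖(c : ℂ) ^ k‖ ^ 2 = c ^ (k + k) := by
    rw [norm_pow, ← pow_mul, mul_two, Complex.norm_real, Real.norm_eq_abs,
      Even.pow_abs ⟨k, rfl⟩]
  rw [hc] at hB
  have hc0 : 0 ≤ c ^ (k + k) := Even.pow_nonneg ⟨k, rfl⟩ c
  nlinarith [mul_le_mul_of_nonneg_left hdim' hc0]

theorem sum_mul_step_le (hcast : Function.Surjective (Nat.cast : ℕ → F))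
    (a : Bool → SL(2, F)) {k : ℕ} {Λ : ℝ} (hΛ : 0 ≤ Λ)
    (h : 2 * (Fintype.card SL(2, F) * walk a (k + k) 1) < Λ ^ (k + k) * (Fintype.card F - 1))
    {f : SL(2, F) → ℝ} (hf : ∑ x, f x = 0) :
    ∑ x, f x * ((∑ i, f (letter a i * x)) / 4) ≤ Λ * ∑ x, f x ^ 2 := by
  let B : Matrix SL(2, F) SL(2, F) ℝ := Matrix.of fun x y =>
    (if x = y then Λ else 0) - (walk a 1 (y * x⁻¹) - (Fintype.card SL(2, F) : ℝ)⁻¹)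
  have hBv : ∀ v x, (Matrix.mulVec B v) x = Λ * v x -
      ((∑ i, v (letter a i * x)) / 4 - (Fintype.card SL(2, F) : ℝ)⁻¹ * ∑ y, v y) := by
    intro v x
    rw [← sum_walk_one_mul]
    simp [Matrix.mulVec, dotProduct, B, sub_mul, sum_sub_distrib, mul_sum]
  have hB : B.IsHermitian := by
    ext x y
    have : walk a 1 (x * y⁻¹) = walk a 1 (y * x⁻¹) := by
      rw [← walk_inv]; simp
    simp [B, this, eq_comm]
  have hpos : B.PosSemidef := by
    rw [hB.posSemidef_iff_eigenvalues_nonneg]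
    intro j
    by_contra! hj
    change hB.eigenvalues j < 0 at hj
    obtain ⟨μ, hμ⟩ : ∃ μ, μ = hB.eigenvalues j := ⟨_, rfl⟩
    obtain ⟨v, hv⟩ : ∃ v, v = (hB.eigenvectorBasis j).ofLp := ⟨_, rfl⟩
    have hBj := hB.mulVec_eigenvectorBasis j
    rw [← hμ, ← hv] at hBj
    rw [← hμ] at hj
    have hv0 : v ≠ 0 := by
      intro h0
      have := hB.eigenvectorBasis.orthonormal.ne_zero j
      exact this (by ext x; simpa [hv] using congrFun h0 x)
    have hx : ∀ x, (∑ i, v (letter a i * x)) / 4 - (Fintype.card SL(2, F) : ℝ)⁻¹ * ∑ y, v y =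
        (Λ - μ) * v x := by
      intro x
      have := congrFun hBj x
      rw [hBv, Pi.smul_apply, smul_eq_mul] at this
      linarith
    have hs : ∑ x, v x = 0 := by
      have h1 := sum_congr (rfl : (univ : Finset SL(2, F)) = univ) fun x _ => hx x
      rw [sum_sub_distrib, sum_const, card_univ, nsmul_eq_mul, ← mul_assoc, mul_inv_cancel₀
        (by exact_mod_cast Fintype.card_ne_zero), one_mul, ← sum_div, sum_comm,
        ← mul_sum] at h1
      have h2 : ∀ i, ∑ x, v (letter a i * x) = ∑ x, v x := fun i =>
        Fintype.sum_equiv (Equiv.mulLeft (letter a i)) _ _ fun x => rfl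
      rw [sum_congr rfl fun i _ => h2 i, sum_const] at h1
      have h3 : (Λ - μ) * ∑ x, v x = 0 := by
        rw [← h1]
        simp
      rcases mul_eq_zero.1 h3 with h | h
      · linarith
      · exact h
    have hx' : ∀ x, (∑ i, v (letter a i * x)) / 4 = (Λ - μ) * v x := fun x => by
      rw [← hx, hs]; simp
    have h4 := pow_mul_card_le_of_eigenvector hcast a hv0 hs hx' k
    have h5 : Λ ^ (k + k) ≤ (Λ - μ) ^ (k + k) := pow_le_pow_left₀ hΛ (by linarith) _
    have h6 : (1 : ℝ) ≤ Fintype.card F := by exact_mod_cast Fintype.card_pos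
    nlinarith [mul_le_mul_of_nonneg_right h5 (sub_nonneg.2 h6)]
  have h7 := hpos.dotProduct_mulVec_nonneg f
  simp only [dotProduct, hBv, hf, star_trivial, mul_zero, sub_zero, mul_sub, sum_sub_distrib] at h7
  rw [mul_sum]
  have h8 : ∑ x, f x * (Λ * f x) = ∑ x, Λ * f x ^ 2 := sum_congr rfl fun x _ => by ring
  linarith

end Spectral

section Boundary

variable {G : Type*} [Group G] [Fintype G] [DecidableEq G]

lemma mul_card_le_card_boundary (a : Bool → G) {Λ : ℝ} (hΛ : Λ ≤ 1)
    (h : ∀ f : G → ℝ, ∑ x, f x = 0 →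
      ∑ x, f x * ((∑ i, f (letter a i * x)) / 4) ≤ Λ * ∑ x, f x ^ 2)
    {A B : Finset G} (hA : 2 * #A ≤ Fintype.card G)
    (hB : ∀ x ∈ A, ∀ i, letter a i * x ∉ A → letter a i * x ∈ B) :
    (1 - Λ) / 2 * #A ≤ #B := by
  obtain ⟨N, hN⟩ : ∃ N : ℝ, N = Fintype.card G := ⟨_, rfl⟩
  have hN0 : 0 < N := by rw [hN]; exact_mod_cast Fintype.card_pos
  obtain ⟨α, hα⟩ : ∃ α : ℝ, α = #A / N := ⟨_, rfl⟩
  have hαN : α * N = #A := by rw [hα]; field_simp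
  have hα2 : α ≤ 1 / 2 := by
    rw [hα, div_le_iff₀ hN0]
    have : (2 * #A : ℝ) ≤ N := by rw [hN]; exact_mod_cast hA
    linarith
  let f : G → ℝ := fun x => (if x ∈ A then 1 else 0) - α
  have hind : ∑ x, (if x ∈ A then (1 : ℝ) else 0) = #A := by simp
  have hsum : ∀ c : ℝ, ∑ _x : G, c = c * N := fun c => by
    rw [sum_const, card_univ, nsmul_eq_mul, hN, mul_comm]
  have hf0 : ∑ x, f x = 0 := by
    rw [sum_sub_distrib, hind, hsum, hαN, sub_self]
  have hf2 : ∑ x, f x ^ 2 = #A * (1 - α) := by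
    have : ∀ x, f x ^ 2 = (1 - 2 * α) * (if x ∈ A then 1 else 0) + α ^ 2 := by
      intro x
      simp only [f]
      split_ifs <;> ring
    rw [sum_congr rfl fun x _ => this x, sum_add_distrib, ← mul_sum, hind, hsum, pow_two,
      mul_assoc, hαN]
    ring
  have hi : ∀ i, #A - #B - α * #A ≤ ∑ x, f x * f (letter a i * x) := by
    intro i
    have e : ∀ x, f x * f (letter a i * x) =
        (if x ∈ A then if letter a i * x ∈ A then 1 else 0 else 0) -
          α * (if x ∈ A then 1 else 0) - α * f (letter a i * x) := by
      intro x
      simp only [f]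
      split_ifs <;> ring
    have hshift : ∑ x, f (letter a i * x) = 0 := by
      rw [← hf0]
      exact Fintype.sum_equiv (Equiv.mulLeft (letter a i)) _ _ fun x => rfl
    rw [sum_congr rfl fun x _ => e x, sum_sub_distrib, sum_sub_distrib, ← mul_sum, ← mul_sum,
      hshift, hind, mul_zero, sub_zero]
    have h1 : ∑ x, (if x ∈ A then if letter a i * x ∈ A then (1 : ℝ) else 0 else 0) =
        #{x ∈ A | letter a i * x ∈ A} := by
      rw [← sum_filter]
      simp
    have h2 : #{x ∈ A | letter a i * x ∉ A} ≤ #B :=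
      card_le_card_of_injOn (letter a i * ·)
        (fun x hx => hB x (mem_filter.1 hx).1 i (mem_filter.1 hx).2)
        fun x _ y _ hxy => mul_left_cancel hxy
    have h3 := card_filter_add_card_filter_not (s := A) fun x => letter a i * x ∈ A
    have h4 : (#{x ∈ A | letter a i * x ∈ A} : ℝ) + #{x ∈ A | letter a i * x ∉ A} = #A := by
      exact_mod_cast h3
    have h5 : (#{x ∈ A | letter a i * x ∉ A} : ℝ) ≤ #B := by exact_mod_cast h2
    rw [h1]
    linarith
  have hkey := h f hf0
  have hswap : ∑ x, f x * ((∑ i, f (letter a i * x)) / 4) =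
      (∑ i, ∑ x, f x * f (letter a i * x)) / 4 := by
    rw [sum_comm, sum_div]
    refine sum_congr rfl fun x _ => ?_
    rw [← mul_sum, mul_div_assoc]
  have hge : #A - #B - α * #A ≤ (∑ i, ∑ x, f x * f (letter a i * x)) / 4 := by
    have := sum_le_sum fun i (_ : i ∈ (univ : Finset (Bool × Bool))) => hi i
    rw [sum_const, card_univ, nsmul_eq_mul] at this
    have h4 : ((Fintype.card (Bool × Bool) : ℕ) : ℝ) = 4 := by norm_num
    rw [h4] at this
    linarith
  rw [hswap, hf2] at hkey
  have h0 : (0 : ℝ) ≤ #A := by positivity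
  nlinarith [mul_nonneg (mul_nonneg h0 (sub_nonneg.2 hΛ)) (sub_nonneg.2 hα2)]

end Boundary

section Girth

lemma cons_isCycle_of_isPath {V : Type*} {Γ : SimpleGraph V} {u v : V} (h : Γ.Adj u v)
    {p : Γ.Walk v u} (hp : p.IsPath) (hlen : 2 ≤ p.length) :
    (SimpleGraph.Walk.cons h p).IsCycle := by
  rw [SimpleGraph.Walk.cons_isCycle_iff]
  refine ⟨hp, fun he => ?_⟩
  cases p with
  | nil => simp at hlen
  | cons h' q =>
    rw [SimpleGraph.Walk.cons_isPath_iff] at hp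
    rw [SimpleGraph.Walk.edges_cons, List.mem_cons] at he
    rcases he with he | he
    · rw [Sym2.eq_iff] at he
      rcases he with ⟨rfl, _⟩ | ⟨rfl, _⟩
      · exact h.ne rfl
      · rw [SimpleGraph.Walk.length_cons] at hlen
        have := SimpleGraph.Walk.length_eq_zero_iff.2 (SimpleGraph.Walk.isPath_iff_nil.1 hp.1)
        omega
    · exact hp.2 (q.snd_mem_support_of_mem_edges he)

variable {G : Type*} [Group G] {S : Set G} {a : Bool → G}

lemma cayleyGraph_adj_letter (ha : ∀ i, letter a i ∈ S) (ha1 : ∀ i, letter a i ≠ 1)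
    (i : Bool × Bool) (x : G) : (cayleyGraph G S).Adj (letter a i * x) x := by
  rw [cayleyGraph, SimpleGraph.fromRel_adj]
  exact ⟨fun h => ha1 i (by simpa using h), Or.inl ⟨_, ha i, rfl⟩⟩

/-- Words all of whose proper pieces are nontrivial trace out paths in the Cayley graph. -/
lemma exists_path_of_word (ha : ∀ i, letter a i ∈ S) (ha1 : ∀ i, letter a i ≠ 1)
    (L : List (Bool × Bool)) (hL : ∀ M, M <:+: L → M ≠ [] → (M.map (letter a)).prod ≠ 1) :
    ∀ g, (L.map (letter a)).prod = g → ∃ p : (cayleyGraph G S).Walk g 1, p.IsPath ∧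
      p.length = L.length ∧ ∀ x ∈ p.support, ∃ M, M <:+ L ∧ (M.map (letter a)).prod = x := by
  induction L with
  | nil =>
    rintro g rfl
    refine ⟨(SimpleGraph.Walk.nil : (cayleyGraph G S).Walk 1 1), .nil, rfl, fun x hx => ?_⟩
    exact ⟨[], List.suffix_rfl, (List.mem_singleton.1 hx).symm⟩
  | cons i L ih =>
    intro g hg
    obtain ⟨p, hp, hlen, hsupp⟩ :=
      ih (fun M hM => hL M (hM.trans (List.suffix_cons i L).isInfix)) _ rfl
    have hadj := cayleyGraph_adj_letter ha ha1 i (L.map (letter a)).prod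
    rw [← List.prod_cons, ← List.map_cons, hg] at hadj
    refine ⟨.cons hadj p, ?_, by simp [hlen], ?_⟩
    · rw [SimpleGraph.Walk.cons_isPath_iff]
      refine ⟨hp, fun hmem => ?_⟩
      obtain ⟨M, ⟨N, hN⟩, hM⟩ := hsupp _ hmem
      refine hL (i :: N) ⟨[], M, by simp [hN]⟩ (by simp) ?_
      rw [← hg, ← hN, List.map_cons, List.map_append, List.prod_cons, List.prod_append,
        ← mul_assoc] at hM
      rw [List.map_cons, List.prod_cons]
      exact mul_eq_right.1 hM.symm
    · intro x hx
      rw [SimpleGraph.Walk.support_cons, List.mem_cons] at hx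
      rcases hx with rfl | hx
      · exact ⟨i :: L, List.suffix_rfl, hg⟩
      · obtain ⟨M, hM, hMx⟩ := hsupp x hx
        exact ⟨M, hM.trans (List.suffix_cons i L), hMx⟩

lemma lift_mk_eq_prod (a : Bool → G) (L : List (Bool × Bool)) :
    FreeGroup.lift a (FreeGroup.mk L) = (L.map (letter a)).prod := rfl

lemma three_le_norm_of_lift_eq_one (hcomm : ¬ Commute (a false) (a true))
    (hsq : ∀ i, a i * a i ≠ 1) {w : FreeGroup Bool} (hw : w ≠ 1) (h : FreeGroup.lift a w = 1) :
    3 ≤ w.norm := by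
  have ha1 : ∀ i, a i ≠ 1 := fun i hi => hsq i (by simp [hi])
  by_contra! hlt
  rw [FreeGroup.norm] at hlt
  rw [← FreeGroup.mk_toWord (x := w), lift_mk_eq_prod] at h
  have hred := FreeGroup.isReduced_toWord (x := w)
  rw [Ne, ← FreeGroup.toWord_eq_nil_iff] at hw
  rcases hL : w.toWord with _ | ⟨⟨i, s⟩, _ | ⟨⟨j, t⟩, _ | ⟨k, L⟩⟩⟩
  · exact hw hL
  · rw [hL] at h
    have := ha1 i
    cases s <;> simp_all [letter]
  · rw [hL] at h hred
    have hr : i = j → s = t := by simpa using hred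
    have hc' : ¬ Commute (a true) (a false) := fun h => hcomm h.symm
    have h' : letter a (i, s) * letter a (j, t) = 1 := by simpa using h
    have h'' := mul_eq_one_iff_eq_inv.1 h'
    by_cases hij : i = j
    · subst hij
      obtain rfl := hr rfl
      have := hsq i
      cases s
      · apply this
        have : (a i)⁻¹ * (a i)⁻¹ = 1 := h'
        rw [← mul_inv_rev, inv_eq_one] at this
        exact this
      · exact this h'
    · have hcij : ¬ Commute (a i) (a j) := by
        cases i <;> cases j <;> simp_all
      apply hcij
      have : a i = a j ∨ a i = (a j)⁻¹ := by
        rw [letter, letter] at h''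
        cases s <;> cases t <;> simp only [cond_true, cond_false, inv_inv, inv_inj] at h'' <;>
          first | exact Or.inl h'' | exact Or.inr h'' | exact Or.inr (by rw [← h'', inv_inv])
      rcases this with h | h
      · rw [h]
      · rw [h]; exact (Commute.refl _).inv_left
  · rw [hL] at hlt
    simp at hlt
    omega

theorem exists_isCycle_of_relation (ha : ∀ i, letter a i ∈ S)
    (hcomm : ¬ Commute (a false) (a true)) (hsq : ∀ i, a i * a i ≠ 1) {w : FreeGroup Bool}
    (hw : w ≠ 1) (h : FreeGroup.lift a w = 1) :
    ∃ (v : G) (c : (cayleyGraph G S).Walk v v), c.IsCycle ∧ c.length ≤ w.norm := by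
  induction hn : w.norm using Nat.strong_induction_on generalizing w with
  | _ n ih =>
  subst hn
  by_cases hmin : ∃ u : FreeGroup Bool, u ≠ 1 ∧ FreeGroup.lift a u = 1 ∧ u.norm < w.norm
  · obtain ⟨u, hu, hu1, hlt⟩ := hmin
    obtain ⟨v, c, hc, hle⟩ := ih _ hlt hu hu1 rfl
    exact ⟨v, c, hc, hle.trans hlt.le⟩
  push Not at hmin
  have ha1 : ∀ i, letter a i ≠ 1 := by
    rintro ⟨i, s⟩ hi
    apply hsq i
    cases s
    · have : (a i)⁻¹ = 1 := hi
      simp [inv_eq_one.1 this]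
    · have : a i = 1 := hi
      simp [this]
  have h3 := three_le_norm_of_lift_eq_one hcomm hsq hw h
  have hred := FreeGroup.isReduced_toWord (x := w)
  rcases hL : w.toWord with _ | ⟨i, L⟩
  · exact absurd (FreeGroup.toWord_eq_nil_iff.1 hL) hw
  have hnorm : w.norm = L.length + 1 := by rw [FreeGroup.norm, hL, List.length_cons]
  rw [hL] at hred
  have hpieces : ∀ M, M <:+: L → M ≠ [] → (M.map (letter a)).prod ≠ 1 := by
    intro M hM hM0 hprod
    have hMred : FreeGroup.IsReduced M := by
      obtain ⟨X, Y, hXY⟩ := hM.trans (List.suffix_cons i L).isInfix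
      rw [← hXY] at hred
      exact (List.isChain_append.1 (List.isChain_append.1 hred).1).2.1
    have hMw : (FreeGroup.mk M).toWord = M := by rw [FreeGroup.toWord_mk, hMred.reduce_eq]
    have := hmin (FreeGroup.mk M) (fun h1 => hM0 (by
      rw [← hMw, h1, FreeGroup.toWord_one])) hprod
    rw [hnorm, FreeGroup.norm, hMw] at this
    have := hM.length_le
    omega
  obtain ⟨p, hp, hlen, -⟩ := exists_path_of_word ha ha1 L hpieces _ rfl
  have hprod : letter a i * (L.map (letter a)).prod = 1 := by
    rw [← FreeGroup.mk_toWord (x := w), lift_mk_eq_prod, hL] at h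
    simpa using h
  have hadj := cayleyGraph_adj_letter ha ha1 i (L.map (letter a)).prod
  rw [hprod] at hadj
  exact ⟨1, .cons hadj p, cons_isCycle_of_isPath hadj hp (by omega), by simp [hlen, hnorm]⟩

end Girth

section Scales

variable {F : Type*} [Field F] [Fintype F] [DecidableEq F]

lemma card_le_card_pow_four :
    Fintype.card SL(2, F) ≤ Fintype.card F ^ 4 := by
  have h := Fintype.card_le_of_injective
    (fun g : SL(2, F) => ((g.1 0 0, g.1 0 1), (g.1 1 0, g.1 1 1))) fun g h hgh => by
      simp only [Prod.mk.injEq] at hgh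
      exact ext_entries hgh.1.1 hgh.1.2 hgh.2.1 hgh.2.2
  rw [Fintype.card_prod, Fintype.card_prod] at h
  exact h.trans (le_of_eq (by ring))

lemma card_pow_three_le_two_mul_card : Fintype.card F ^ 3 ≤ 2 * Fintype.card SL(2, F) := by
  have h : Fintype.card (Fˣ × F × F) ≤ Fintype.card SL(2, F) := Fintype.card_le_of_injective
    (fun t : Fˣ × F × F => (⟨!![(t.1 : F), t.2.1; t.2.2, (1 + t.2.1 * t.2.2) / t.1], by
      rw [Matrix.det_fin_two_of, mul_div_cancel₀ _ t.1.ne_zero]; ring⟩ : SL(2, F)))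
    fun s t hst => by
      have h := congrArg Subtype.val hst
      have h00 : (s.1 : F) = t.1 := congrFun (congrFun h 0) 0
      have h01 : s.2.1 = t.2.1 := congrFun (congrFun h 0) 1
      have h10 : s.2.2 = t.2.2 := congrFun (congrFun h 1) 0
      exact Prod.ext (Units.ext h00) (Prod.ext h01 h10)
  rw [Fintype.card_prod, Fintype.card_prod, Fintype.card_units] at h
  have h2 : 2 ≤ Fintype.card F := Fintype.one_lt_card
  obtain ⟨q, hq⟩ := Nat.exists_eq_add_of_le' h2
  rw [hq] at h ⊢
  simp only [Nat.add_succ_sub_one] at h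
  nlinarith

lemma one_le_card_mul_walk (a : Bool → SL(2, F)) (n : ℕ) :
    1 ≤ Fintype.card SL(2, F) * walk a (n + n) 1 := by
  rw [← sum_walk a (n + n), ← nsmul_eq_mul, ← card_univ, ← sum_const]
  exact sum_le_sum fun x _ => walk_two_le a n x

/-- At some scale the return probability is essentially as small as equidistribution allows. -/
lemma exists_scale (hcast : Function.Surjective (Nat.cast : ℕ → F)) (hF : (2 : F) ≠ 0)
    (a : Bool → SL(2, F)) {k : ℕ} {R β : ℝ} (hR : 2 ≤ R) (hβ0 : 0 ≤ β)
    (hβ : R ^ 18000 * β < 1)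
    (hNC : ∀ (H : Subgroup SL(2, F)) [DecidablePred (· ∈ H)], IsMetabelian H →
      walkMean a (k + k) (fun x => if x ∈ H then 1 else 0) ≤ β ^ 2)
    {J : ℕ} (hJ : (Fintype.card F : ℝ) ^ 4 ≤ R ^ J) :
    ∃ n ≤ 4 ^ J * k, (Fintype.card SL(2, F) : ℝ) ^ 3 * walk a (n + n) 1 ^ 2 ≤
      R ^ 45300 * (Fintype.card F : ℝ) ^ 3 := by
  have hR0 : 0 < R := by linarith
  by_contra! hcon
  have hdecay : ∀ j ≤ J, R ^ j * walk a (4 ^ j * k + 4 ^ j * k) 1 ≤ 1 ∧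
      (0 < j → R ^ j * walk a (4 ^ j * k + 4 ^ j * k) 1 < 1) := by
    intro j
    induction j with
    | zero =>
      intro _
      refine ⟨?_, fun h => absurd h (lt_irrefl _)⟩
      rw [pow_zero, one_mul, ← sum_walk a (4 ^ 0 * k + 4 ^ 0 * k)]
      exact single_le_sum (f := walk a (4 ^ 0 * k + 4 ^ 0 * k)) (fun x _ => walk_nonneg a _ x)
        (mem_univ 1)
    | succ j ih =>
      intro hj
      have h1 := (ih (by omega)).1
      have hle : 4 ^ j * k ≤ 4 ^ J * k :=
        Nat.mul_le_mul_right _ (Nat.pow_le_pow_right (by norm_num) (by omega))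
      have hbad := hcon _ hle
      have hk : k ≤ 4 ^ j * k + 4 ^ j * k := by
        have := Nat.one_le_pow j 4 (by norm_num)
        nlinarith
      have h2 : R * walk a (4 ^ (j + 1) * k + 4 ^ (j + 1) * k) 1 <
          walk a (4 ^ j * k + 4 ^ j * k) 1 := by
        by_contra! h
        refine absurd (card_pow_mul_walk_sq_le hcast hF a hk hR hβ0 hβ hNC
          (h.trans (le_of_eq ?_))) (not_le.2 hbad)
        rw [pow_succ]
        congr 2
        ring
      have h3 : R ^ (j + 1) * walk a (4 ^ (j + 1) * k + 4 ^ (j + 1) * k) 1 < 1 := by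
        rw [pow_succ, mul_assoc]
        exact (mul_lt_mul_of_pos_left h2 (pow_pos hR0 j)).trans_le h1
      exact ⟨h3.le, fun _ => h3⟩
  have hq : (2 : ℝ) ≤ Fintype.card F := by exact_mod_cast (Fintype.one_lt_card : 1 < Fintype.card F)
  have hJ0 : 0 < J := by
    rcases Nat.eq_zero_or_pos J with rfl | h
    · rw [pow_zero] at hJ
      have : (2 : ℝ) ^ 4 ≤ (Fintype.card F : ℝ) ^ 4 := by gcongr
      norm_num at this
      linarith
    · exact h
  have h1 := (hdecay J le_rfl).2 hJ0
  have h2 := one_le_card_mul_walk a (4 ^ J * k)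
  have h3 : (Fintype.card SL(2, F) : ℝ) ≤ R ^ J :=
    le_trans (by exact_mod_cast card_le_card_pow_four) hJ
  have h4 := mul_le_mul_of_nonneg_right h3 (walk_nonneg a (4 ^ J * k + 4 ^ J * k) 1)
  linarith

end Scales

section Gap

lemma metabelian_decay {δ L : ℝ} {E k : ℕ} (hE : 10 ^ 8 ≤ E * δ) (hE0 : 0 < (E : ℝ))
    (hL : (E : ℝ) ≤ L) (hk : δ * L / 41 - 1 ≤ k) :
    Real.exp (L / E) ^ 36000 * ((2 * ((k + k : ℕ) : ℝ) + 1) * (√3 / 2) ^ (k + k)) < 1 := by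
  have h1 : (√3 / 2) ^ (k + k) ≤ Real.exp (-(k / 4)) := by
    have : (√3 / 2) ^ 2 = 3 / 4 := by
      rw [div_pow, Real.sq_sqrt (by norm_num)]; norm_num
    rw [← two_mul, pow_mul, this]
    have h2 : (3 / 4 : ℝ) ≤ Real.exp (-(1 / 4)) := by
      have := Real.add_one_le_exp (-(1 / 4) : ℝ)
      linarith
    calc (3 / 4 : ℝ) ^ k ≤ Real.exp (-(1 / 4)) ^ k := by gcongr
      _ = Real.exp (-(k / 4)) := by rw [← Real.exp_nat_mul]; congr 1; ring
  have h2 : 2 * ((k + k : ℕ) : ℝ) + 1 ≤ Real.exp 5 * Real.exp (k / 16) := by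
    have h3 := Real.add_one_le_exp ((k : ℝ) / 16)
    have h4 : (64 : ℝ) ≤ Real.exp 5 := by
      have := Real.add_one_le_exp (5 / 4 : ℝ)
      have h5 : Real.exp 5 = Real.exp (5 / 4) ^ 4 := by
        rw [← Real.exp_nat_mul]; norm_num
      have h6 := Real.exp_one_gt_d9
      have h7 : Real.exp 5 = Real.exp 1 ^ 5 := by
        rw [← Real.exp_nat_mul]; norm_num
      rw [h7]
      calc (64 : ℝ) ≤ 2.7 ^ 5 := by norm_num
        _ ≤ Real.exp 1 ^ 5 := by gcongr; linarith
    have hk0 : (0 : ℝ) ≤ k := Nat.cast_nonneg k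
    push_cast
    calc 2 * ((k : ℝ) + k) + 1 ≤ 64 * (k / 16 + 1) := by linarith
      _ ≤ _ := by gcongr
  have h3 : Real.exp (L / E) ^ 36000 = Real.exp (36000 * (L / E)) := by
    rw [← Real.exp_nat_mul]; norm_num
  rw [h3]
  have hδ : 0 < δ := by
    by_contra! h
    nlinarith
  have hL0 : 0 < L := hE0.trans_le hL
  have h4 : 36000 * (L / E) ≤ δ * L / 1000 := by
    rw [← mul_div_assoc, div_le_div_iff₀ hE0 (by norm_num)]
    nlinarith
  have h5 : 10 ^ 8 ≤ δ * L := by nlinarith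
  calc Real.exp (36000 * (L / E)) * ((2 * ((k + k : ℕ) : ℝ) + 1) * (√3 / 2) ^ (k + k))
      ≤ Real.exp (36000 * (L / E)) * (Real.exp 5 * Real.exp (k / 16) * Real.exp (-(k / 4))) := by
        gcongr
    _ = Real.exp (36000 * (L / E) + (5 + k / 16 + -(k / 4))) := by
        rw [← Real.exp_add, ← Real.exp_add, ← Real.exp_add]
    _ < 1 := by
        rw [Real.exp_lt_one_iff]
        linarith

lemma two_mul_mul_lt_of_sq_le {N M P X Y q : ℝ} (hN0 : 0 < N) (hX2 : 2 ≤ X)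
    (hq : q = X ^ 4) (hNq : q ^ 3 ≤ 2 * N) (hM : N ^ 3 * M ^ 2 ≤ P * q ^ 3) (hPX : P ≤ X ^ 2)
    (hY : 1 ≤ Y * X) : 2 * (N * M) < Y * (q - 1) := by
  have hX0 : 0 < X := by linarith
  have hq0 : 0 < q := by rw [hq]; positivity
  have hsq : (2 * (N * M)) ^ 2 ≤ 8 * X ^ 2 := by
    refine le_of_mul_le_mul_right ?_ hN0
    calc (2 * (N * M)) ^ 2 * N = 4 * (N ^ 3 * M ^ 2) := by ring
      _ ≤ 4 * (P * q ^ 3) := by linarith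
      _ ≤ 4 * (X ^ 2 * (2 * N)) := by
        refine mul_le_mul_of_nonneg_left ?_ (by norm_num)
        exact mul_le_mul hPX hNq (by positivity) (by positivity)
      _ = 8 * X ^ 2 * N := by ring
  have hle : 2 * (N * M) ≤ 3 * X := by
    refine abs_le_of_sq_le_sq' (a := 2 * (N * M)) (b := 3 * X) ?_ (by positivity) |>.2
    nlinarith [sq_nonneg X]
  have hX2' : 4 ≤ X ^ 2 := by nlinarith
  have hX4 : 4 * X ^ 2 ≤ q := by
    rw [hq]
    nlinarith
  refine lt_of_mul_lt_mul_right ?_ hX0.le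
  calc 2 * (N * M) * X ≤ 3 * X * X := by gcongr
    _ < q - 1 := by nlinarith
    _ ≤ Y * X * (q - 1) := by
      refine le_mul_of_one_le_left ?_ hY
      nlinarith
    _ = Y * (q - 1) * X := by ring

variable {F : Type*} [Field F] [Fintype F] [DecidableEq F]

theorem sum_mul_step_le_of_no_relation (hcast : Function.Surjective (Nat.cast : ℕ → F))
    (hF : (2 : F) ≠ 0) {δ : ℝ} {E : ℕ} (hE1 : 10 ^ 5 ≤ E) (hE : 10 ^ 8 ≤ E * δ)
    (hL : (E : ℝ) ≤ Real.log (Fintype.card F)) (a : Bool → SL(2, F))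
    (hrel : ∀ w : FreeGroup Bool, w ≠ 1 → w.norm < δ * Real.log (Fintype.card F) →
      FreeGroup.lift a w ≠ 1) {f : SL(2, F) → ℝ} (hf : ∑ x, f x = 0) :
    ∑ x, f x * ((∑ i, f (letter a i * x)) / 4) ≤
      Real.exp (-(1 / (4 ^ (4 * E) * δ))) * ∑ x, f x ^ 2 := by
  obtain ⟨L, hLdef⟩ : ∃ L, L = Real.log (Fintype.card F) := ⟨_, rfl⟩
  rw [← hLdef] at hL hrel
  have hq0 : (0 : ℝ) < Fintype.card F := by exact_mod_cast Fintype.card_pos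
  have hqL : Real.exp L = Fintype.card F := by rw [hLdef, Real.exp_log hq0]
  have hE1' : (10 : ℝ) ^ 5 ≤ E := by exact_mod_cast hE1
  have hE0 : (0 : ℝ) < E := lt_of_lt_of_le (by norm_num) hE1'
  have hL0 : 0 < L := hE0.trans_le hL
  have hδ : 0 < δ := by
    by_contra! h
    nlinarith
  have hδL : 0 < δ * L := mul_pos hδ hL0
  obtain ⟨k, hk⟩ : ∃ k, k = ⌊δ * L / 41⌋₊ := ⟨_, rfl⟩
  have hk1 : (k : ℝ) ≤ δ * L / 41 := by rw [hk]; exact Nat.floor_le (by positivity)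
  have hk2 : δ * L / 41 - 1 ≤ k := by rw [hk]; linarith [Nat.lt_floor_add_one (δ * L / 41)]
  obtain ⟨γ, hγ⟩ : ∃ γ : ℝ, γ = (2 * ((k + k : ℕ) : ℝ) + 1) * (√3 / 2) ^ (k + k) := ⟨_, rfl⟩
  have hγ0 : 0 ≤ γ := by rw [hγ]; positivity
  have hdecay := metabelian_decay hE hE0 hL hk2
  rw [← hγ] at hdecay
  obtain ⟨R, hR⟩ : ∃ R, R = Real.exp (L / E) := ⟨_, rfl⟩
  rw [← hR] at hdecay
  have hR0 : 0 < R := hR ▸ Real.exp_pos _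
  have hR2 : 2 ≤ R := by
    have h1 : 1 ≤ L / E := (one_le_div hE0).2 hL
    have := Real.add_one_le_exp (L / E)
    rw [hR]
    linarith
  have hpowR : ∀ m : ℕ, R ^ m = Real.exp (m * (L / E)) := fun m => by
    rw [hR, ← Real.exp_nat_mul]
  have hβ : R ^ 18000 * √γ < 1 := by
    have h1 : (R ^ 18000 * √γ) ^ 2 < 1 := by
      rw [mul_pow, Real.sq_sqrt hγ0, ← pow_mul, show 18000 * 2 = 36000 by norm_num]
      exact hdecay
    exact (sq_lt_one_iff₀ (mul_nonneg (pow_nonneg hR0.le _) (Real.sqrt_nonneg _))).1 h1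
  have hNC : ∀ (H : Subgroup SL(2, F)) [DecidablePred (· ∈ H)], IsMetabelian H →
      walkMean a (k + k) (fun x => if x ∈ H then 1 else 0) ≤ √γ ^ 2 := by
    intro H _ hH
    rw [Real.sq_sqrt hγ0, hγ]
    refine walkMean_metabelian_le a H hH (k + k) fun w hw hwn => hrel w hw ?_
    have : (w.norm : ℝ) ≤ 20 * (k + k) := by exact_mod_cast hwn
    linarith
  have hJ : (Fintype.card F : ℝ) ^ 4 ≤ R ^ (4 * E) := by
    rw [hpowR, ← hqL, ← Real.exp_nat_mul]
    refine le_of_eq ?_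
    congr 1
    push_cast
    field_simp
  obtain ⟨n, hn, hM⟩ := exists_scale hcast hF a hR2 (Real.sqrt_nonneg γ) hβ hNC hJ
  refine sum_mul_step_le hcast a (k := n) (Real.exp_pos _).le ?_ hf
  obtain ⟨X, hX⟩ : ∃ X, X = Real.exp (L / 4) := ⟨_, rfl⟩
  have hX0 : 0 < X := hX ▸ Real.exp_pos _
  have hX4 : (Fintype.card F : ℝ) = X ^ 4 := by
    rw [hX, ← hqL, ← Real.exp_nat_mul]
    congr 1
    push_cast
    ring
  have hX2 : 2 ≤ X := by
    have := Real.add_one_le_exp (L / 4)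
    rw [hX]
    linarith
  have hRX : ∀ m : ℕ, 2 * m ≤ E → R ^ m ≤ X ^ 2 := by
    intro m hm
    rw [hpowR, hX, ← Real.exp_nat_mul]
    refine Real.exp_le_exp.2 ?_
    have hm' : 2 * (m : ℝ) ≤ E := by exact_mod_cast hm
    push_cast
    rw [← mul_div_assoc, div_le_iff₀ hE0]
    nlinarith
  have hΛ : 1 ≤ Real.exp (-(1 / (4 ^ (4 * E) * δ))) ^ (n + n) * X := by
    rw [← Real.exp_nat_mul, hX, ← Real.exp_add]
    refine Real.one_le_exp ?_
    have h4 : (0 : ℝ) < 4 ^ (4 * E) := by positivity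
    have hn' : (n : ℝ) ≤ 4 ^ (4 * E) * k := by exact_mod_cast hn
    have h5 : (n : ℝ) * (1 / (4 ^ (4 * E) * δ)) ≤ L / 41 := by
      rw [mul_one_div, div_le_iff₀ (by positivity)]
      refine hn'.trans ?_
      calc (4 : ℝ) ^ (4 * E) * k ≤ 4 ^ (4 * E) * (δ * L / 41) := by gcongr
        _ = _ := by ring
    push_cast
    linarith
  exact two_mul_mul_lt_of_sq_le (by exact_mod_cast Fintype.card_pos) hX2 hX4
    (by exact_mod_cast card_pow_three_le_two_mul_card) hM (hRX _ (by omega)) hΛ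

end Gap

section Generators

lemma eq_univ_of_mul_mem {G : Type*} [Group G] {S A : Set G} (hS : S = S⁻¹)
    (hgen : Subgroup.closure S = ⊤) (hA : A.Nonempty) (h : ∀ s ∈ S, ∀ x ∈ A, s * x ∈ A) :
    A = Set.univ := by
  have key : ∀ g ∈ Subgroup.closure S, ∀ y, y ∈ A ↔ g * y ∈ A := by
    intro g hg
    induction hg using Subgroup.closure_induction with
    | mem s hs =>
      refine fun y => ⟨h s hs y, fun hy => ?_⟩
      rw [hS] at hs
      simpa using h s⁻¹ hs _ hy
    | one => simp
    | mul g h _ _ hg hh => intro y; rw [hh y, hg, mul_assoc]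
    | inv g _ hg => intro y; rw [hg (g⁻¹ * y), mul_inv_cancel_left]
  obtain ⟨x, hx⟩ := hA
  refine Set.eq_univ_of_forall fun y => ?_
  have := (key (y * x⁻¹) (by rw [hgen]; trivial) x).1 hx
  simpa using this

lemma exists_not_commute {G : Type*} [Group G] {S : Set G} (hgen : Subgroup.closure S = ⊤)
    {g h : G} (hgh : ¬ Commute g h) : ∃ s ∈ S, ∃ t ∈ S, ¬ Commute s t := by
  by_contra! hcon
  have h1 : Subgroup.closure S ≤ Subgroup.centralizer S := by
    rw [Subgroup.closure_le]
    exact fun t ht s hs => hcon s hs t ht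
  have h2 : Subgroup.closure S ≤ Subgroup.center G := by
    rw [Subgroup.closure_le]
    intro s hs
    refine Subgroup.mem_center_iff.2 fun x => ?_
    have hx : x ∈ Subgroup.centralizer S := h1 (by rw [hgen]; trivial)
    exact (Subgroup.mem_centralizer_iff.1 hx s hs).symm
  have hh : h ∈ Subgroup.center G := h2 (by rw [hgen]; trivial)
  exact hgh (Subgroup.mem_center_iff.1 hh g)

variable {F : Type*} [Field F]

lemma isScalar_of_mul_self_eq_one (hF : (2 : F) ≠ 0) {g : SL(2, F)} (hg : g * g = 1) :
    IsScalar g := by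
  have h : g = g⁻¹ := eq_inv_of_mul_eq_one_left hg
  have h0 : ∀ x : F, x = -x → x = 0 := fun x hx => by
    have : 2 * x = 0 := by linear_combination hx
    exact (mul_eq_zero.1 this).resolve_left hF
  have hinv := Matrix.SpecialLinearGroup.SL2_inv_expl g
  rw [← h] at hinv
  have h' := congrArg Subtype.val hinv
  have h00 : g.1 0 0 = g.1 1 1 := congrFun (congrFun h' 0) 0
  have h01 : g.1 0 1 = -g.1 0 1 := congrFun (congrFun h' 0) 1
  have h10 : g.1 1 0 = -g.1 1 0 := congrFun (congrFun h' 1) 0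
  exact ⟨sub_eq_zero.2 h00, h0 _ h10, h0 _ h01⟩

lemma not_commute_upper_lower : ¬ Commute (upper (1 : F)) (lower 1) := by
  intro h
  have h00 := congrFun (congrFun (congrArg Subtype.val h.eq) 0) 0
  simp [Matrix.SpecialLinearGroup.coe_mul, upper_coe, lower_coe] at h00

lemma mul_card_le_card_boundary_of_girth [Fintype F] [DecidableEq F]
    (hcast : Function.Surjective (Nat.cast : ℕ → F)) (hF : (2 : F) ≠ 0) {δ : ℝ} {E : ℕ}
    (hE1 : 10 ^ 5 ≤ E) (hE : 10 ^ 8 ≤ E * δ) (hL : (E : ℝ) ≤ Real.log (Fintype.card F))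
    {S : Set SL(2, F)} (hS : S = S⁻¹) (hgen : Subgroup.closure S = ⊤)
    (hgirth : ∀ (v : SL(2, F)) (w : (cayleyGraph _ S).Walk v v), w.IsCycle →
      δ * Real.log (Fintype.card F) ≤ w.length)
    {A B : Finset SL(2, F)} (hA : 2 * #A ≤ Fintype.card SL(2, F))
    (hB : ∀ x ∈ A, ∀ s ∈ S, s * x ∉ A → s * x ∈ B) :
    (1 - Real.exp (-(1 / (4 ^ (4 * E) * δ)))) / 2 * #A ≤ #B := by
  have hδ : 0 < δ := by
    by_contra! h
    have : (0 : ℝ) ≤ E := Nat.cast_nonneg E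
    nlinarith
  obtain ⟨s, hs, t, ht, hst⟩ := exists_not_commute hgen (not_commute_upper_lower (F := F))
  let a : Bool → SL(2, F) := fun i => cond i t s
  have ha : ∀ i, letter a i ∈ S := by
    have hinv : ∀ g ∈ S, g⁻¹ ∈ S := fun g hg => by rw [hS] at hg; exact hg
    rintro ⟨_ | _, _ | _⟩
    exacts [hinv s hs, hs, hinv t ht, ht]
  have hsq : ∀ i, a i * a i ≠ 1 := by
    rintro (_ | _) h
    · exact hst ((isScalar_of_mul_self_eq_one hF h).commute t)
    · exact hst ((isScalar_of_mul_self_eq_one hF h).commute s).symm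
  have hrel : ∀ w : FreeGroup Bool, w ≠ 1 → w.norm < δ * Real.log (Fintype.card F) →
      FreeGroup.lift a w ≠ 1 := by
    intro w hw hlt h
    obtain ⟨v, c, hc, hle⟩ := exists_isCycle_of_relation ha hst hsq hw h
    have h1 := hgirth v c hc
    have h2 : (c.length : ℝ) ≤ w.norm := by exact_mod_cast hle
    linarith
  refine mul_card_le_card_boundary a ?_
    (fun f hf => sum_mul_step_le_of_no_relation hcast hF hE1 hE hL a hrel hf) hA
    fun x hx i => hB x hx _ (ha i)
  rw [Real.exp_le_one_iff, neg_nonpos]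
  positivity

end Generators

end BourgainGamburd

/-- **Bourgain–Gamburd**: for every `δ > 0` there is `ε = ε(δ) > 0` such that for
every prime `p` and every symmetric generating set `S` of `G = SL(2,p)`, if the
girth of `Cay(G,S)` is at least `δ·log p` (i.e. every cycle has length at least
`δ·log p`), then `Cay(G,S)` is an `ε`-expander: `|(S·A) \ A| ≥ ε·|A|` for every
`A ⊆ G` with `|A| < |G|/2`. -/
theorem bourgain_gamburd_SL2 (δ : ℝ) (hδ : 0 < δ) :
    ∃ ε > (0 : ℝ),
      ∀ (p : ℕ), p.Prime →
        ∀ S : Set (Matrix.SpecialLinearGroup (Fin 2) (ZMod p)),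
          S = S⁻¹ → Subgroup.closure S = ⊤ →
          (∀ (v : Matrix.SpecialLinearGroup (Fin 2) (ZMod p))
              (w : (cayleyGraph _ S).Walk v v), w.IsCycle → δ * Real.log p ≤ w.length) →
          ∀ A : Set (Matrix.SpecialLinearGroup (Fin 2) (ZMod p)),
            2 * Nat.card ↥A < Nat.card (Matrix.SpecialLinearGroup (Fin 2) (ZMod p)) →
            ε * (Nat.card ↥A : ℝ) ≤ (Nat.card ↥((S * A) \ A) : ℝ) := by
  obtain ⟨E, hEdef⟩ : ∃ E, E = 10 ^ 5 + ⌈10 ^ 8 / δ⌉₊ := ⟨_, rfl⟩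
  have hE1 : 10 ^ 5 ≤ E := by omega
  have hE : 10 ^ 8 ≤ E * δ := by
    rw [← div_le_iff₀ hδ, hEdef]
    push_cast
    linarith [Nat.le_ceil (10 ^ 8 / δ)]
  obtain ⟨c, hc⟩ : ∃ c, c = (1 - Real.exp (-(1 / (4 ^ (4 * E) * δ)))) / 2 := ⟨_, rfl⟩
  have hc0 : 0 < c := by
    have h1 : Real.exp (-(1 / (4 ^ (4 * E) * δ))) < 1 := by
      rw [Real.exp_lt_one_iff, neg_lt_zero]
      positivity
    rw [hc]
    linarith
  refine ⟨min c (Real.exp (-(4 * E))), lt_min hc0 (Real.exp_pos _), ?_⟩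
  intro p hp S hS hgen hgirth A hA
  have : Fact p.Prime := ⟨hp⟩
  have hp0 : (0 : ℝ) < p := by exact_mod_cast hp.pos
  by_cases hL : (E : ℝ) ≤ Real.log p
  · have hp2 : p ≠ 2 := by
      rintro rfl
      have h1 := Real.log_le_sub_one_of_pos hp0
      have h2 : (10 ^ 5 : ℝ) ≤ E := by exact_mod_cast hE1
      have h3 : ((2 : ℕ) : ℝ) - 1 = 1 := by norm_num
      linarith
    have hF : (2 : ZMod p) ≠ 0 :=
      Ring.two_ne_zero (by rw [ZMod.ringChar_zmod_n]; exact hp2)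
    have hcard : Fintype.card (ZMod p) = p := ZMod.card p
    have key := BourgainGamburd.mul_card_le_card_boundary_of_girth (F := ZMod p)
      (ZMod.natCast_zmod_surjective) hF hE1 hE (by rwa [hcard]) hS hgen (by rwa [hcard])
      (A := A.toFinite.toFinset) (B := ((S * A) \ A).toFinite.toFinset)
    rw [← Set.ncard_eq_toFinset_card, ← Set.ncard_eq_toFinset_card, ← hc] at key
    refine (mul_le_mul_of_nonneg_right (min_le_left _ _) (Nat.cast_nonneg _)).trans (key ?_ ?_)
    · rw [← Nat.card_eq_fintype_card]
      exact hA.le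
    · intro x hx s hs hsx
      rw [Set.Finite.mem_toFinset] at hx hsx ⊢
      exact ⟨Set.mul_mem_mul hs hx, hsx⟩
  · push Not at hL
    rcases A.eq_empty_or_nonempty with rfl | hne
    · simp
    have hb : ((S * A) \ A).Nonempty := by
      by_contra hb
      rw [Set.not_nonempty_iff_eq_empty, Set.sdiff_eq_empty] at hb
      have := BourgainGamburd.eq_univ_of_mul_mem hS hgen hne fun s hs x hx =>
        hb (Set.mul_mem_mul hs hx)
      rw [this, Nat.card_univ] at hA
      omega
    have hb1 : (1 : ℝ) ≤ Nat.card ↥((S * A) \ A) := by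
      have := hb.to_subtype
      exact_mod_cast Nat.card_pos
    refine le_trans ?_ hb1
    have h1 : (Nat.card A : ℝ) ≤ (p : ℝ) ^ 4 := by
      have h2 : Nat.card (Matrix.SpecialLinearGroup (Fin 2) (ZMod p)) ≤ p ^ 4 := by
        have h := BourgainGamburd.card_le_card_pow_four (F := ZMod p)
        rw [ZMod.card] at h
        rwa [Nat.card_eq_fintype_card]
      exact_mod_cast (show Nat.card A ≤ p ^ 4 by omega)
    have h3 : (p : ℝ) ^ 4 ≤ Real.exp (4 * E) := by
      rw [← Real.exp_log hp0, ← Real.exp_nat_mul]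
      refine Real.exp_le_exp.2 ?_
      push_cast
      linarith
    calc min c (Real.exp (-(4 * E))) * (Nat.card A : ℝ)
        ≤ Real.exp (-(4 * E)) * Real.exp (4 * E) := by
          gcongr
          · exact min_le_right _ _
          · exact h1.trans h3
      _ = 1 := by rw [← Real.exp_add]; simp
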